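/- Let 0 < γ < 1 and s > 3. Then there exist constants c₁, c₂, c₃ (depending only on s and γ) with the following property. Let R > 4/γ, let B_R ⊂ ℝ³ be the open ball of radius R centred at the origin, let v ∈ L²(B_R;ℝ³) ∩ L^s_{loc}(B_R;ℝ³) and p ∈ L¹_{loc}(B_R) satisfy the distributional identity ∫_{B_R} p·Δφ dx = −∫_{B_R} v_i v_j · ∂_i∂_j φ dx for all φ ∈ C_c^∞(B_R) (summation over i,j = 1,2,3; i.e. Δp = −∂_i∂_j(v_i v_j) in the sense of distributions). Then ∫_{3<|x|<4} |p|^{s/2} dx ≤ c₁ ( ∫_{|x|<1} |v|² dx )^{s/2} + c₂ ∫_{1<|x|<R} |v|^s dx + c₃ ( R^{−3} ∫_{γR<|x|<R} ( |v|² + |p| ) dx )^{s/2}, the inequality being understood in [0,∞]. -/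

import Mathlib

open MeasureTheory Set
open scoped ENNReal

noncomputable section

/-- ℝ³ as a Euclidean space. -/
abbrev E3 := EuclideanSpace ℝ (Fin 3)

/-- The `i`-th standard basis vector of ℝ³. -/
def e3 (i : Fin 3) : E3 := EuclideanSpace.single i 1

/-- Partial derivative in the `i`-th coordinate direction. -/
def pd {F : Type*} [NormedAddCommGroup F] [NormedSpace ℝ F]
    (i : Fin 3) (f : E3 → F) (x : E3) : F :=
  fderiv ℝ f x (e3 i)

/-! ### A convex function with quantified convexity away from the origin -/

/-- The Euclidean length of `(1, a, b)`. -/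
def japanese (a b : ℝ) : ℝ := √(1 + a ^ 2 + b ^ 2)

/-- A convex function of linear growth vanishing near the origin. -/
def cutoffConvex (a b : ℝ) : ℝ := max 0 (japanese a b - 2)

/-- The scalar factor of a subgradient of `cutoffConvex`. -/
def cutoffSlope (a b : ℝ) : ℝ := if 2 ≤ japanese a b then 1 / japanese a b else 0

lemma japanese_sq (a b : ℝ) : japanese a b ^ 2 = 1 + a ^ 2 + b ^ 2 :=
  Real.sq_sqrt (by positivity)

lemma one_le_japanese (a b : ℝ) : 1 ≤ japanese a b :=
  Real.one_le_sqrt.2 (by nlinarith [sq_nonneg a, sq_nonneg b])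

lemma japanese_le (a b : ℝ) : japanese a b ≤ 1 + |a| + |b| := by
  refine Real.sqrt_le_iff.2 ⟨by positivity, ?_⟩
  nlinarith [sq_abs a, sq_abs b, abs_nonneg a, abs_nonneg b,
    mul_nonneg (abs_nonneg a) (abs_nonneg b)]

lemma abs_le_japanese_left (a b : ℝ) : |a| ≤ japanese a b := by
  refine Real.le_sqrt_of_sq_le ?_
  nlinarith [sq_abs a, sq_nonneg b]

lemma abs_le_japanese_right (a b : ℝ) : |b| ≤ japanese a b := by
  refine Real.le_sqrt_of_sq_le ?_
  nlinarith [sq_abs b, sq_nonneg a]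

lemma cutoffConvex_nonneg (a b : ℝ) : 0 ≤ cutoffConvex a b := le_max_left _ _

lemma cutoffConvex_le (a b : ℝ) : cutoffConvex a b ≤ |a| + |b| := by
  have := japanese_le a b
  refine max_le (by positivity) (by linarith)

lemma japanese_lt_two {a b : ℝ} (ha : |a| ≤ 1) (hb : |b| ≤ 1) : japanese a b < 2 := by
  refine (Real.sqrt_lt' (by norm_num)).2 ?_
  nlinarith [sq_abs a, sq_abs b, abs_nonneg a, abs_nonneg b]

lemma cutoffConvex_eq_zero {a b : ℝ} (ha : |a| ≤ 1) (hb : |b| ≤ 1) : cutoffConvex a b = 0 :=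
  max_eq_left (by linarith [japanese_lt_two ha hb])

lemma cutoffSlope_eq_zero {a b : ℝ} (ha : |a| ≤ 1) (hb : |b| ≤ 1) : cutoffSlope a b = 0 :=
  if_neg (by linarith [japanese_lt_two ha hb])

lemma abs_mul_cutoffSlope_left_le (a b : ℝ) : |a * cutoffSlope a b| ≤ 1 := by
  unfold cutoffSlope
  have h := one_le_japanese a b
  split_ifs
  · rw [mul_one_div, abs_div, abs_of_pos (by linarith : 0 < japanese a b), div_le_one (by linarith)]
    exact abs_le_japanese_left a b
  · simp

lemma abs_mul_cutoffSlope_right_le (a b : ℝ) : |b * cutoffSlope a b| ≤ 1 := by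
  unfold cutoffSlope
  have h := one_le_japanese a b
  split_ifs
  · rw [mul_one_div, abs_div, abs_of_pos (by linarith : 0 < japanese a b), div_le_one (by linarith)]
    exact abs_le_japanese_right a b
  · simp

/-- Quantified convexity of the Euclidean length of `(1, a, b)`. -/
lemma japanese_bregman (a b a' b' : ℝ) :
    |a' - a| * |b' - b| / (japanese a b ^ 2 * japanese a' b') ≤
      japanese a' b' - japanese a b
        - (a * (a' - a) + b * (b' - b)) / japanese a b := by
  have h1 := one_le_japanese a b
  have h2 := one_le_japanese a' b'
  have s1 := japanese_sq a b
  have s2 := japanese_sq a' b'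
  set g := japanese a b
  set g' := japanese a' b'
  have hg : 0 < g := by linarith
  have hg' : 0 < g' := by linarith
  set P := 1 + a * a' + b * b' with hP
  have e : g' - g - (a * (a' - a) + b * (b' - b)) / g = (g * g' - P) / g := by
    field_simp
    linear_combination (-1) * s1 + hP
  have hD : (a' - a) ^ 2 + (b' - b) ^ 2 ≤ (g * g' - P) * (g * g' + P) := by
    have : (g * g' - P) * (g * g' + P) = g ^ 2 * g' ^ 2 - P ^ 2 := by ring
    rw [this, s1, s2, hP]
    nlinarith [sq_nonneg (a * b' - b * a')]
  have hP2 : P ≤ g * g' := by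
    by_contra! h
    have : 0 < g * g' := by positivity
    nlinarith [sq_nonneg (a' - a), sq_nonneg (b' - b)]
  have hAB : 2 * (|a' - a| * |b' - b|) ≤ (a' - a) ^ 2 + (b' - b) ^ 2 := by
    nlinarith [sq_abs (a' - a), sq_abs (b' - b), sq_nonneg (|a' - a| - |b' - b|)]
  rw [e, div_le_div_iff₀ (by positivity) hg]
  have : |a' - a| * |b' - b| ≤ (g * g' - P) * (g * g') := by nlinarith
  nlinarith

lemma cutoffConvex_subgradient (a b a' b' : ℝ) :
    0 ≤ cutoffConvex a' b' - cutoffConvex a b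
        - (a * cutoffSlope a b * (a' - a) + b * cutoffSlope a b * (b' - b)) := by
  unfold cutoffSlope
  split_ifs with h
  · have := japanese_bregman a b a' b'
    have h1 : cutoffConvex a b = japanese a b - 2 := max_eq_right (by linarith)
    have h2 : japanese a' b' - 2 ≤ cutoffConvex a' b' := le_max_right _ _
    have hg := one_le_japanese a b
    have hg' := one_le_japanese a' b'
    have : 0 ≤ |a' - a| * |b' - b| / (japanese a b ^ 2 * japanese a' b') := by positivity
    have e : a * (1 / japanese a b) * (a' - a) + b * (1 / japanese a b) * (b' - b)
        = (a * (a' - a) + b * (b' - b)) / japanese a b := by ring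
    rw [e]; linarith
  · have h1 : cutoffConvex a b = 0 := max_eq_left (by linarith)
    simp [h1, cutoffConvex_nonneg]

lemma cutoffConvex_bregman {K a b a' b' : ℝ} (hK : 1 ≤ K)
    (ha : |a| ≤ K) (hb : |b| ≤ K) (ha' : |a'| ≤ K) (hb' : |b'| ≤ K)
    (hlarge : 4 ≤ |a| ∨ 4 ≤ |b| ∨ 4 ≤ |a'| ∨ 4 ≤ |b'|) :
    |a' - a| * |b' - b| / (27 * K ^ 3) ≤ cutoffConvex a' b' - cutoffConvex a b
        - (a * cutoffSlope a b * (a' - a) + b * cutoffSlope a b * (b' - b)) := by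
  have hA := abs_mul_cutoffSlope_left_le a b
  have hda : |a' - a| ≤ 2 * K := (abs_sub _ _).trans (by linarith)
  have hdb : |b' - b| ≤ 2 * K := (abs_sub _ _).trans (by linarith)
  have hg := one_le_japanese a b
  have hg' := one_le_japanese a' b'
  have hgK : japanese a b ≤ 3 * K := (japanese_le a b).trans (by linarith)
  have hgK' : japanese a' b' ≤ 3 * K := (japanese_le a' b').trans (by linarith)
  unfold cutoffSlope
  split_ifs with h
  · have := japanese_bregman a b a' b'
    have h1 : cutoffConvex a b = japanese a b - 2 := max_eq_right (by linarith)
    have h2 : japanese a' b' - 2 ≤ cutoffConvex a' b' := le_max_right _ _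
    have h3 : |a' - a| * |b' - b| / (27 * K ^ 3) ≤
        |a' - a| * |b' - b| / (japanese a b ^ 2 * japanese a' b') := by
      apply div_le_div_of_nonneg_left (by positivity) (by positivity)
      calc japanese a b ^ 2 * japanese a' b' ≤ (3 * K) ^ 2 * (3 * K) := by gcongr
        _ = 27 * K ^ 3 := by ring
    have e : a * (1 / japanese a b) * (a' - a) + b * (1 / japanese a b) * (b' - b)
        = (a * (a' - a) + b * (b' - b)) / japanese a b := by ring
    rw [e]; linarith
  · push Not at h
    have h1 : cutoffConvex a b = 0 := max_eq_left (by linarith)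
    have h2 : japanese a' b' - 2 ≤ cutoffConvex a' b' := le_max_right _ _
    have h4 : 4 ≤ japanese a' b' := by
      rcases hlarge with h5 | h5 | h5 | h5
      · linarith [abs_le_japanese_left a b]
      · linarith [abs_le_japanese_right a b]
      · linarith [abs_le_japanese_left a' b']
      · linarith [abs_le_japanese_right a' b']
    have h5 : |a' - a| * |b' - b| / (27 * K ^ 3) ≤ 2 := by
      rw [div_le_iff₀ (by positivity)]
      calc |a' - a| * |b' - b| ≤ (2 * K) * (2 * K) := by gcongr
        _ ≤ 2 * (27 * K ^ 3) := by nlinarith [sq_nonneg K]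
    simp [h1]
    linarith

lemma continuous_japanese : Continuous fun z : ℝ × ℝ => japanese z.1 z.2 := by
  unfold japanese; fun_prop

lemma continuous_cutoffConvex : Continuous fun z : ℝ × ℝ => cutoffConvex z.1 z.2 :=
  continuous_const.max (continuous_japanese.sub continuous_const)

lemma measurable_cutoffSlope : Measurable fun z : ℝ × ℝ => cutoffSlope z.1 z.2 := by
  unfold cutoffSlope
  refine Measurable.ite ?_ ?_ measurable_const
  · exact measurableSet_le measurable_const continuous_japanese.measurable
  · exact continuous_japanese.measurable.const_div 1

/-! ### A Bellman function for bilinear forms on `L^p × L^q` -/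

lemma abs_mul_rpow_neg_le {p x l m : ℝ} (hp : 0 < p) (hl : 0 < l) (h : |x| ^ p ≤ m * l)
    (hm : 0 ≤ m) : |x * l ^ (-1 / p)| ≤ m ^ (1 / p) := by
  have h1 : |x| = (|x| ^ p) ^ (1 / p) := by
    rw [← Real.rpow_mul (abs_nonneg x), mul_one_div_cancel hp.ne', Real.rpow_one]
  rw [abs_mul, abs_of_pos (Real.rpow_pos_of_pos hl _), h1, neg_div, Real.rpow_neg hl.le]
  rw [← div_eq_mul_inv, div_le_iff₀ (by positivity), ← Real.mul_rpow hm hl.le]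
  gcongr

lemma le_abs_mul_rpow_neg {p x l m : ℝ} (hp : 0 < p) (hl : 0 < l) (h : m * l ≤ |x| ^ p)
    (hm : 0 ≤ m) : m ^ (1 / p) ≤ |x * l ^ (-1 / p)| := by
  have h1 : |x| = (|x| ^ p) ^ (1 / p) := by
    rw [← Real.rpow_mul (abs_nonneg x), mul_one_div_cancel hp.ne', Real.rpow_one]
  rw [abs_mul, abs_of_pos (Real.rpow_pos_of_pos hl _), h1, neg_div, Real.rpow_neg hl.le]
  rw [← div_eq_mul_inv, le_div_iff₀ (by positivity), ← Real.mul_rpow hm hl.le]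
  gcongr

/-- The mass of the Bellman function at scale `l`. -/
def bellmanLayer (p q ξ η l : ℝ) : ℝ := cutoffConvex (ξ * l ^ (-1 / p)) (η * l ^ (-1 / q))

/-- The slope of the Bellman function at scale `l`. -/
def bellmanSlope (p q ξ η l : ℝ) : ℝ := cutoffSlope (ξ * l ^ (-1 / p)) (η * l ^ (-1 / q))

/-- The Bellman function. -/
def bellman (p q ξ η : ℝ) : ℝ := ∫ l in Ioi (0 : ℝ), bellmanLayer p q ξ η l

lemma measurable_bellmanLayer (p q : ℝ) :
    Measurable fun w : (ℝ × ℝ) × ℝ => bellmanLayer p q w.1.1 w.1.2 w.2 :=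
  continuous_cutoffConvex.measurable.comp
    (g := fun z : ℝ × ℝ => cutoffConvex z.1 z.2)
    (f := fun w : (ℝ × ℝ) × ℝ => (w.1.1 * w.2 ^ (-1 / p), w.1.2 * w.2 ^ (-1 / q))) (by fun_prop)

lemma measurable_bellmanSlope (p q ξ η : ℝ) : Measurable (bellmanSlope p q ξ η) :=
  measurable_cutoffSlope.comp
    (g := fun z : ℝ × ℝ => cutoffSlope z.1 z.2)
    (f := fun l : ℝ => (ξ * l ^ (-1 / p), η * l ^ (-1 / q))) (by fun_prop)

lemma measurable_bellman (p q : ℝ) : Measurable fun z : ℝ × ℝ => bellman p q z.1 z.2 :=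
  (StronglyMeasurable.integral_prod_right'
    (measurable_bellmanLayer p q).stronglyMeasurable).measurable

lemma bellman_nonneg (p q ξ η : ℝ) : 0 ≤ bellman p q ξ η :=
  integral_nonneg fun _ => cutoffConvex_nonneg _ _

lemma small_of_large_scale {p q : ℝ} (hpq : p.HolderConjugate q)
    {ξ η l : ℝ} (hl : 0 < l) (h : |ξ| ^ p + |η| ^ q ≤ l) :
    |ξ * l ^ (-1 / p)| ≤ 1 ∧ |η * l ^ (-1 / q)| ≤ 1 := by
  have h1 : 0 ≤ |ξ| ^ p := by positivity
  have h2 : 0 ≤ |η| ^ q := by positivity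
  constructor
  · simpa using abs_mul_rpow_neg_le (m := 1) hpq.pos hl (by linarith) zero_le_one
  · simpa using abs_mul_rpow_neg_le (m := 1) hpq.symm.pos hl (by linarith) zero_le_one

lemma neg_one_div_gt {p q : ℝ} (hpq : p.HolderConjugate q) : -1 < -1 / p := by
  have := hpq.lt
  rw [neg_div, neg_lt_neg_iff, div_lt_one hpq.pos]; exact this

lemma integrable_scale_indicator {p q : ℝ} (hpq : p.HolderConjugate q) (A N : ℝ) :
    Integrable (indicator (Ioc 0 N) fun l : ℝ => A * l ^ (-1 / p)) := by
  rw [integrable_indicator_iff measurableSet_Ioc]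
  rcases le_or_gt N 0 with h | h
  · simp [Ioc_eq_empty_of_le h]
  · exact ((intervalIntegrable_iff_integrableOn_Ioc_of_le h.le).1
      (intervalIntegral.intervalIntegrable_rpow' (neg_one_div_gt hpq))).const_mul A

lemma integral_scale_indicator {p q : ℝ} (hpq : p.HolderConjugate q) {A N : ℝ} (hN : 0 ≤ N) :
    ∫ l : ℝ, indicator (Ioc 0 N) (fun l : ℝ => A * l ^ (-1 / p)) l = A * (q * N ^ (1 / q)) := by
  rw [integral_indicator measurableSet_Ioc, ← intervalIntegral.integral_of_le hN,
    intervalIntegral.integral_const_mul, integral_rpow (Or.inl (neg_one_div_gt hpq))]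
  have e : -1 / p + 1 = 1 / q := by
    have := hpq.inv_add_inv_eq_one
    field_simp at this ⊢; linarith
  have hq := hpq.symm.pos
  rw [e, Real.zero_rpow (by positivity)]
  field_simp; ring

lemma bellmanLayer_le {p q : ℝ} (hpq : p.HolderConjugate q) {ξ η l : ℝ} (hl : 0 < l) :
    bellmanLayer p q ξ η l ≤
      indicator (Ioc 0 (|ξ| ^ p + |η| ^ q)) (fun l : ℝ => |ξ| * l ^ (-1 / p)) l
      + indicator (Ioc 0 (|ξ| ^ p + |η| ^ q)) (fun l : ℝ => |η| * l ^ (-1 / q)) l := by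
  by_cases h : l ≤ |ξ| ^ p + |η| ^ q
  · have : l ∈ Ioc 0 (|ξ| ^ p + |η| ^ q) := ⟨hl, h⟩
    rw [indicator_of_mem this, indicator_of_mem this]
    refine (cutoffConvex_le _ _).trans_eq ?_
    rw [abs_mul, abs_mul, abs_of_pos (Real.rpow_pos_of_pos hl _),
      abs_of_pos (Real.rpow_pos_of_pos hl _)]
  · have : l ∉ Ioc 0 (|ξ| ^ p + |η| ^ q) := fun h' => h h'.2
    rw [indicator_of_notMem this, indicator_of_notMem this]
    obtain ⟨h1, h2⟩ := small_of_large_scale hpq (ξ := ξ) (η := η) hl (by linarith)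
    exact (cutoffConvex_eq_zero h1 h2).le.trans (by simp)

lemma integrableOn_bellmanLayer {p q : ℝ} (hpq : p.HolderConjugate q) (ξ η : ℝ) :
    IntegrableOn (bellmanLayer p q ξ η) (Ioi 0) := by
  refine Integrable.mono' (((integrable_scale_indicator hpq |ξ| (|ξ| ^ p + |η| ^ q)).add
    (integrable_scale_indicator hpq.symm |η| (|ξ| ^ p + |η| ^ q))).integrableOn) ?_ ?_
  · exact ((measurable_bellmanLayer p q).comp
      (measurable_const.prodMk measurable_id :
        Measurable fun l : ℝ => ((ξ, η), l))).aestronglyMeasurable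
  · filter_upwards [ae_restrict_mem measurableSet_Ioi] with l hl
    rw [Real.norm_of_nonneg (by exact cutoffConvex_nonneg _ _)]
    exact bellmanLayer_le hpq hl

lemma bellman_le {p q : ℝ} (hpq : p.HolderConjugate q) (ξ η : ℝ) :
    bellman p q ξ η ≤ (p + q) * (|ξ| ^ p + |η| ^ q) := by
  set N := |ξ| ^ p + |η| ^ q with hN
  have hN0 : 0 ≤ N := by positivity
  have hp := hpq.pos
  have hq := hpq.symm.pos
  have h1 : bellman p q ξ η ≤ ∫ l in Ioi (0 : ℝ),
      (indicator (Ioc 0 N) (fun l : ℝ => |ξ| * l ^ (-1 / p)) l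
      + indicator (Ioc 0 N) (fun l : ℝ => |η| * l ^ (-1 / q)) l) :=
    setIntegral_mono_on (integrableOn_bellmanLayer hpq ξ η)
      (((integrable_scale_indicator hpq _ _).add
        (integrable_scale_indicator hpq.symm _ _)).integrableOn) measurableSet_Ioi
      fun l hl => bellmanLayer_le hpq hl
  have h2 : ∫ l in Ioi (0 : ℝ),
      (indicator (Ioc 0 N) (fun l : ℝ => |ξ| * l ^ (-1 / p)) l
      + indicator (Ioc 0 N) (fun l : ℝ => |η| * l ^ (-1 / q)) l)
      = |ξ| * (q * N ^ (1 / q)) + |η| * (p * N ^ (1 / p)) := by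
    rw [← integral_scale_indicator hpq hN0, ← integral_scale_indicator hpq.symm hN0,
      ← integral_add (integrable_scale_indicator hpq _ _)
        (integrable_scale_indicator hpq.symm _ _)]
    refine setIntegral_eq_integral_of_forall_compl_eq_zero fun l hl => ?_
    have : l ∉ Ioc 0 N := fun h => hl h.1
    simp [indicator_of_notMem this]
  have e1 : |ξ| ≤ N ^ (1 / p) := by
    rw [one_div, Real.le_rpow_inv_iff_of_pos (abs_nonneg _) hN0 hp]
    have : 0 ≤ |η| ^ q := by positivity
    linarith
  have e2 : |η| ≤ N ^ (1 / q) := by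
    rw [one_div, Real.le_rpow_inv_iff_of_pos (abs_nonneg _) hN0 hq]
    have : 0 ≤ |ξ| ^ p := by positivity
    linarith
  have e3 : N ^ (1 / p) * N ^ (1 / q) = N := by
    rw [← Real.rpow_add_of_nonneg hN0 (by positivity) (by positivity), one_div, one_div,
      hpq.inv_add_inv_eq_one, Real.rpow_one]
  have e4 : |ξ| * (q * N ^ (1 / q)) ≤ q * N := by
    calc |ξ| * (q * N ^ (1 / q)) ≤ N ^ (1 / p) * (q * N ^ (1 / q)) := by gcongr
      _ = q * N := by rw [mul_left_comm, e3]
  have e5 : |η| * (p * N ^ (1 / p)) ≤ p * N := by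
    calc |η| * (p * N ^ (1 / p)) ≤ N ^ (1 / q) * (p * N ^ (1 / p)) := by gcongr
      _ = p * N := by rw [mul_left_comm, mul_comm (N ^ (1 / q)), e3]
  linarith

lemma integrableOn_bellmanSlope {p q : ℝ} (hpq : p.HolderConjugate q) (ξ η : ℝ) :
    IntegrableOn (fun l => ξ * l ^ (-1 / p) * bellmanSlope p q ξ η l * l ^ (-1 / p)) (Ioi 0) := by
  refine Integrable.mono' (integrable_scale_indicator hpq 1 (|ξ| ^ p + |η| ^ q)).integrableOn ?_ ?_
  · have := measurable_bellmanSlope p q ξ η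
    exact Measurable.aestronglyMeasurable (by fun_prop)
  · filter_upwards [ae_restrict_mem measurableSet_Ioi] with l hl
    by_cases h : l ≤ |ξ| ^ p + |η| ^ q
    · have : l ∈ Ioc 0 (|ξ| ^ p + |η| ^ q) := ⟨hl, h⟩
      rw [indicator_of_mem this, Real.norm_eq_abs, abs_mul,
        abs_of_pos (Real.rpow_pos_of_pos hl _)]
      have := Real.rpow_pos_of_pos hl (-1 / p)
      gcongr
      exact abs_mul_cutoffSlope_left_le _ _
    · obtain ⟨h1, h2⟩ := small_of_large_scale hpq (ξ := ξ) (η := η) hl (by linarith)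
      have : l ∉ Ioc 0 (|ξ| ^ p + |η| ^ q) := fun h' => h h'.2
      rw [indicator_of_notMem this]
      simp [bellmanSlope, cutoffSlope_eq_zero h1 h2]

lemma integrableOn_bellmanSlope' {p q : ℝ} (hpq : p.HolderConjugate q) (ξ η : ℝ) :
    IntegrableOn (fun l => η * l ^ (-1 / q) * bellmanSlope p q ξ η l * l ^ (-1 / q)) (Ioi 0) := by
  refine Integrable.mono'
    (integrable_scale_indicator hpq.symm 1 (|ξ| ^ p + |η| ^ q)).integrableOn ?_ ?_
  · have := measurable_bellmanSlope p q ξ η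
    exact Measurable.aestronglyMeasurable (by fun_prop)
  · filter_upwards [ae_restrict_mem measurableSet_Ioi] with l hl
    by_cases h : l ≤ |ξ| ^ p + |η| ^ q
    · have : l ∈ Ioc 0 (|ξ| ^ p + |η| ^ q) := ⟨hl, h⟩
      rw [indicator_of_mem this, Real.norm_eq_abs, abs_mul,
        abs_of_pos (Real.rpow_pos_of_pos hl _)]
      have := Real.rpow_pos_of_pos hl (-1 / q)
      gcongr
      exact abs_mul_cutoffSlope_right_le _ _
    · obtain ⟨h1, h2⟩ := small_of_large_scale hpq (ξ := ξ) (η := η) hl (by linarith)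
      have : l ∉ Ioc 0 (|ξ| ^ p + |η| ^ q) := fun h' => h h'.2
      rw [indicator_of_notMem this]
      simp [bellmanSlope, cutoffSlope_eq_zero h1 h2]

lemma rpow_neg_mul_rpow_neg {p q : ℝ} (hpq : p.HolderConjugate q) {l : ℝ} (hl : 0 < l) :
    l ^ (-1 / p) * l ^ (-1 / q) = l⁻¹ := by
  rw [← Real.rpow_add hl, ← Real.rpow_neg_one]
  congr 1
  have := hpq.inv_add_inv_eq_one
  rw [neg_div, neg_div, one_div, one_div]; linarith

/-- Quantified convexity of the Bellman function. -/
theorem exists_bellman_convexity {p q : ℝ} (hpq : p.HolderConjugate q) :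
    ∃ c > 0, ∀ ξ η : ℝ, ∃ L₁ L₂ : ℝ, ∀ ξ' η' : ℝ,
    bellman p q ξ η + (L₁ * (ξ' - ξ) + L₂ * (η' - η)) + c * (|ξ' - ξ| * |η' - η|)
      ≤ bellman p q ξ' η' := by
  have hp := hpq.pos
  have hq := hpq.symm.pos
  set T : ℝ := 4 ^ (p + q) with hT
  have hT1 : 1 ≤ T := Real.one_le_rpow (by norm_num) (by positivity)
  set K : ℝ := 2 * T with hK
  refine ⟨1 / (54 * K ^ 3), by positivity, fun ξ η =>
    ⟨∫ l in Ioi (0 : ℝ), ξ * l ^ (-1 / p) * bellmanSlope p q ξ η l * l ^ (-1 / p),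
     ∫ l in Ioi (0 : ℝ), η * l ^ (-1 / q) * bellmanSlope p q ξ η l * l ^ (-1 / q),
     fun ξ' η' => ?_⟩⟩
  set D : ℝ → ℝ := fun l => bellmanLayer p q ξ' η' l - bellmanLayer p q ξ η l
    - ((ξ * l ^ (-1 / p) * bellmanSlope p q ξ η l * l ^ (-1 / p)) * (ξ' - ξ)
      + (η * l ^ (-1 / q) * bellmanSlope p q ξ η l * l ^ (-1 / q)) * (η' - η)) with hD
  have I1 := integrableOn_bellmanLayer hpq ξ η
  have I2 := integrableOn_bellmanLayer hpq ξ' η'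
  have I3 := (integrableOn_bellmanSlope hpq ξ η).mul_const (ξ' - ξ)
  have I4 := (integrableOn_bellmanSlope' hpq ξ η).mul_const (η' - η)
  have ID : IntegrableOn D (Ioi 0) := (I2.sub I1).sub (I3.add I4)
  have hDint : ∫ l in Ioi (0 : ℝ), D l = bellman p q ξ' η' - bellman p q ξ η
      - ((∫ l in Ioi (0 : ℝ), ξ * l ^ (-1 / p) * bellmanSlope p q ξ η l * l ^ (-1 / p)) * (ξ' - ξ)
       + (∫ l in Ioi (0 : ℝ), η * l ^ (-1 / q) * bellmanSlope p q ξ η l * l ^ (-1 / q)) * (η' - η))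
      :=
    (integral_sub (I2.sub I1) (I3.add I4)).trans (congrArg₂ (· - ·) (integral_sub I2 I1)
      ((integral_add I3 I4).trans
        (congrArg₂ (· + ·) (integral_mul_const _ _) (integral_mul_const _ _))))
  have e0 : ∀ l, D l = cutoffConvex (ξ' * l ^ (-1 / p)) (η' * l ^ (-1 / q))
      - cutoffConvex (ξ * l ^ (-1 / p)) (η * l ^ (-1 / q))
      - (ξ * l ^ (-1 / p) * cutoffSlope (ξ * l ^ (-1 / p)) (η * l ^ (-1 / q))
          * (ξ' * l ^ (-1 / p) - ξ * l ^ (-1 / p))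
        + η * l ^ (-1 / q) * cutoffSlope (ξ * l ^ (-1 / p)) (η * l ^ (-1 / q))
          * (η' * l ^ (-1 / q) - η * l ^ (-1 / q))) := fun l => by
    simp only [hD, bellmanLayer, bellmanSlope]; ring
  have hD0 : ∀ l, 0 ≤ D l := fun l => by
    rw [e0]; exact cutoffConvex_subgradient _ _ _ _
  suffices h : 1 / (54 * K ^ 3) * (|ξ' - ξ| * |η' - η|) ≤ ∫ l in Ioi (0 : ℝ), D l by
    rw [hDint] at h; linarith
  set M : ℝ := max (max (|ξ| ^ p) (|η| ^ q)) (max (|ξ'| ^ p) (|η'| ^ q)) with hM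
  have m1 : |ξ| ^ p ≤ M := (le_max_left _ _).trans (le_max_left _ _)
  have m2 : |η| ^ q ≤ M := (le_max_right _ _).trans (le_max_left _ _)
  have m3 : |ξ'| ^ p ≤ M := (le_max_left _ _).trans (le_max_right _ _)
  have m4 : |η'| ^ q ≤ M := (le_max_right _ _).trans (le_max_right _ _)
  have hM0 : 0 ≤ M := le_trans (by positivity) m1
  rcases hM0.eq_or_lt with hM1 | hM1
  · have z : ∀ x r : ℝ, 0 < r → |x| ^ r ≤ M → x = 0 := fun x r hr h => by
      rw [← hM1] at h
      have := le_antisymm h (by positivity)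
      rw [Real.rpow_eq_zero (abs_nonneg x) hr.ne'] at this
      exact abs_eq_zero.1 this
    rw [z ξ p hp m1, z ξ' p hp m3]
    simpa using setIntegral_nonneg measurableSet_Ioi fun l _ => hD0 l
  · set l₁ := M / T with hl₁
    have hl₁0 : 0 < l₁ := by positivity
    have hlow : ∀ l ∈ Ioc (l₁ / 2) l₁,
        |ξ' - ξ| * |η' - η| / (27 * K ^ 3) / l₁ ≤ D l := by
      intro l hl
      have hl0 : 0 < l := by linarith [hl.1]
      have hup : M ≤ K * l := by
        have : M = T * l₁ := by rw [hl₁]; field_simp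
        rw [this, hK]; nlinarith [hl.1]
      have hlo : T * l ≤ M := by
        have : M = T * l₁ := by rw [hl₁]; field_simp
        rw [this]; nlinarith [hl.2]
      have hK1 : 1 ≤ K := by linarith
      have bd : ∀ x r : ℝ, 1 < r → |x| ^ r ≤ M → |x * l ^ (-1 / r)| ≤ K := fun x r hr h => by
        refine (abs_mul_rpow_neg_le (by linarith) hl0 (h.trans hup) (by linarith)).trans ?_
        calc K ^ (1 / r) ≤ K ^ (1 : ℝ) :=
              Real.rpow_le_rpow_of_exponent_le hK1 ((div_le_one (by linarith)).2 hr.le)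
          _ = K := Real.rpow_one _
      have lb : ∀ x r : ℝ, 0 < r → r ≤ p + q → M = |x| ^ r → 4 ≤ |x * l ^ (-1 / r)| :=
        fun x r hr hr' h => by
          refine le_trans ?_ (le_abs_mul_rpow_neg hr hl0 (hlo.trans h.le) (by linarith))
          rw [hT, ← Real.rpow_mul (by norm_num)]
          calc (4 : ℝ) = 4 ^ (1 : ℝ) := (Real.rpow_one _).symm
            _ ≤ _ := Real.rpow_le_rpow_of_exponent_le (by norm_num) (by
              rw [mul_one_div, le_div_iff₀ hr]; linarith)
      have key := cutoffConvex_bregman hK1 (bd ξ p hpq.lt m1) (bd η q hpq.symm.lt m2)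
        (bd ξ' p hpq.lt m3) (bd η' q hpq.symm.lt m4) (by
          rcases max_choice (max (|ξ| ^ p) (|η| ^ q)) (max (|ξ'| ^ p) (|η'| ^ q)) with h | h
          · rcases max_choice (|ξ| ^ p) (|η| ^ q) with h' | h'
            · exact Or.inl (lb _ _ hp (by linarith) (h.trans h'))
            · exact Or.inr (Or.inl (lb _ _ hq (by linarith) (h.trans h')))
          · rcases max_choice (|ξ'| ^ p) (|η'| ^ q) with h' | h'
            · exact Or.inr (Or.inr (Or.inl (lb _ _ hp (by linarith) (h.trans h'))))
            · exact Or.inr (Or.inr (Or.inr (lb _ _ hq (by linarith) (h.trans h')))))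
      rw [e0]
      refine le_trans ?_ key
      rw [← sub_mul, ← sub_mul, abs_mul, abs_mul, abs_of_pos (Real.rpow_pos_of_pos hl0 _),
        abs_of_pos (Real.rpow_pos_of_pos hl0 _), mul_mul_mul_comm, rpow_neg_mul_rpow_neg hpq hl0,
        div_right_comm, ← div_eq_mul_inv]
      gcongr
      exact hl.2
    calc 1 / (54 * K ^ 3) * (|ξ' - ξ| * |η' - η|)
        = ∫ l in Ioc (l₁ / 2) l₁, |ξ' - ξ| * |η' - η| / (27 * K ^ 3) / l₁ := by
          rw [setIntegral_const, Measure.real, Real.volume_Ioc,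
            ENNReal.toReal_ofReal (by linarith), smul_eq_mul]
          field_simp
          ring
      _ ≤ ∫ l in Ioc (l₁ / 2) l₁, D l :=
          setIntegral_mono_on (by simp) (ID.mono_set fun l hl => by
            have := hl.1; simp only [mem_Ioi]; linarith) measurableSet_Ioc hlow
      _ ≤ ∫ l in Ioi (0 : ℝ), D l :=
          setIntegral_mono_set ID (Filter.Eventually.of_forall hD0)
            (Filter.Eventually.of_forall fun l hl => by
              have := hl.1
              change (0 : ℝ) < l
              linarith)

/-! ### Averaging decreases the Bellman energy -/

/-- Convolution of real functions on `ℝ³`. -/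
def cv (k f : E3 → ℝ) (x : E3) : ℝ := ∫ y, k y * f (x - y)

lemma integrable_mul_comp_sub {k f : E3 → ℝ} {M : ℝ} (hk : Measurable k) (hkM : ∀ y, |k y| ≤ M)
    (hf : Integrable f) (x : E3) : Integrable fun y => k y * f (x - y) :=
  (hf.comp_sub_left x).bdd_mul hk.aestronglyMeasurable (Filter.Eventually.of_forall hkM)

lemma measurable_cv {k f : E3 → ℝ} (hk : Measurable k) (hf : Measurable f) :
    Measurable (cv k f) := by
  have : StronglyMeasurable fun z : E3 × E3 => k z.2 * f (z.1 - z.2) :=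
    Measurable.stronglyMeasurable (by fun_prop)
  exact this.integral_prod_right'.measurable

/-- The energy dissipated when `u` and `w` are averaged with the kernel `k`. -/
def dissipation (k u w : E3 → ℝ) : ℝ≥0∞ :=
  ∫⁻ x, ∫⁻ y, ENNReal.ofReal (k y * (|u (x - y) - cv k u x| * |w (x - y) - cv k w x|))

lemma bellman_average_pointwise {p q c : ℝ} (hc0 : 0 ≤ c)
    (hc : ∀ ξ η : ℝ, ∃ L₁ L₂ : ℝ, ∀ ξ' η' : ℝ,
      bellman p q ξ η + (L₁ * (ξ' - ξ) + L₂ * (η' - η)) + c * (|ξ' - ξ| * |η' - η|)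
        ≤ bellman p q ξ' η')
    {k u w : E3 → ℝ} {M : ℝ} (hk : Measurable k) (hk0 : ∀ y, 0 ≤ k y) (hkM : ∀ y, |k y| ≤ M)
    (hki : Integrable k) (hk1 : ∫ y, k y = 1) (hu : Measurable u) (hui : Integrable u)
    (hw : Measurable w) (hwi : Integrable w) (x : E3) :
    ENNReal.ofReal (bellman p q (cv k u x) (cv k w x)) + ∫⁻ y, ENNReal.ofReal c * ENNReal.ofReal
        (k y * (|u (x - y) - cv k u x| * |w (x - y) - cv k w x|))
      ≤ ∫⁻ y, ENNReal.ofReal (k y * bellman p q (u (x - y)) (w (x - y))) := by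
  set U := cv k u x with hU
  set W := cv k w x with hW
  set f : E3 → ℝ := fun y => k y * bellman p q (u (x - y)) (w (x - y)) with hf
  have hfm : Measurable f := hk.mul ((measurable_bellman p q).comp
    (by fun_prop : Measurable fun y => (u (x - y), w (x - y))))
  have hf0 : ∀ y, 0 ≤ f y := fun y => mul_nonneg (hk0 y) (bellman_nonneg _ _ _ _)
  by_cases hfin : ∫⁻ y, ENNReal.ofReal (f y) = ∞
  · rw [hfin]; exact le_top
  have hfi : Integrable f := ⟨hfm.aestronglyMeasurable, by
    rw [hasFiniteIntegral_iff_ofReal (Filter.Eventually.of_forall hf0)]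
    exact lt_top_iff_ne_top.2 hfin⟩
  obtain ⟨L₁, L₂, hL⟩ := hc U W
  have hi1 := integrable_mul_comp_sub hk hkM hui x
  have hi2 := integrable_mul_comp_sub hk hkM hwi x
  set B₀ := bellman p q U W
  set g : E3 → ℝ := fun y => (B₀ - L₁ * U - L₂ * W) * k y
    + (L₁ * (k y * u (x - y)) + L₂ * (k y * w (x - y))) with hg
  have hgi : Integrable g := (hki.const_mul _).add ((hi1.const_mul _).add (hi2.const_mul _))
  have hgint : ∫ y, g y = B₀ := by
    refine (integral_add (hki.const_mul _) ((hi1.const_mul _).add (hi2.const_mul _))).trans ?_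
    rw [integral_const_mul, hk1]
    have := integral_add (hi1.const_mul L₁) (hi2.const_mul L₂)
    rw [integral_const_mul, integral_const_mul] at this
    change (B₀ - L₁ * U - L₂ * W) * 1 + ∫ a, L₁ * (k a * u (x - a)) + L₂ * (k a * w (x - a)) = B₀
    rw [this]
    change (B₀ - L₁ * U - L₂ * W) * 1 + (L₁ * U + L₂ * W) = B₀
    ring
  set e : E3 → ℝ := fun y => c * (k y * (|u (x - y) - U| * |w (x - y) - W|)) with he
  have hem : Measurable e := by
    have : Measurable fun y => |u (x - y) - U| :=
      (by fun_prop : Measurable fun y => u (x - y) - U).abs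
    have : Measurable fun y => |w (x - y) - W| :=
      (by fun_prop : Measurable fun y => w (x - y) - W).abs
    fun_prop
  have he0 : ∀ y, 0 ≤ e y := fun y => mul_nonneg hc0 (mul_nonneg (hk0 y) (by positivity))
  have hle : ∀ y, e y ≤ f y - g y := fun y => by
    have := mul_le_mul_of_nonneg_left (hL (u (x - y)) (w (x - y))) (hk0 y)
    simp only [he, hf, hg]
    linarith
  have hei : Integrable e := (hfi.sub hgi).mono' hem.aestronglyMeasurable
    (Filter.Eventually.of_forall fun y => by
      rw [Real.norm_of_nonneg (he0 y)]; exact hle y)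
  have h_int : ∫ y, e y ≤ (∫ y, f y) - B₀ := by
    rw [← hgint, ← integral_sub hfi hgi]
    exact integral_mono hei (hfi.sub hgi) hle
  have hB0 : 0 ≤ B₀ := bellman_nonneg _ _ _ _
  have e1 : ∫⁻ y, ENNReal.ofReal c * ENNReal.ofReal
      (k y * (|u (x - y) - U| * |w (x - y) - W|)) = ENNReal.ofReal (∫ y, e y) := by
    rw [ofReal_integral_eq_lintegral_ofReal hei (Filter.Eventually.of_forall he0)]
    simp_rw [he, ENNReal.ofReal_mul hc0]
  rw [e1, ← ENNReal.ofReal_add hB0 (integral_nonneg he0),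
    ← ofReal_integral_eq_lintegral_ofReal hfi (Filter.Eventually.of_forall hf0)]
  exact ENNReal.ofReal_le_ofReal (by linarith)

/-- Averaging with a probability kernel decreases the Bellman energy, with a gain. -/
lemma bellman_average {p q c : ℝ} (hc0 : 0 ≤ c)
    (hc : ∀ ξ η : ℝ, ∃ L₁ L₂ : ℝ, ∀ ξ' η' : ℝ,
      bellman p q ξ η + (L₁ * (ξ' - ξ) + L₂ * (η' - η)) + c * (|ξ' - ξ| * |η' - η|)
        ≤ bellman p q ξ' η')
    {k u w : E3 → ℝ} {M : ℝ} (hk : Measurable k) (hk0 : ∀ y, 0 ≤ k y) (hkM : ∀ y, |k y| ≤ M)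
    (hki : Integrable k) (hk1 : ∫ y, k y = 1) (hu : Measurable u) (hui : Integrable u)
    (hw : Measurable w) (hwi : Integrable w) :
    (∫⁻ x, ENNReal.ofReal (bellman p q (cv k u x) (cv k w x)))
        + ENNReal.ofReal c * dissipation k u w
      ≤ ∫⁻ x, ENNReal.ofReal (bellman p q (u x) (w x)) := by
  have hBm := measurable_bellman p q
  have hm1 : Measurable fun x => ENNReal.ofReal (bellman p q (cv k u x) (cv k w x)) :=
    (hBm.comp ((measurable_cv hk hu).prodMk (measurable_cv hk hw))).ennreal_ofReal
  have hm2 : Measurable fun x => ENNReal.ofReal (bellman p q (u x) (w x)) :=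
    (hBm.comp (hu.prodMk hw)).ennreal_ofReal
  rw [dissipation, ← lintegral_const_mul' _ _ ENNReal.ofReal_ne_top]
  simp_rw [← lintegral_const_mul' _ _ ENNReal.ofReal_ne_top]
  rw [← lintegral_add_left hm1]
  calc _ ≤ ∫⁻ x, ∫⁻ y, ENNReal.ofReal (k y * bellman p q (u (x - y)) (w (x - y))) :=
        lintegral_mono fun x =>
          bellman_average_pointwise hc0 hc hk hk0 hkM hki hk1 hu hui hw hwi x
    _ = ∫⁻ y, ∫⁻ x, ENNReal.ofReal (k y * bellman p q (u (x - y)) (w (x - y))) := by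
        refine lintegral_lintegral_swap (Measurable.aemeasurable ?_)
        refine Measurable.ennreal_ofReal ((hk.comp measurable_snd).mul (hBm.comp
          (by fun_prop : Measurable fun z : E3 × E3 => (u (z.1 - z.2), w (z.1 - z.2)))))
    _ = ∫⁻ y, ENNReal.ofReal (k y) * ∫⁻ x, ENNReal.ofReal (bellman p q (u x) (w x)) := by
        refine lintegral_congr fun y => ?_
        simp_rw [ENNReal.ofReal_mul (hk0 y)]
        rw [lintegral_const_mul' _ _ ENNReal.ofReal_ne_top,
          lintegral_sub_right_eq_self (fun x => ENNReal.ofReal (bellman p q (u x) (w x))) y]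
    _ = _ := by
        rw [lintegral_mul_const'' _ hk.ennreal_ofReal.aemeasurable,
          ← ofReal_integral_eq_lintegral_ofReal hki (Filter.Eventually.of_forall hk0), hk1]
        simp

/-! ### Convolution identities -/

lemma abs_cv_le {k f : E3 → ℝ} {M : ℝ} (hkM : ∀ y, |k y| ≤ M) (hf : Integrable f) (x : E3) :
    |cv k f x| ≤ M * ∫ y, |f y| := by
  have h1 : ∀ y, ‖k y * f (x - y)‖ ≤ M * |f (x - y)| := fun y => by
    rw [norm_mul]
    exact mul_le_mul_of_nonneg_right (hkM y) (abs_nonneg _)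
  have h2 := norm_integral_le_of_norm_le ((hf.abs.comp_sub_left x).const_mul M)
    (Filter.Eventually.of_forall h1)
  rw [integral_const_mul, integral_sub_left_eq_self (fun y => |f y|)] at h2
  exact h2

lemma integrable_cv {k f : E3 → ℝ} (hk : Integrable k) (hf : Integrable f) :
    Integrable (cv k f) :=
  hk.integrable_convolution (ContinuousLinearMap.lsmul ℝ ℝ) hf

lemma integral_cv {k f : E3 → ℝ} (hk : Integrable k) (hf : Integrable f) :
    ∫ x, cv k f x = (∫ x, k x) * ∫ x, f x :=
  integral_convolution (ContinuousLinearMap.lsmul ℝ ℝ) hk hf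

lemma cv_cv {k₁ k₂ f : E3 → ℝ} {M : ℝ} (hk₁ : Integrable k₁) (hk₁m : Measurable k₁)
    (hk₂ : Measurable k₂) (hkM : ∀ y, |k₂ y| ≤ M) (hf : Integrable f) (hfm : Measurable f)
    (x : E3) :
    cv k₁ (cv k₂ f) x = cv (cv k₁ k₂) f x := by
  have e1 : ∀ y, cv k₂ f (x - y) = ∫ z, k₂ (z - y) * f (x - z) := fun y => by
    rw [cv, ← integral_sub_right_eq_self (fun z => k₂ z * f (x - y - z)) y]
    refine integral_congr_ae (Filter.Eventually.of_forall fun z => ?_)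
    simp
  have h_int : Integrable (fun z : E3 × E3 => k₁ z.1 * (k₂ (z.2 - z.1) * f (x - z.2))) := by
    have hb := (hk₁.mul_prod (hf.comp_sub_left x)).const_mul M
    refine Integrable.mono hb (Measurable.aestronglyMeasurable (by fun_prop))
      (Filter.Eventually.of_forall fun z => ?_)
    rw [norm_mul, norm_mul, norm_mul, norm_mul, mul_left_comm]
    refine mul_le_mul_of_nonneg_right ((hkM _).trans (le_abs_self M)) (by positivity)
  calc cv k₁ (cv k₂ f) x = ∫ y, ∫ z, k₁ y * (k₂ (z - y) * f (x - z)) := by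
        simp_rw [integral_const_mul, ← e1]; rfl
    _ = ∫ z, ∫ y, k₁ y * (k₂ (z - y) * f (x - z)) := integral_integral_swap h_int
    _ = _ := by
        simp_rw [← mul_assoc, integral_mul_const]; rfl

lemma integral_mul_cv_comm {k f g : E3 → ℝ} {M : ℝ} (hk : Measurable k) (hkM : ∀ y, |k y| ≤ M)
    (hke : ∀ y, k (-y) = k y) (hf : Integrable f) (hg : Integrable g)
    (hfm : Measurable f) (hgm : Measurable g) :
    ∫ x, f x * cv k g x = ∫ x, g x * cv k f x := by
  have e1 : ∀ (g : E3 → ℝ) x, cv k g x = ∫ y, k (x - y) * g y := fun g x => by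
    rw [cv, ← integral_sub_left_eq_self (fun z => k z * g (x - z)) volume x]
    refine integral_congr_ae (Filter.Eventually.of_forall fun z => ?_)
    simp
  have h_int : Integrable (fun z : E3 × E3 => f z.1 * (k (z.1 - z.2) * g z.2)) := by
    have hb := (hf.mul_prod hg).const_mul M
    refine Integrable.mono hb (Measurable.aestronglyMeasurable (by fun_prop))
      (Filter.Eventually.of_forall fun z => ?_)
    rw [norm_mul, norm_mul, norm_mul, norm_mul, mul_left_comm]
    refine mul_le_mul_of_nonneg_right ((hkM _).trans (le_abs_self M)) (by positivity)
  calc ∫ x, f x * cv k g x = ∫ x, ∫ y, f x * (k (x - y) * g y) := by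
        simp_rw [integral_const_mul, ← e1]
    _ = ∫ y, ∫ x, f x * (k (x - y) * g y) := integral_integral_swap h_int
    _ = _ := by
        refine integral_congr_ae (Filter.Eventually.of_forall fun y => ?_)
        simp only
        rw [e1, ← integral_const_mul]
        refine integral_congr_ae (Filter.Eventually.of_forall fun x => ?_)
        simp only
        rw [← hke (x - y), neg_sub]; ring

/-- A bound for the pairing of increments against an even mean-zero kernel dominated by `k`. -/
lemma pairing_le_dissipation {k κ u w : E3 → ℝ} {A M Mu : ℝ} (hA : 0 ≤ A) (hk : Measurable k)
    (hkM : ∀ y, |k y| ≤ M)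
    (hκ : Measurable κ) (hκi : Integrable κ) (hκM : ∀ y, |κ y| ≤ M) (hκ0 : ∫ y, κ y = 0)
    (hκk : ∀ y, |κ y| ≤ A * k y)
    (hu : Integrable u) (hw : Integrable w) (hum : Measurable u) (hwm : Measurable w)
    (huM : ∀ x, |u x| ≤ Mu) :
    ENNReal.ofReal |(∫ x, cv k w x * cv κ u x) + ∫ x, cv k u x * cv κ w x|
      ≤ ENNReal.ofReal A * dissipation k u w := by
  have huw : Integrable fun x => u x * w x :=
    hw.bdd_mul hum.aestronglyMeasurable (Filter.Eventually.of_forall huM)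
  have hU := measurable_cv hk hum
  have hW := measurable_cv hk hwm
  have inner : ∀ x, ∫ y, κ y * ((u (x - y) - cv k u x) * (w (x - y) - cv k w x))
      = cv κ (fun x => u x * w x) x - (cv k w x * cv κ u x + cv k u x * cv κ w x) := fun x => by
    set U := cv k u x
    set W := cv k w x
    have i1 := integrable_mul_comp_sub hκ hκM huw x
    have i2 := (integrable_mul_comp_sub hκ hκM hu x).const_mul W
    have i3 := (integrable_mul_comp_sub hκ hκM hw x).const_mul U
    have i4 := hκi.const_mul (U * W)
    have e : ∀ y, κ y * ((u (x - y) - U) * (w (x - y) - W))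
        = (κ y * (u (x - y) * w (x - y)) + (U * W) * κ y)
          - (W * (κ y * u (x - y)) + U * (κ y * w (x - y))) := fun y => by ring
    simp_rw [e]
    refine (integral_sub (i1.add i4) (i2.add i3)).trans ?_
    rw [integral_add' i1 i4, integral_add' i2 i3, integral_const_mul, integral_const_mul,
      integral_const_mul, hκ0, mul_zero, add_zero]
    rfl
  have j1 := integrable_cv hκi huw
  have j2 : Integrable fun x => cv k w x * cv κ u x :=
    (integrable_cv hκi hu).bdd_mul hW.aestronglyMeasurable
      (Filter.Eventually.of_forall fun x => abs_cv_le hkM hw x)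
  have j3 : Integrable fun x => cv k u x * cv κ w x :=
    (integrable_cv hκi hw).bdd_mul hU.aestronglyMeasurable
      (Filter.Eventually.of_forall fun x => abs_cv_le hkM hu x)
  have outer : ∫ x, ∫ y, κ y * ((u (x - y) - cv k u x) * (w (x - y) - cv k w x))
      = -((∫ x, cv k w x * cv κ u x) + ∫ x, cv k u x * cv κ w x) := by
    simp_rw [inner]
    refine (integral_sub j1 (j2.add j3)).trans ?_
    rw [integral_add' j2 j3, integral_cv hκi huw, hκ0]
    ring
  rw [← abs_neg, ← outer, ← Real.norm_eq_abs, ofReal_norm, dissipation,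
    ← lintegral_const_mul' _ _ ENNReal.ofReal_ne_top]
  refine (enorm_integral_le_lintegral_enorm _).trans (lintegral_mono fun x => ?_)
  rw [← lintegral_const_mul' _ _ ENNReal.ofReal_ne_top]
  refine (enorm_integral_le_lintegral_enorm _).trans (lintegral_mono fun y => ?_)
  rw [← ofReal_norm, ← ENNReal.ofReal_mul hA]
  refine ENNReal.ofReal_le_ofReal ?_
  rw [Real.norm_eq_abs, abs_mul, abs_mul, ← mul_assoc A]
  exact mul_le_mul_of_nonneg_right (hκk y) (by positivity)

/-! ### The heat kernel and its second derivatives -/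

/-- The heat kernel on `ℝ³`. -/
def heat (s : ℝ) (x : E3) : ℝ :=
  (4 * Real.pi * s) ^ (-(3 / 2) : ℝ) * Real.exp (-(‖x‖ ^ 2 / (4 * s)))

/-- The Kronecker symbol. -/
def kron (i j : Fin 3) : ℝ := if i = j then 1 else 0

/-- The second derivatives of the heat kernel. -/
def heat₂ (i j : Fin 3) (s : ℝ) (x : E3) : ℝ :=
  (x i * x j / (4 * s ^ 2) - kron i j / (2 * s)) * heat s x

lemma measurable_coord (i : Fin 3) : Measurable fun x : E3 => x i := by fun_prop

lemma measurable_heat_uncurry : Measurable fun z : ℝ × E3 => heat z.1 z.2 := by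
  unfold heat; fun_prop

lemma measurable_heat₂_uncurry (i j : Fin 3) : Measurable fun z : ℝ × E3 => heat₂ i j z.1 z.2 := by
  unfold heat₂
  have := measurable_heat_uncurry
  have h1 : Measurable fun z : ℝ × E3 => z.2 i := (measurable_coord i).comp measurable_snd
  have h2 : Measurable fun z : ℝ × E3 => z.2 j := (measurable_coord j).comp measurable_snd
  fun_prop

lemma measurable_heat (s : ℝ) : Measurable (heat s) :=
  measurable_heat_uncurry.comp (measurable_const.prodMk measurable_id)

lemma measurable_heat₂ (i j : Fin 3) (s : ℝ) : Measurable (heat₂ i j s) :=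
  (measurable_heat₂_uncurry i j).comp (measurable_const.prodMk measurable_id)

lemma heat_neg (s : ℝ) (x : E3) : heat s (-x) = heat s x := by simp [heat]

lemma heat₂_neg (i j : Fin 3) (s : ℝ) (x : E3) : heat₂ i j s (-x) = heat₂ i j s x := by
  simp [heat₂, heat_neg]

lemma heat_pos {s : ℝ} (hs : 0 < s) (x : E3) : 0 < heat s x := by
  unfold heat; positivity

lemma heat_le {s : ℝ} (hs : 0 < s) (x : E3) : heat s x ≤ (4 * Real.pi * s) ^ (-(3 / 2) : ℝ) := by
  unfold heat
  refine mul_le_of_le_one_right (by positivity) (Real.exp_le_one_iff.2 ?_)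
  have : 0 ≤ ‖x‖ ^ 2 / (4 * s) := by positivity
  linarith

lemma integral_heat {s : ℝ} (hs : 0 < s) : ∫ x, heat s x = 1 := by
  unfold heat
  have h := GaussianFourier.integral_rexp_neg_mul_sq_norm (V := E3) (b := (4 * s)⁻¹) (by positivity)
  have e : ∀ x : E3, -(‖x‖ ^ 2 / (4 * s)) = -(4 * s)⁻¹ * ‖x‖ ^ 2 := fun x => by
    field_simp
  simp_rw [e]
  rw [integral_const_mul, h]
  have : Real.pi / (4 * s)⁻¹ = 4 * Real.pi * s := by field_simp
  rw [this, finrank_euclideanSpace, Fintype.card_fin, ← Real.rpow_add (by positivity)]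
  norm_num

lemma integrable_heat {s : ℝ} (hs : 0 < s) : Integrable (heat s) := by
  by_contra h
  have := integral_undef h
  rw [integral_heat hs] at this
  exact one_ne_zero this

lemma heat_half_le {s : ℝ} (hs : 0 < s) (x : E3) :
    heat (s / 2) x * (1 + ‖x‖ ^ 2 / (4 * s)) ≤ 3 * heat s x := by
  unfold heat
  set r := ‖x‖ ^ 2 / (4 * s)
  have e1 : ‖x‖ ^ 2 / (4 * (s / 2)) = r + r := by simp only [r]; field_simp; ring
  have e2 : (4 * Real.pi * (s / 2)) ^ (-(3 / 2) : ℝ)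
      = (4 * Real.pi * s) ^ (-(3 / 2) : ℝ) * 2 ^ (3 / 2 : ℝ) := by
    rw [mul_div_assoc', Real.div_rpow (by positivity) (by norm_num), div_eq_mul_inv,
      ← Real.rpow_neg (by norm_num), neg_neg]
  have e3 : (2 : ℝ) ^ (3 / 2 : ℝ) ≤ 3 := by
    have h1 : ((2 : ℝ) ^ (3 / 2 : ℝ)) ^ 2 = 8 := by
      rw [← Real.rpow_natCast, ← Real.rpow_mul (by norm_num)]; norm_num
    nlinarith [Real.rpow_nonneg (show (0 : ℝ) ≤ 2 by norm_num) (3 / 2)]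
  have e4 : Real.exp (-r) * (1 + r) ≤ 1 := by
    have := Real.add_one_le_exp r
    calc Real.exp (-r) * (1 + r) ≤ Real.exp (-r) * Real.exp r := by
          refine mul_le_mul_of_nonneg_left (by linarith) (Real.exp_pos _).le
      _ = 1 := by rw [← Real.exp_add]; simp
  rw [e1, e2, neg_add, Real.exp_add]
  have hA : 0 ≤ (4 * Real.pi * s) ^ (-(3 / 2) : ℝ) := by positivity
  calc _ = (4 * Real.pi * s) ^ (-(3 / 2) : ℝ) * Real.exp (-r) *
        ((2 : ℝ) ^ (3 / 2 : ℝ) * (Real.exp (-r) * (1 + r))) := by ring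
    _ ≤ (4 * Real.pi * s) ^ (-(3 / 2) : ℝ) * Real.exp (-r) * (3 * 1) := by
        gcongr
    _ = _ := by ring

lemma abs_coord_le (x : E3) (i : Fin 3) : |x i| ≤ ‖x‖ := by
  simpa using EuclideanSpace.norm_eq x ▸ PiLp.norm_apply_le x i

lemma abs_coord_mul_le (x : E3) (i j : Fin 3) : |x i * x j| ≤ ‖x‖ ^ 2 := by
  rw [abs_mul, sq]
  exact mul_le_mul (abs_coord_le x i) (abs_coord_le x j) (abs_nonneg _) (norm_nonneg _)

lemma abs_kron_le (i j : Fin 3) : |kron i j| ≤ 1 := by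
  unfold kron; split_ifs <;> simp

lemma abs_coord_mul_heat_le {s : ℝ} (hs : 0 < s) (i j : Fin 3) (x : E3) :
    |x i * x j * heat (s / 2) x| ≤ 12 * s * heat s x := by
  have h := heat_half_le hs x
  have h0 := (heat_pos (half_pos hs) x)
  rw [abs_mul, abs_of_pos h0]
  calc |x i * x j| * heat (s / 2) x ≤ ‖x‖ ^ 2 * heat (s / 2) x := by
        gcongr; exact abs_coord_mul_le x i j
    _ = 4 * s * (heat (s / 2) x * (‖x‖ ^ 2 / (4 * s))) := by field_simp
    _ ≤ 4 * s * (3 * heat s x) := by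
        refine mul_le_mul_of_nonneg_left ?_ (by positivity)
        linarith
    _ = _ := by ring

lemma mul_abs_heat₂_half_le {s : ℝ} (hs : 0 < s) (i j : Fin 3) (x : E3) :
    |s * heat₂ i j (s / 2) x| ≤ 15 * heat s x := by
  have h1 := abs_coord_mul_heat_le hs i j x
  have h2 := heat_half_le hs x
  have h0 := heat_pos (half_pos hs) x
  have hk := abs_kron_le i j
  have e : s * heat₂ i j (s / 2) x
      = s⁻¹ * (x i * x j * heat (s / 2) x) - kron i j * heat (s / 2) x := by
    unfold heat₂; field_simp; ring
  rw [e]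
  have h3 : 0 ≤ heat (s / 2) x * (‖x‖ ^ 2 / (4 * s)) := by positivity
  calc |s⁻¹ * (x i * x j * heat (s / 2) x) - kron i j * heat (s / 2) x|
      ≤ |s⁻¹ * (x i * x j * heat (s / 2) x)| + |kron i j * heat (s / 2) x| := abs_sub _ _
    _ ≤ s⁻¹ * (12 * s * heat s x) + 1 * heat (s / 2) x := by
        rw [abs_mul s⁻¹, abs_mul (kron i j), abs_of_pos h0, abs_of_pos (inv_pos.2 hs)]
        gcongr
    _ ≤ _ := by
        have : s⁻¹ * (12 * s * heat s x) = 12 * heat s x := by field_simp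
        rw [this]; linarith

lemma abs_heat₂_le {s : ℝ} (hs : 0 < s) (i j : Fin 3) (x : E3) :
    |heat₂ i j s x| ≤ 15 / (2 * s) * (4 * Real.pi * (2 * s)) ^ (-(3 / 2) : ℝ) := by
  have h := mul_abs_heat₂_half_le (show 0 < 2 * s by positivity) i j x
  rw [mul_div_cancel_left₀ _ two_ne_zero, abs_mul, abs_of_pos (show 0 < 2 * s by positivity)] at h
  have h2 := heat_le (show 0 < 2 * s by positivity) x
  rw [div_mul_eq_mul_div, le_div_iff₀ (by positivity), mul_comm]
  linarith

lemma integrable_heat₂ {s : ℝ} (hs : 0 < s) (i j : Fin 3) : Integrable (heat₂ i j s) := by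
  have hs2 : 0 < 2 * s := by positivity
  refine ((integrable_heat hs2).const_mul (15 / (2 * s))).mono'
    (measurable_heat₂ i j s).aestronglyMeasurable (Filter.Eventually.of_forall fun x => ?_)
  have h := mul_abs_heat₂_half_le hs2 i j x
  rw [mul_div_cancel_left₀ _ two_ne_zero, abs_mul, abs_of_pos hs2] at h
  rw [Real.norm_eq_abs, div_mul_eq_mul_div, le_div_iff₀ (by positivity), mul_comm]
  exact h

lemma integrable_coord_mul_heat {s : ℝ} (hs : 0 < s) (i j : Fin 3) :
    Integrable fun x : E3 => x i * x j * heat s x := by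
  have hs2 : 0 < 2 * s := by positivity
  refine ((integrable_heat hs2).const_mul (12 * (2 * s))).mono'
    (((measurable_coord i).mul (measurable_coord j)).mul (measurable_heat s)).aestronglyMeasurable
    (Filter.Eventually.of_forall fun x => ?_)
  have h := abs_coord_mul_heat_le hs2 i j x
  rwa [mul_div_cancel_left₀ _ two_ne_zero] at h

lemma integral_coord_mul_heat_eq_zero {s : ℝ} (i : Fin 3) :
    ∫ x : E3, x i * heat s x = 0 := by
  have h := integral_neg_eq_self (fun x : E3 => x i * heat s x) volume
  have e : ∀ x : E3, (-x) i * heat s (-x) = -(x i * heat s x) := fun x => by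
    rw [heat_neg]; simp
  simp_rw [e, integral_neg] at h
  linarith

lemma integrable_coord_heat {s : ℝ} (hs : 0 < s) (i : Fin 3) :
    Integrable fun x : E3 => x i * heat s x := by
  refine ((integrable_heat hs).add (integrable_coord_mul_heat hs i i)).mono'
    ((measurable_coord i).mul (measurable_heat s)).aestronglyMeasurable
    (Filter.Eventually.of_forall fun x => ?_)
  have h := heat_pos hs x
  rw [Real.norm_eq_abs, abs_mul, abs_of_pos h, Pi.add_apply]
  have : |x i| ≤ 1 + x i * x i := by
    cases abs_cases (x i) <;> nlinarith [sq_nonneg (x i - 1), sq_nonneg (x i + 1)]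
  nlinarith

lemma hasFDerivAt_coord (j : Fin 3) (x : E3) :
    HasFDerivAt (fun x : E3 => x j) (EuclideanSpace.proj j : E3 →L[ℝ] ℝ) x :=
  (EuclideanSpace.proj j : E3 →L[ℝ] ℝ).hasFDerivAt

lemma inner_e3 (x : E3) (i : Fin 3) : inner ℝ x (e3 i) = x i := by
  simp [e3, EuclideanSpace.inner_single_right]

lemma e3_apply (i j : Fin 3) : (e3 i) j = kron i j := by
  simp only [e3, kron, EuclideanSpace.single, PiLp.single_apply, eq_comm]

lemma hasFDerivAt_heat (s : ℝ) (x : E3) :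
    HasFDerivAt (heat s) ((-(heat s x / (2 * s))) • innerSL ℝ x) x := by
  have h1 := (hasStrictFDerivAt_norm_sq x).hasFDerivAt
  have h2 := (((h1.mul_const (4 * s)⁻¹).neg).exp).const_mul ((4 * Real.pi * s) ^ (-(3 / 2) : ℝ))
  refine h2.congr_fderiv ?_
  ext v
  simp [heat, div_eq_mul_inv]
  ring

lemma integral_coord_mul_coord_mul_heat {s : ℝ} (hs : 0 < s) (i j : Fin 3) :
    ∫ x : E3, x i * x j * heat s x = 2 * s * kron i j := by
  have hg : ∀ x : E3, fderiv ℝ (heat s) x (e3 i) = -(heat s x / (2 * s)) * x i := fun x => by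
    rw [(hasFDerivAt_heat s x).fderiv]
    simp [inner_e3]
  have hf : ∀ x : E3, fderiv ℝ (fun x : E3 => x j) x (e3 i) = kron i j := fun x => by
    rw [(hasFDerivAt_coord j x).fderiv]
    simp [e3_apply]
  have i1 : Integrable fun x : E3 => fderiv ℝ (fun x : E3 => x j) x (e3 i) * heat s x := by
    simp_rw [hf]; exact (integrable_heat hs).const_mul _
  have hh : ∀ x : E3, x j * fderiv ℝ (heat s) x (e3 i) = (-(2 * s)⁻¹) * (x i * x j * heat s x) :=
    fun x => by rw [hg]; field_simp
  have i2 : Integrable fun x : E3 => x j * fderiv ℝ (heat s) x (e3 i) := by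
    simp_rw [hh]; exact (integrable_coord_mul_heat hs i j).const_mul _
  have key := integral_mul_fderiv_eq_neg_fderiv_mul_of_integrable i1 i2 (integrable_coord_heat hs j)
    (fun x _ => (hasFDerivAt_coord j x).differentiableAt)
    (fun x _ => (hasFDerivAt_heat s x).differentiableAt)
  simp_rw [hh, hf, integral_const_mul, integral_heat hs] at key
  field_simp at key
  linarith

lemma integral_heat₂ {s : ℝ} (hs : 0 < s) (i j : Fin 3) : ∫ x, heat₂ i j s x = 0 := by
  have e : ∀ x, heat₂ i j s x
      = (4 * s ^ 2)⁻¹ * (x i * x j * heat s x) - kron i j / (2 * s) * heat s x := fun x => by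
    unfold heat₂; field_simp
  simp_rw [e]
  rw [integral_sub ((integrable_coord_mul_heat hs i j).const_mul _) ((integrable_heat hs).const_mul _),
    integral_const_mul, integral_const_mul, integral_coord_mul_coord_mul_heat hs, integral_heat hs]
  field_simp
  ring

lemma heat_mul_heat {s t : ℝ} (hs : 0 < s) (ht : 0 < t) (x y : E3) :
    heat s y * heat t (x - y)
      = heat (s + t) x * heat (s * t / (s + t)) (y - (s / (s + t)) • x) := by
  have hst : 0 < s + t := by positivity
  unfold heat
  have e1 : (4 * Real.pi * s) ^ (-(3 / 2) : ℝ) * (4 * Real.pi * t) ^ (-(3 / 2) : ℝ)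
      = (4 * Real.pi * (s + t)) ^ (-(3 / 2) : ℝ)
        * (4 * Real.pi * (s * t / (s + t))) ^ (-(3 / 2) : ℝ) := by
    rw [← Real.mul_rpow (by positivity) (by positivity),
      ← Real.mul_rpow (by positivity) (by positivity)]
    congr 1
    field_simp
  have e2 : -(‖y‖ ^ 2 / (4 * s)) + -(‖x - y‖ ^ 2 / (4 * t)) = -(‖x‖ ^ 2 / (4 * (s + t)))
      + -(‖y - (s / (s + t)) • x‖ ^ 2 / (4 * (s * t / (s + t)))) := by
    rw [norm_sub_sq_real, norm_sub_sq_real, norm_smul, inner_smul_right, mul_pow, Real.norm_eq_abs,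
      sq_abs, real_inner_comm x y]
    field_simp
    ring
  rw [mul_mul_mul_comm, ← Real.exp_add, e1, e2, Real.exp_add, mul_mul_mul_comm]

lemma cv_heat_heat {s t : ℝ} (hs : 0 < s) (ht : 0 < t) : cv (heat s) (heat t) = heat (s + t) := by
  funext x
  have hst : 0 < s + t := by positivity
  rw [cv]
  simp_rw [heat_mul_heat hs ht]
  rw [integral_const_mul, integral_sub_right_eq_self (fun y => heat (s * t / (s + t)) y),
    integral_heat (by positivity), mul_one]

lemma cv_heat₂_heat {s t : ℝ} (hs : 0 < s) (ht : 0 < t) (i j : Fin 3) :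
    cv (heat₂ i j s) (heat t) = heat₂ i j (s + t) := by
  funext x
  have hst : 0 < s + t := by positivity
  set σ := s * t / (s + t) with hσ
  have hσ0 : 0 < σ := by positivity
  set α := s / (s + t) with hα
  rw [cv]
  have e0 : ∀ y : E3, heat₂ i j s y * heat t (x - y)
      = (y i * y j / (4 * s ^ 2) - kron i j / (2 * s))
      * (heat (s + t) x * heat σ (y - α • x)) := fun y => by
    rw [← heat_mul_heat hs ht, heat₂, mul_assoc]
  simp_rw [e0]
  unfold heat₂
  rw [← integral_add_right_eq_self _ (α • x)]
  have e : ∀ z : E3, ((z + α • x) i * (z + α • x) j / (4 * s ^ 2) - kron i j / (2 * s))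
      * (heat (s + t) x * heat σ (z + α • x - α • x))
      = heat (s + t) x * ((4 * s ^ 2)⁻¹ * (z i * z j * heat σ z)
        + (4 * s ^ 2)⁻¹ * (α * x j) * (z i * heat σ z)
        + (4 * s ^ 2)⁻¹ * (α * x i) * (z j * heat σ z)
        + ((4 * s ^ 2)⁻¹ * (α * x i * (α * x j)) - kron i j / (2 * s)) * heat σ z) := fun z => by
    rw [add_sub_cancel_right]
    simp only [PiLp.add_apply, PiLp.smul_apply, smul_eq_mul]
    ring
  simp_rw [e]
  have i1 := (integrable_coord_mul_heat hσ0 i j).const_mul (4 * s ^ 2)⁻¹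
  have i2 := (integrable_coord_heat hσ0 i).const_mul ((4 * s ^ 2)⁻¹ * (α * x j))
  have i3 := (integrable_coord_heat hσ0 j).const_mul ((4 * s ^ 2)⁻¹ * (α * x i))
  have i4 := (integrable_heat hσ0).const_mul
    ((4 * s ^ 2)⁻¹ * (α * x i * (α * x j)) - kron i j / (2 * s))
  rw [integral_const_mul]
  refine (congrArg (heat (s + t) x * ·) (integral_add ((i1.add i2).add i3) i4)).trans ?_
  rw [integral_add' (i1.add i2) i3, integral_add' i1 i2,
    integral_const_mul, integral_const_mul, integral_const_mul, integral_const_mul,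
    integral_coord_mul_coord_mul_heat hσ0, integral_coord_mul_heat_eq_zero,
    integral_coord_mul_heat_eq_zero, integral_heat hσ0, mul_comm (heat (s + t) x)]
  congr 1
  simp only [hα, hσ]
  field_simp
  ring

/-! ### Square-function type bound along the heat flow -/

/-- The pairing of `f` and `g` against the second derivatives of the heat kernel. -/
def heatPair (i j : Fin 3) (f g : E3 → ℝ) (s : ℝ) : ℝ := ∫ x, f x * cv (heat₂ i j s) g x

lemma heat_abs_le {s : ℝ} (hs : 0 < s) (x : E3) :
    |heat s x| ≤ (4 * Real.pi * s) ^ (-(3 / 2) : ℝ) := by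
  rw [abs_of_pos (heat_pos hs x)]; exact heat_le hs x

lemma measurable_cv_heat₂_uncurry (i j : Fin 3) {g : E3 → ℝ} (hg : Measurable g) :
    Measurable fun z : ℝ × E3 => cv (heat₂ i j z.1) g z.2 := by
  have h1 : Measurable fun z : (ℝ × E3) × E3 => heat₂ i j z.1.1 z.2 :=
    (measurable_heat₂_uncurry i j).comp
      (by fun_prop : Measurable fun z : (ℝ × E3) × E3 => (z.1.1, z.2))
  have : StronglyMeasurable fun z : (ℝ × E3) × E3 => heat₂ i j z.1.1 z.2 * g (z.1.2 - z.2) :=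
    Measurable.stronglyMeasurable (h1.mul (by fun_prop))
  exact this.integral_prod_right'.measurable

lemma measurable_heatPair (i j : Fin 3) {f g : E3 → ℝ} (hf : Measurable f) (hg : Measurable g) :
    Measurable (heatPair i j f g) := by
  have : StronglyMeasurable fun z : ℝ × E3 => f z.2 * cv (heat₂ i j z.1) g z.2 :=
    Measurable.stronglyMeasurable
      ((hf.comp measurable_snd).mul (measurable_cv_heat₂_uncurry i j hg))
  exact this.integral_prod_right'.measurable

lemma cv_const_mul (a : ℝ) (k f : E3 → ℝ) (x : E3) :
    cv (fun y => a * k y) f x = a * cv k f x := by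
  simp_rw [cv, mul_assoc, integral_const_mul]

lemma cv_heat_cv_heat {s t : ℝ} (hs : 0 < s) (ht : 0 < t) {f : E3 → ℝ} (hf : Integrable f)
    (hfm : Measurable f) : cv (heat s) (cv (heat t) f) = cv (heat (s + t)) f := by
  funext x
  rw [cv_cv (integrable_heat hs) (measurable_heat s) (measurable_heat t) (heat_abs_le ht) hf hfm,
    cv_heat_heat hs ht]

lemma cv_heat₂_cv_heat {s t : ℝ} (hs : 0 < s) (ht : 0 < t) (i j : Fin 3) {f : E3 → ℝ}
    (hf : Integrable f) (hfm : Measurable f) :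
    cv (heat₂ i j s) (cv (heat t) f) = cv (heat₂ i j (s + t)) f := by
  funext x
  rw [cv_cv (integrable_heat₂ hs i j) (measurable_heat₂ i j s) (measurable_heat t) (heat_abs_le ht)
    hf hfm, cv_heat₂_heat hs ht]

lemma heatPair_comm {i j : Fin 3} {f g : E3 → ℝ} {s : ℝ} (hs : 0 < s) (hf : Integrable f)
    (hg : Integrable g) (hfm : Measurable f) (hgm : Measurable g) :
    heatPair i j f g s = heatPair i j g f s :=
  integral_mul_cv_comm (measurable_heat₂ i j s) (abs_heat₂_le hs i j) (heat₂_neg i j s) hf hg hfm hgm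

lemma integral_cv_heat_mul_cv_heat₂ {i j : Fin 3} {f g : E3 → ℝ} {s t : ℝ} (hs : 0 < s)
    (ht : 0 < t) (hf : Integrable f) (hg : Integrable g) (hfm : Measurable f) (hgm : Measurable g) :
    ∫ x, cv (heat t) g x * cv (heat₂ i j s) f x = heatPair i j f g (s + t) := by
  rw [integral_mul_cv_comm (measurable_heat₂ i j s) (abs_heat₂_le hs i j) (heat₂_neg i j s)
    (integrable_cv (integrable_heat ht) hg) hf (measurable_cv (measurable_heat t) hgm) hfm,
    cv_heat₂_cv_heat hs ht i j hg hgm, heatPair]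

lemma heatPair_le_dissipation {i j : Fin 3} {f g : E3 → ℝ} {t : ℝ} (ht : 0 < t)
    (hf : Integrable f) (hg : Integrable g) (hfm : Measurable f) (hgm : Measurable g) :
    ENNReal.ofReal (2 * t * |heatPair i j f g (7 / 2 * t)|)
      ≤ ENNReal.ofReal 15 * dissipation (heat t) (cv (heat t) f) (cv (heat t) g) := by
  have ht2 : 0 < t / 2 := half_pos ht
  set M := (4 * Real.pi * t) ^ (-(3 / 2) : ℝ)
  have hM : 0 ≤ M := by positivity
  have hκk := mul_abs_heat₂_half_le ht i j
  have hu := integrable_cv (integrable_heat ht) hf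
  have hw := integrable_cv (integrable_heat ht) hg
  have hum := measurable_cv (measurable_heat t) hfm
  have hwm := measurable_cv (measurable_heat t) hgm
  have hκM : ∀ y, |t * heat₂ i j (t / 2) y| ≤ 15 * M := fun y =>
    (hκk y).trans (by gcongr; exact heat_le ht y)
  have hkM : ∀ y, |heat t y| ≤ 15 * M := fun y => (heat_abs_le ht y).trans (by linarith)
  have key := pairing_le_dissipation (κ := fun y => t * heat₂ i j (t / 2) y) (k := heat t)
    (u := cv (heat t) f) (w := cv (heat t) g) (A := 15) (by norm_num) (measurable_heat t)
    hkM ((measurable_heat₂ i j (t / 2)).const_mul t) ((integrable_heat₂ ht2 i j).const_mul t) hκM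
    (by rw [integral_const_mul, integral_heat₂ ht2, mul_zero]) hκk hu hw hum hwm
    (abs_cv_le (heat_abs_le ht) hf)
  refine le_trans (le_of_eq ?_) key
  have e : t / 2 + t + (t + t) = 7 / 2 * t := by ring
  have h3 : 0 < t / 2 + t := by positivity
  have h4 : 0 < t + t := by positivity
  simp_rw [cv_const_mul, cv_heat_cv_heat ht ht hf hfm, cv_heat_cv_heat ht ht hg hgm,
    cv_heat₂_cv_heat ht2 ht i j hf hfm, cv_heat₂_cv_heat ht2 ht i j hg hgm, mul_left_comm _ t,
    integral_const_mul]
  rw [integral_cv_heat_mul_cv_heat₂ h3 h4 hf hg hfm hgm,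
    integral_cv_heat_mul_cv_heat₂ h3 h4 hg hf hgm hfm,
    e, heatPair_comm (by positivity) hg hf hgm hfm, ← mul_add, ← two_mul, abs_mul, abs_mul,
    abs_of_pos ht, abs_two]
  ring_nf

/-- The sum of the dyadic heat pairings is controlled by the Lebesgue norms. -/
lemma exists_sum_heatPair_le {p q : ℝ} (hpq : p.HolderConjugate q) : ∃ C : ℝ, 0 < C ∧
    ∀ (i j : Fin 3) (f g : E3 → ℝ), Integrable f → Integrable g → Measurable f → Measurable g →
    ∀ t : ℝ, 0 < t → ∀ m : ℕ,
    ∑ k ∈ Finset.range m, ENNReal.ofReal (2 ^ k * t * |heatPair i j f g (7 / 2 * (2 ^ k * t))|)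
      ≤ ENNReal.ofReal C * ∫⁻ x, ENNReal.ofReal (|f x| ^ p + |g x| ^ q) := by
  obtain ⟨c, hc0, hc⟩ := exists_bellman_convexity hpq
  have hp := hpq.pos
  have hq := hpq.symm.pos
  refine ⟨(2 * (c / 15))⁻¹ * (p + q), by positivity, fun i j f g hf hg hfm hgm t ht m => ?_⟩
  set E : ℝ → ℝ≥0∞ := fun t =>
    ∫⁻ x, ENNReal.ofReal (bellman p q (cv (heat t) f x) (cv (heat t) g x)) with hE
  set N := ∫⁻ x, ENNReal.ofReal (|f x| ^ p + |g x| ^ q)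
  set G : ℝ → ℝ≥0∞ := fun t => ENNReal.ofReal (t * |heatPair i j f g (7 / 2 * t)|) with hG
  set a := ENNReal.ofReal (2 * (c / 15))
  have start : ∀ t, 0 < t → E t ≤ ENNReal.ofReal (p + q) * N := fun t ht => by
    have h1 := bellman_average hc0.le hc (measurable_heat t) (fun y => (heat_pos ht y).le)
      (heat_abs_le ht) (integrable_heat ht) (integral_heat ht) hfm hf hgm hg
    refine (le_self_add.trans h1).trans ?_
    rw [← lintegral_const_mul' _ _ ENNReal.ofReal_ne_top]
    refine lintegral_mono fun x => ?_
    rw [← ENNReal.ofReal_mul (by positivity)]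
    exact ENNReal.ofReal_le_ofReal (bellman_le hpq _ _)
  have step : ∀ t, 0 < t → E (2 * t) + a * G t ≤ E t := fun t ht => by
    have h1 := bellman_average hc0.le hc (measurable_heat t) (fun y => (heat_pos ht y).le)
      (heat_abs_le ht) (integrable_heat ht) (integral_heat ht)
      (measurable_cv (measurable_heat t) hfm) (integrable_cv (integrable_heat ht) hf)
      (measurable_cv (measurable_heat t) hgm) (integrable_cv (integrable_heat ht) hg)
    rw [cv_heat_cv_heat ht ht hf hfm, cv_heat_cv_heat ht ht hg hgm, ← two_mul] at h1
    refine le_trans (add_le_add le_rfl ?_) h1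
    have h2 := heatPair_le_dissipation (i := i) (j := j) ht hf hg hfm hgm
    calc a * G t = ENNReal.ofReal (c / 15)
          * ENNReal.ofReal (2 * t * |heatPair i j f g (7 / 2 * t)|) := by
          rw [← ENNReal.ofReal_mul (by positivity), ← ENNReal.ofReal_mul (by positivity)]
          congr 1; ring
      _ ≤ ENNReal.ofReal (c / 15) * (ENNReal.ofReal 15 * _) := by gcongr
      _ = _ := by
          rw [← mul_assoc, ← ENNReal.ofReal_mul (by positivity), div_mul_cancel₀ _ (by norm_num)]
  have sum : ∀ m : ℕ, E (2 ^ m * t) + a * ∑ k ∈ Finset.range m, G (2 ^ k * t) ≤ E t := by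
    intro m
    induction m with
    | zero => simp
    | succ m ih =>
      rw [Finset.sum_range_succ, mul_add, add_comm (a * _), ← add_assoc, pow_succ', mul_assoc]
      exact (add_le_add (step (2 ^ m * t) (by positivity)) le_rfl).trans ih
  have h := (le_add_self.trans (sum m)).trans (start t ht)
  have ha0 : a ≠ 0 := by simp only [a]; rw [ENNReal.ofReal_ne_zero_iff]; positivity
  rw [ENNReal.ofReal_mul (by positivity), ENNReal.ofReal_inv_of_pos (by positivity), mul_assoc,
    ← ENNReal.mul_le_iff_le_inv ha0 ENNReal.ofReal_ne_top]
  exact h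

lemma lintegral_Ioc_scale (G : ℝ → ℝ≥0∞) {c : ℝ} (hc : 0 < c) (A B : ℝ) :
    ∫⁻ r in Ioc (c * A) (c * B), G r = ∫⁻ r in Ioc A B, ENNReal.ofReal c * G (c * r) := by
  have h := lintegral_image_eq_lintegral_abs_deriv_mul (s := Ioc A B) (f := fun r => c * r)
    (f' := fun _ => c) measurableSet_Ioc
    (fun x _ => by simpa using ((hasDerivAt_id x).const_mul c).hasDerivWithinAt)
    (mul_right_injective₀ hc.ne').injOn G
  rw [image_mul_left_Ioc hc, abs_of_pos hc] at h
  exact h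

lemma lintegral_Ioc_le_dyadic (G : ℝ → ℝ≥0∞) (hG : Measurable G) {A : ℝ} (m : ℕ) :
    ∫⁻ r in Ioc A (2 ^ m * A), G r
      ≤ ∫⁻ r in Ioc A (2 * A), ∑ k ∈ Finset.range m, ENNReal.ofReal (2 ^ k) * G (2 ^ k * r) := by
  rw [lintegral_finsetSum _ fun k _ => by fun_prop]
  simp_rw [← lintegral_Ioc_scale G (show (0 : ℝ) < 2 ^ _ by positivity)]
  induction m with
  | zero => simp
  | succ m ih =>
    rw [Finset.sum_range_succ]
    have : Ioc A (2 ^ (m + 1) * A) ⊆ Ioc A (2 ^ m * A) ∪ Ioc (2 ^ m * A) (2 ^ m * (2 * A)) := by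
      rw [pow_succ, mul_assoc]
      exact Ioc_subset_Ioc_union_Ioc
    calc _ ≤ ∫⁻ r in Ioc A (2 ^ m * A) ∪ Ioc (2 ^ m * A) (2 ^ m * (2 * A)), G r :=
          lintegral_mono_set this
      _ ≤ _ := (lintegral_union_le _ _ _).trans (add_le_add ih le_rfl)

/-- The total heat pairing is controlled by the Lebesgue norms. -/
lemma exists_lintegral_heatPair_le {p q : ℝ} (hpq : p.HolderConjugate q) : ∃ C : ℝ, 0 < C ∧
    ∀ (i j : Fin 3) (f g : E3 → ℝ), Integrable f → Integrable g → Measurable f → Measurable g →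
    ∫⁻ s in Ioi 0, ENNReal.ofReal |heatPair i j f g s|
      ≤ ENNReal.ofReal C * ∫⁻ x, ENNReal.ofReal (|f x| ^ p + |g x| ^ q) := by
  obtain ⟨C, hC, H⟩ := exists_sum_heatPair_le hpq
  refine ⟨7 / 2 * C, by positivity, fun i j f g hf hg hfm hgm => ?_⟩
  set N := ∫⁻ x, ENNReal.ofReal (|f x| ^ p + |g x| ^ q)
  set G : ℝ → ℝ≥0∞ := fun s => ENNReal.ofReal |heatPair i j f g s| with hGdef
  have hG : Measurable G := (measurable_heatPair i j hfm hgm).abs.ennreal_ofReal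
  have bound : ∀ A : ℝ, 0 < A → ∀ m : ℕ,
      ∫⁻ r in Ioc A (2 ^ m * A), G r ≤ ENNReal.ofReal (7 / 2 * C) * N := fun A hA m => by
    refine (lintegral_Ioc_le_dyadic G hG m).trans ?_
    have hb : ∀ r ∈ Ioc A (2 * A), ∑ k ∈ Finset.range m, ENNReal.ofReal (2 ^ k) * G (2 ^ k * r)
        ≤ ENNReal.ofReal (A⁻¹) * (ENNReal.ofReal (7 / 2 * C) * N) := fun r hr => by
      have hr0 : 0 < r := hA.trans hr.1
      have h := H i j f g hf hg hfm hgm (2 / 7 * r) (by positivity) m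
      calc ∑ k ∈ Finset.range m, ENNReal.ofReal (2 ^ k) * G (2 ^ k * r)
          = ∑ k ∈ Finset.range m, ENNReal.ofReal (7 / 2 * r⁻¹) * ENNReal.ofReal
            (2 ^ k * (2 / 7 * r) * |heatPair i j f g (7 / 2 * (2 ^ k * (2 / 7 * r)))|) := by
            refine Finset.sum_congr rfl fun k _ => ?_
            rw [hGdef, ← ENNReal.ofReal_mul (by positivity), ← ENNReal.ofReal_mul (by positivity)]
            have : (7 / 2 * (2 ^ k * (2 / 7 * r)) : ℝ) = 2 ^ k * r := by ring
            rw [this]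
            congr 1
            field_simp
        _ ≤ ENNReal.ofReal (7 / 2 * r⁻¹) * (ENNReal.ofReal C * N) := by
            rw [← Finset.mul_sum]; gcongr
        _ ≤ ENNReal.ofReal (7 / 2 * A⁻¹) * (ENNReal.ofReal C * N) := by
            gcongr; exact hr.1.le
        _ = _ := by
            rw [← mul_assoc, ← mul_assoc, ← ENNReal.ofReal_mul (by positivity),
              ← ENNReal.ofReal_mul (by positivity)]
            ring_nf
    refine (setLIntegral_mono measurable_const hb).trans ?_
    rw [setLIntegral_const, Real.volume_Ioc, mul_right_comm, ← ENNReal.ofReal_mul (by positivity)]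
    have : A⁻¹ * (2 * A - A) = 1 := by field_simp; ring
    rw [this]; simp
  have hU : Ioi (0 : ℝ) = ⋃ n : ℕ, Ioc ((2 ^ n)⁻¹ : ℝ) (2 ^ n) := by
    ext x
    simp only [mem_Ioi, mem_iUnion, mem_Ioc]
    constructor
    · intro hx
      obtain ⟨n, hn⟩ := pow_unbounded_of_one_lt (max x x⁻¹) (one_lt_two (α := ℝ))
      refine ⟨n, ?_, (le_max_left _ _).trans hn.le⟩
      exact inv_lt_of_inv_lt₀ hx ((le_max_right _ _).trans_lt hn)
    · rintro ⟨n, hn, -⟩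
      exact lt_trans (by positivity) hn
  have hmono : Monotone fun n : ℕ => Ioc ((2 ^ n)⁻¹ : ℝ) (2 ^ n) := fun m n hmn =>
    Ioc_subset_Ioc (by gcongr; norm_num) (by gcongr; norm_num)
  rw [hU, setLIntegral_iUnion_of_directed _ hmono.directed_le]
  refine iSup_le fun n => ?_
  have := bound ((2 ^ n)⁻¹) (by positivity) (n + n)
  rwa [pow_add, mul_assoc, mul_inv_cancel₀ (by positivity), mul_one] at this

/-! ### The regularised Newton kernel -/

/-- The second derivatives of the regularised Newton kernel `(‖x‖² + a²) ^ (-1/2)`. -/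
def newton₂ (i j : Fin 3) (a : ℝ) (x : E3) : ℝ :=
  3 * (x i * x j) * (‖x‖ ^ 2 + a ^ 2) ^ (-(5 / 2) : ℝ)
    - kron i j * (‖x‖ ^ 2 + a ^ 2) ^ (-(3 / 2) : ℝ)

lemma integral_rpow_mul_exp_neg_div {b c : ℝ} (hb : 0 < b) (hc : 0 < c) :
    ∫ s in Ioi (0 : ℝ), s ^ (-(b + 1)) * Real.exp (-(c / s)) = (1 / c) ^ b * Real.Gamma b := by
  rw [← Real.integral_rpow_mul_exp_neg_mul_Ioi hb hc,
    ← integral_comp_rpow_Ioi (fun t => t ^ (b - 1) * Real.exp (-(c * t))) (p := -1) (by norm_num)]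
  refine setIntegral_congr_fun measurableSet_Ioi fun s hs => ?_
  have hs0 : (0 : ℝ) < s := hs
  simp only [smul_eq_mul, abs_neg, abs_one, one_mul]
  rw [← mul_assoc, ← Real.rpow_mul hs0.le, ← Real.rpow_add hs0, Real.rpow_neg_one, div_eq_mul_inv]
  congr 2
  ring

lemma integrableOn_rpow_mul_exp_neg_div {b c : ℝ} (hb : 0 < b) (hc : 0 < c) :
    IntegrableOn (fun s : ℝ => s ^ (-(b + 1)) * Real.exp (-(c / s))) (Ioi 0) := by
  by_contra h
  have := integral_undef h
  rw [integral_rpow_mul_exp_neg_div hb hc] at this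
  have h2 := Real.Gamma_pos_of_pos hb
  exact (by positivity : (1 / c) ^ b * Real.Gamma b ≠ 0) this

/-- The normalising constant relating the Newton kernel and the heat kernel. -/
def newtonConst : ℝ := 4 * (4 * Real.pi) ^ (-(3 / 2) : ℝ) * Real.Gamma (3 / 2)

lemma newtonConst_pos : 0 < newtonConst := by
  have := Real.Gamma_pos_of_pos (show (0 : ℝ) < 3 / 2 by norm_num)
  unfold newtonConst; positivity

lemma exp_mul_heat {s : ℝ} (hs : 0 < s) (a : ℝ) (x : E3) :
    Real.exp (-(a ^ 2 / (4 * s))) * heat s x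
      = (4 * Real.pi) ^ (-(3 / 2) : ℝ) * (s ^ (-(3 / 2) : ℝ)
        * Real.exp (-((‖x‖ ^ 2 + a ^ 2) / 4 / s))) := by
  unfold heat
  rw [Real.mul_rpow (by positivity) hs.le, mul_left_comm, ← Real.exp_add, mul_assoc]
  congr 4
  field_simp
  ring

lemma integral_exp_mul_heat₂ {a : ℝ} (ha : 0 < a) (i j : Fin 3) (x : E3) :
    ∫ s in Ioi (0 : ℝ), Real.exp (-(a ^ 2 / (4 * s))) * heat₂ i j s x
      = newtonConst * newton₂ i j a x := by
  set D := ‖x‖ ^ 2 + a ^ 2 with hD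
  have hD0 : 0 < D := by positivity
  have hD4 : 0 < D / 4 := by positivity
  set A := (4 * Real.pi) ^ (-(3 / 2) : ℝ) with hA
  have e : ∀ s ∈ Ioi (0 : ℝ), Real.exp (-(a ^ 2 / (4 * s))) * heat₂ i j s x
      = A * (x i * x j) / 4 * (s ^ (-(5 / 2 + 1) : ℝ) * Real.exp (-(D / 4 / s)))
        - A * kron i j / 2 * (s ^ (-(3 / 2 + 1) : ℝ) * Real.exp (-(D / 4 / s))) := fun s hs => by
    have hs0 : (0 : ℝ) < s := hs
    have r1 : s ^ (-(5 / 2 + 1) : ℝ) = s ^ (-(3 / 2) : ℝ) * (s ^ 2)⁻¹ := by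
      rw [← Real.rpow_natCast, ← Real.rpow_neg hs0.le, ← Real.rpow_add hs0]; norm_num
    have r2 : s ^ (-(3 / 2 + 1) : ℝ) = s ^ (-(3 / 2) : ℝ) * s⁻¹ := by
      rw [← Real.rpow_neg_one, ← Real.rpow_add hs0]; norm_num
    have h := exp_mul_heat hs0 a x
    rw [← hD, ← hA] at h
    rw [heat₂, mul_left_comm, h, r1, r2]
    field_simp
  rw [setIntegral_congr_fun measurableSet_Ioi e, integral_sub, integral_const_mul,
    integral_const_mul, integral_rpow_mul_exp_neg_div (by norm_num) hD4,
    integral_rpow_mul_exp_neg_div (by norm_num) hD4]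
  · have g1 : Real.Gamma (5 / 2) = 3 / 2 * Real.Gamma (3 / 2) := by
      rw [← Real.Gamma_add_one (by norm_num)]; norm_num
    have p1 : (1 / (D / 4)) ^ (5 / 2 : ℝ) = 32 * D ^ (-(5 / 2) : ℝ) := by
      rw [one_div_div, Real.div_rpow (by norm_num) hD0.le, Real.rpow_neg hD0.le, div_eq_mul_inv]
      congr 1
      rw [show (4 : ℝ) = 2 ^ (2 : ℝ) by norm_num, ← Real.rpow_mul (by norm_num)]; norm_num
    have p2 : (1 / (D / 4)) ^ (3 / 2 : ℝ) = 8 * D ^ (-(3 / 2) : ℝ) := by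
      rw [one_div_div, Real.div_rpow (by norm_num) hD0.le, Real.rpow_neg hD0.le, div_eq_mul_inv]
      congr 1
      rw [show (4 : ℝ) = 2 ^ (2 : ℝ) by norm_num, ← Real.rpow_mul (by norm_num)]; norm_num
    rw [g1, p1, p2, newtonConst, newton₂]
    ring
  · exact (integrableOn_rpow_mul_exp_neg_div (by norm_num) hD4).const_mul _
  · exact (integrableOn_rpow_mul_exp_neg_div (by norm_num) hD4).const_mul _

/-- An integrable majorant of the heat representation of the Newton kernel. -/
def newtonMajorant (a s : ℝ) : ℝ :=
  15 / 2 * (8 * Real.pi) ^ (-(3 / 2) : ℝ)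
    * (s ^ (-(3 / 2 + 1) : ℝ) * Real.exp (-(a ^ 2 / 4 / s)))

lemma integrableOn_newtonMajorant {a : ℝ} (ha : 0 < a) :
    IntegrableOn (newtonMajorant a) (Ioi 0) :=
  (integrableOn_rpow_mul_exp_neg_div (by norm_num) (by positivity)).const_mul _

lemma abs_exp_mul_heat₂_le {s : ℝ} (hs : 0 < s) (a : ℝ) (i j : Fin 3) (x : E3) :
    |Real.exp (-(a ^ 2 / (4 * s))) * heat₂ i j s x| ≤ newtonMajorant a s := by
  rw [abs_mul, abs_of_pos (Real.exp_pos _), newtonMajorant]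
  have r2 : s ^ (-(3 / 2 + 1) : ℝ) = s ^ (-(3 / 2) : ℝ) * s⁻¹ := by
    rw [← Real.rpow_neg_one, ← Real.rpow_add hs]; norm_num
  have h := abs_heat₂_le hs i j x
  have e : (4 * Real.pi * (2 * s)) ^ (-(3 / 2) : ℝ)
      = (8 * Real.pi) ^ (-(3 / 2) : ℝ) * s ^ (-(3 / 2) : ℝ) := by
    rw [← Real.mul_rpow (by positivity) hs.le]; ring_nf
  calc _ ≤ Real.exp (-(a ^ 2 / (4 * s)))
        * (15 / (2 * s) * (4 * Real.pi * (2 * s)) ^ (-(3 / 2) : ℝ)) := by gcongr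
    _ = _ := by
        rw [e, r2, div_div]
        field_simp

lemma cv_newton₂ {a : ℝ} (ha : 0 < a) (i j : Fin 3) {g : E3 → ℝ} (hg : Integrable g)
    (hgm : Measurable g) (x : E3) :
    newtonConst * cv (newton₂ i j a) g x
      = ∫ s in Ioi (0 : ℝ), Real.exp (-(a ^ 2 / (4 * s))) * cv (heat₂ i j s) g x := by
  have h_int : Integrable (Function.uncurry fun (s : ℝ) (y : E3) =>
      Real.exp (-(a ^ 2 / (4 * s))) * heat₂ i j s y * g (x - y))
      ((volume.restrict (Ioi 0)).prod volume) := by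
    refine ((integrableOn_newtonMajorant ha).mul_prod (hg.comp_sub_left x).norm).mono'
      (Measurable.aestronglyMeasurable ?_) ?_
    · have h1 := measurable_heat₂_uncurry i j
      have h2 : Measurable fun z : ℝ × E3 => Real.exp (-(a ^ 2 / (4 * z.1))) := by fun_prop
      exact (h2.mul h1).mul (by fun_prop)
    · have : ∀ᵐ z ∂((volume.restrict (Ioi (0 : ℝ))).prod (volume : Measure E3)), z.1 ∈ Ioi (0 : ℝ) :=
        Measure.quasiMeasurePreserving_fst.ae (ae_restrict_mem measurableSet_Ioi)
      filter_upwards [this] with z hz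
      simp only [Function.uncurry]
      rw [norm_mul]
      gcongr
      exact abs_exp_mul_heat₂_le hz a i j z.2
  calc newtonConst * cv (newton₂ i j a) g x
      = ∫ y, ∫ s in Ioi (0 : ℝ), Real.exp (-(a ^ 2 / (4 * s))) * heat₂ i j s y * g (x - y) := by
        simp_rw [integral_mul_const, integral_exp_mul_heat₂ ha, mul_assoc, integral_const_mul]
        rfl
    _ = ∫ s in Ioi (0 : ℝ), ∫ y, Real.exp (-(a ^ 2 / (4 * s))) * heat₂ i j s y * g (x - y) :=
        (integral_integral_swap h_int).symm
    _ = _ := by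
        simp_rw [mul_assoc, integral_const_mul]
        rfl

lemma integral_mul_cv_newton₂ {a : ℝ} (ha : 0 < a) (i j : Fin 3) {f g : E3 → ℝ}
    (hf : Integrable f) (hg : Integrable g) (hfm : Measurable f) (hgm : Measurable g) :
    newtonConst * ∫ x, f x * cv (newton₂ i j a) g x
      = ∫ s in Ioi (0 : ℝ), Real.exp (-(a ^ 2 / (4 * s))) * heatPair i j f g s := by
  have h_int : Integrable (Function.uncurry fun (s : ℝ) (x : E3) =>
      f x * (Real.exp (-(a ^ 2 / (4 * s))) * cv (heat₂ i j s) g x))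
      ((volume.restrict (Ioi 0)).prod volume) := by
    refine (((integrableOn_newtonMajorant ha).mul_const (∫ y, |g y|)).mul_prod hf.norm).mono'
      (Measurable.aestronglyMeasurable ?_) ?_
    · have h1 := measurable_cv_heat₂_uncurry i j hgm
      have h2 : Measurable fun z : ℝ × E3 => Real.exp (-(a ^ 2 / (4 * z.1))) := by fun_prop
      exact (hfm.comp measurable_snd).mul (h2.mul h1)
    · have : ∀ᵐ z ∂((volume.restrict (Ioi (0 : ℝ))).prod (volume : Measure E3)), z.1 ∈ Ioi (0 : ℝ) :=
        Measure.quasiMeasurePreserving_fst.ae (ae_restrict_mem measurableSet_Ioi)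
      filter_upwards [this] with z hz
      simp only [Function.uncurry]
      rw [norm_mul, mul_comm, ← cv_const_mul]
      gcongr
      exact abs_cv_le (fun y => abs_exp_mul_heat₂_le hz a i j y) hg z.2
  rw [← integral_const_mul]
  simp_rw [mul_left_comm newtonConst, cv_newton₂ ha i j hg hgm, ← integral_const_mul]
  rw [← integral_integral_swap h_int]
  simp_rw [mul_left_comm (f _), integral_const_mul]
  rfl

/-- A Calderón–Zygmund estimate for the regularised Newton kernel, uniform in the
regularisation. -/
lemma exists_newton₂_le {p q : ℝ} (hpq : p.HolderConjugate q) : ∃ C : ℝ, 0 < C ∧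
    ∀ (i j : Fin 3) (a : ℝ) (f g : E3 → ℝ), 0 < a →
    Integrable f → Integrable g → Measurable f → Measurable g →
    ENNReal.ofReal |∫ x, f x * cv (newton₂ i j a) g x|
      ≤ ENNReal.ofReal C * ∫⁻ x, ENNReal.ofReal (|f x| ^ p + |g x| ^ q) := by
  obtain ⟨C, hC, H⟩ := exists_lintegral_heatPair_le hpq
  have hc := newtonConst_pos
  refine ⟨newtonConst⁻¹ * C, by positivity, fun i j a f g ha hf hg hfm hgm => ?_⟩
  have h := integral_mul_cv_newton₂ ha i j hf hg hfm hgm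
  rw [← eq_inv_mul_iff_mul_eq₀ hc.ne'] at h
  rw [h, abs_mul, abs_of_pos (inv_pos.2 hc), ENNReal.ofReal_mul (by positivity),
    ENNReal.ofReal_mul (by positivity), mul_assoc]
  gcongr
  refine le_trans ?_ (H i j f g hf hg hfm hgm)
  rw [← Real.norm_eq_abs, ofReal_norm]
  refine (enorm_integral_le_lintegral_enorm _).trans
    (setLIntegral_mono' measurableSet_Ioi fun s hs => ?_)
  have hs0 : (0 : ℝ) < s := hs
  rw [← ofReal_norm, norm_mul, Real.norm_of_nonneg (Real.exp_pos _).le]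
  refine ENNReal.ofReal_le_ofReal (mul_le_of_le_one_left (abs_nonneg _) ?_)
  exact Real.exp_le_one_iff.2 (neg_nonpos.2 (by positivity))

/-- The regularised Newton kernel, up to normalisation. -/
def newton (a : ℝ) (x : E3) : ℝ := (‖x‖ ^ 2 + a ^ 2) ^ (-(1 / 2) : ℝ)

/-- The first derivatives of the regularised Newton kernel. -/
def newton₁ (i : Fin 3) (a : ℝ) (x : E3) : ℝ := -(x i * (‖x‖ ^ 2 + a ^ 2) ^ (-(3 / 2) : ℝ))

/-- Minus the Laplacian of the regularised Newton kernel. -/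
def newtonMass (a : ℝ) (x : E3) : ℝ := 3 * a ^ 2 * (‖x‖ ^ 2 + a ^ 2) ^ (-(5 / 2) : ℝ)

lemma contDiff_newton {a : ℝ} (ha : 0 < a) : ContDiff ℝ (⊤ : ℕ∞) (newton a) :=
  ContDiff.rpow_const_of_ne ((contDiff_norm_sq ℝ).add contDiff_const) fun x => by positivity

lemma hasFDerivAt_norm_sq_add_rpow {a : ℝ} (ha : 0 < a) (b : ℝ) (x : E3) :
    HasFDerivAt (fun x : E3 => (‖x‖ ^ 2 + a ^ 2) ^ b)
      ((b * (‖x‖ ^ 2 + a ^ 2) ^ (b - 1)) • (2 • innerSL ℝ x)) x := by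
  have h1 := (hasStrictFDerivAt_norm_sq x).hasFDerivAt.add_const (a ^ 2)
  exact h1.rpow_const (Or.inl (by positivity))

lemma pd_newton {a : ℝ} (ha : 0 < a) (i : Fin 3) : pd i (newton a) = newton₁ i a := by
  funext x
  unfold newton
  rw [pd, (hasFDerivAt_norm_sq_add_rpow ha _ x).fderiv]
  simp only [smul_apply, innerSL_apply_apply, inner_e3, smul_eq_mul, newton₁]
  rw [show (-(1 / 2) - 1 : ℝ) = -(3 / 2) by norm_num]
  simp
  ring

lemma pd_newton₁ {a : ℝ} (ha : 0 < a) (i j : Fin 3) : pd i (newton₁ j a) = newton₂ i j a := by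
  funext x
  unfold newton₁
  have h := (((hasFDerivAt_coord j x).mul (hasFDerivAt_norm_sq_add_rpow ha (-(3 / 2)) x))).neg
  have h2 : fderiv ℝ (fun x : E3 => -(x j * (‖x‖ ^ 2 + a ^ 2) ^ (-(3 / 2) : ℝ))) x = _ := h.fderiv
  rw [pd, h2]
  simp only [smul_apply, neg_apply,
    add_apply, innerSL_apply_apply, inner_e3, smul_eq_mul, newton₂]
  rw [show (-(3 / 2) - 1 : ℝ) = -(5 / 2) by norm_num]
  simp [e3_apply]
  ring

lemma sum_newton₂ {a : ℝ} (ha : 0 < a) (x : E3) : ∑ i, newton₂ i i a x = -newtonMass a x := by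
  have hn : ‖x‖ ^ 2 = x 0 * x 0 + x 1 * x 1 + x 2 * x 2 := by
    rw [EuclideanSpace.norm_sq_eq, Fin.sum_univ_three]
    simp [sq]
  have hD : 0 < ‖x‖ ^ 2 + a ^ 2 := by positivity
  have e : (‖x‖ ^ 2 + a ^ 2) ^ (-(3 / 2) : ℝ)
      = (‖x‖ ^ 2 + a ^ 2) ^ (-(5 / 2) : ℝ) * (‖x‖ ^ 2 + a ^ 2) := by
    nth_rewrite 3 [← Real.rpow_one (‖x‖ ^ 2 + a ^ 2)]
    rw [← Real.rpow_add hD]; norm_num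
  rw [Fin.sum_univ_three]
  simp only [newton₂, newtonMass, e, kron, if_true]
  set L := (‖x‖ ^ 2 + a ^ 2) ^ (-(5 / 2) : ℝ)
  rw [hn]; ring

lemma norm_sq_add_rpow_le_pow {a r : ℝ} (hr : 0 < r) {x : E3} (hx : r ≤ ‖x‖) (n : ℕ) :
    (‖x‖ ^ 2 + a ^ 2) ^ (-((n : ℝ) / 2)) ≤ (r⁻¹) ^ n := by
  have hx0 : 0 < ‖x‖ := hr.trans_le hx
  have h1 : (‖x‖ ^ 2 + a ^ 2) ^ (-((n : ℝ) / 2)) ≤ (r ^ 2) ^ (-((n : ℝ) / 2)) :=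
    Real.rpow_le_rpow_of_nonpos (by positivity) (by nlinarith [sq_nonneg a])
      (neg_nonpos.2 (by positivity))
  refine h1.trans_eq ?_
  rw [← Real.rpow_natCast, ← Real.rpow_mul hr.le, inv_pow, ← Real.rpow_natCast r n,
    ← Real.rpow_neg hr.le]
  congr 1
  push_cast
  ring

lemma abs_newton_le {a r : ℝ} (hr : 0 < r) {x : E3} (hx : r ≤ ‖x‖) : |newton a x| ≤ r⁻¹ := by
  have h := norm_sq_add_rpow_le_pow (a := a) hr hx 1
  rw [newton, abs_of_nonneg (by positivity)]
  simpa using h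

lemma norm_sq_mul_rpow_le {a : ℝ} (ha : 0 < a) (b : ℝ) (x : E3) :
    ‖x‖ ^ 2 * (‖x‖ ^ 2 + a ^ 2) ^ b ≤ (‖x‖ ^ 2 + a ^ 2) ^ (b + 1) := by
  rw [Real.rpow_add_one (by positivity), mul_comm]
  gcongr
  nlinarith [sq_nonneg a]

lemma abs_newton₁_le {a r : ℝ} (ha : 0 < a) (hr : 0 < r) (i : Fin 3) {x : E3} (hx : r ≤ ‖x‖) :
    |newton₁ i a x| ≤ (r⁻¹) ^ 2 := by
  have h := norm_sq_add_rpow_le_pow (a := a) hr hx 2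
  have hD : 0 < ‖x‖ ^ 2 + a ^ 2 := by positivity
  refine le_trans ?_ h
  rw [newton₁, abs_neg, abs_mul, abs_of_nonneg (show 0 ≤ (‖x‖ ^ 2 + a ^ 2) ^ (-(3 / 2) : ℝ) by positivity)]
  have h1 : |x i| ≤ (‖x‖ ^ 2 + a ^ 2) ^ (1 / 2 : ℝ) := by
    rw [← Real.sqrt_eq_rpow]
    refine (abs_coord_le x i).trans (Real.le_sqrt_of_sq_le (by nlinarith [sq_nonneg a]))
  calc _ ≤ (‖x‖ ^ 2 + a ^ 2) ^ (1 / 2 : ℝ) * (‖x‖ ^ 2 + a ^ 2) ^ (-(3 / 2) : ℝ) := by gcongr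
    _ = _ := by rw [← Real.rpow_add hD]; norm_num

lemma abs_newton₂_le_rpow {a : ℝ} (ha : 0 < a) (i j : Fin 3) (x : E3) :
    |newton₂ i j a x| ≤ 4 * (‖x‖ ^ 2 + a ^ 2) ^ (-(3 / 2) : ℝ) := by
  have hD : 0 < ‖x‖ ^ 2 + a ^ 2 := by positivity
  have h2 := norm_sq_mul_rpow_le ha (-(5 / 2)) x
  rw [show (-(5 / 2) + 1 : ℝ) = -(3 / 2) by norm_num] at h2
  have h3 := abs_coord_mul_le x i j
  have h4 := abs_kron_le i j
  have p5 : 0 ≤ (‖x‖ ^ 2 + a ^ 2) ^ (-(5 / 2) : ℝ) := by positivity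
  have p3 : 0 ≤ (‖x‖ ^ 2 + a ^ 2) ^ (-(3 / 2) : ℝ) := by positivity
  calc |newton₂ i j a x|
      ≤ |3 * (x i * x j) * (‖x‖ ^ 2 + a ^ 2) ^ (-(5 / 2) : ℝ)|
        + |kron i j * (‖x‖ ^ 2 + a ^ 2) ^ (-(3 / 2) : ℝ)| := abs_sub _ _
    _ = 3 * (|x i * x j| * (‖x‖ ^ 2 + a ^ 2) ^ (-(5 / 2) : ℝ))
        + |kron i j| * (‖x‖ ^ 2 + a ^ 2) ^ (-(3 / 2) : ℝ) := by
        rw [abs_mul, abs_mul 3, abs_mul (kron i j), abs_of_nonneg p5, abs_of_nonneg p3]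
        norm_num; ring
    _ ≤ 3 * (‖x‖ ^ 2 * (‖x‖ ^ 2 + a ^ 2) ^ (-(5 / 2) : ℝ))
        + 1 * (‖x‖ ^ 2 + a ^ 2) ^ (-(3 / 2) : ℝ) := by gcongr
    _ ≤ _ := by linarith

lemma abs_newton₂_le {a r : ℝ} (ha : 0 < a) (hr : 0 < r) (i j : Fin 3) {x : E3} (hx : r ≤ ‖x‖) :
    |newton₂ i j a x| ≤ 4 * (r⁻¹) ^ 3 := by
  have h := norm_sq_add_rpow_le_pow (a := a) hr hx 3
  norm_num only [Nat.cast_ofNat] at h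
  exact (abs_newton₂_le_rpow ha i j x).trans (by gcongr)

lemma exists_abs_newton₂_le {a : ℝ} (ha : 0 < a) :
    ∃ M, ∀ i j x, |newton₂ i j a x| ≤ M := by
  refine ⟨4 * (a ^ 2) ^ (-(3 / 2) : ℝ), fun i j x => (abs_newton₂_le_rpow ha i j x).trans ?_⟩
  gcongr 4 * ?_
  exact Real.rpow_le_rpow_of_nonpos (by positivity) (by nlinarith [sq_nonneg ‖x‖]) (by norm_num)

lemma measurable_newton₂ (i j : Fin 3) (a : ℝ) : Measurable (newton₂ i j a) := by
  have h := measurable_coord i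
  have h' := measurable_coord j
  unfold newton₂
  fun_prop

/-! ### Smooth truncations of the Newton kernel -/

lemma contDiff_pd {f : E3 → ℝ} (hf : ContDiff ℝ (⊤ : ℕ∞) f) (i : Fin 3) :
    ContDiff ℝ (⊤ : ℕ∞) (pd i f) :=
  (hf.fderiv_right (by simp)).clm_apply contDiff_const

lemma hasCompactSupport_pd {f : E3 → ℝ} (hf : HasCompactSupport f) (i : Fin 3) :
    HasCompactSupport (pd i f) :=
  hf.fderiv_apply ℝ (e3 i)

lemma pd_congr {f g : E3 → ℝ} {x : E3} (h : f =ᶠ[nhds x] g) (i : Fin 3) : pd i f x = pd i g x := by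
  rw [pd, pd, h.fderiv_eq]

lemma exists_truncated_newton {a : ℝ} (ha : 0 < a) {ρ : ℝ} (hρ : 0 < ρ) :
    ∃ k : E3 → ℝ, ContDiff ℝ (⊤ : ℕ∞) k ∧ HasCompactSupport k ∧
      (∀ x ∈ Metric.ball (0 : E3) ρ, k x = newton a x) ∧
      (∀ i, ∀ x ∈ Metric.ball (0 : E3) ρ, pd i k x = newton₁ i a x) ∧
      (∀ i j, ∀ x ∈ Metric.ball (0 : E3) ρ, pd i (pd j k) x = newton₂ i j a x) := by
  let χ : ContDiffBump (0 : E3) := ⟨ρ, 2 * ρ, hρ, by linarith⟩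
  have h0 : ∀ x ∈ Metric.ball (0 : E3) ρ, χ x * newton a x = newton a x := fun x hx => by
    rw [χ.one_of_mem_closedBall (Metric.ball_subset_closedBall hx), one_mul]
  have hn : ∀ x ∈ Metric.ball (0 : E3) ρ, Metric.ball (0 : E3) ρ ∈ nhds x := fun x hx =>
    Metric.isOpen_ball.mem_nhds hx
  have h1 : ∀ i, ∀ x ∈ Metric.ball (0 : E3) ρ,
      pd i (fun x => χ x * newton a x) x = newton₁ i a x := fun i x hx => by
    rw [pd_congr (Filter.eventuallyEq_of_mem (hn x hx) h0), pd_newton ha]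
  refine ⟨fun x => χ x * newton a x, χ.contDiff.mul (contDiff_newton ha),
    χ.hasCompactSupport.mul_right, h0, h1, fun i j x hx => ?_⟩
  rw [pd_congr (Filter.eventuallyEq_of_mem (hn x hx) (h1 j)), pd_newton₁ ha]

/-! ### Differentiating a convolution -/

lemma contDiff_cv {k h : E3 → ℝ} (hk : ContDiff ℝ (⊤ : ℕ∞) k) (hkc : HasCompactSupport k)
    (hh : Integrable h) : ContDiff ℝ (⊤ : ℕ∞) (cv k h) :=
  hkc.contDiff_convolution_left (ContinuousLinearMap.lsmul ℝ ℝ) hk hh.locallyIntegrable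

lemma pd_cv {k h : E3 → ℝ} (hk : ContDiff ℝ (⊤ : ℕ∞) k) (hkc : HasCompactSupport k)
    (hh : Integrable h) (i : Fin 3) : pd i (cv k h) = cv (pd i k) h := by
  funext x
  have hk1 : ContDiff ℝ 1 k := hk.of_le (by exact_mod_cast le_top)
  have h1 := hkc.hasFDerivAt_convolution_left (ContinuousLinearMap.lsmul ℝ ℝ) hk1
    hh.locallyIntegrable x
  have h2 : fderiv ℝ (cv k h) x = _ := h1.fderiv
  have hex := (hkc.fderiv ℝ).convolutionExists_left
    ((ContinuousLinearMap.lsmul ℝ ℝ).precompL E3) (hk1.continuous_fderiv one_ne_zero)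
    hh.locallyIntegrable x
  rw [pd, h2, convolution_def, ContinuousLinearMap.integral_apply hex]
  rfl

lemma pd_comp_smul (c : ℝ) (f : E3 → ℝ) (i : Fin 3) :
    pd i (fun x => f (c • x)) = fun x => c * pd i f (c • x) := by
  funext x
  have h : fderiv ℝ (fun x => f (c • x)) x = c • fderiv ℝ f (c • x) := fderiv_comp_smul c
  rw [pd, h, smul_apply, smul_eq_mul, pd]

lemma pd_const_mul (c : ℝ) (f : E3 → ℝ) (i : Fin 3) :
    pd i (fun x => c * f x) = fun x => c * pd i f x := by
  funext x
  have h : fderiv ℝ (c • f) x = c • fderiv ℝ f x :=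
    congrFun (fderiv_const_smul_field c) x
  rw [pd, ← smul_eq_mul, pd, ← smul_apply, ← h]
  rfl

lemma pd_mul {f g : E3 → ℝ} (hf : ContDiff ℝ (⊤ : ℕ∞) f) (hg : ContDiff ℝ (⊤ : ℕ∞) g)
    (i : Fin 3) : pd i (fun x => f x * g x) = fun x => f x * pd i g x + pd i f x * g x := by
  funext x
  have h := fderiv_fun_mul (hf.differentiable (by simp)).differentiableAt
    (hg.differentiable (by simp)).differentiableAt (x := x)
  rw [pd, h, add_apply, smul_apply, smul_apply, smul_eq_mul, smul_eq_mul,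
    pd, pd, mul_comm (g x)]

lemma pd_add {f g : E3 → ℝ} (hf : ContDiff ℝ (⊤ : ℕ∞) f) (hg : ContDiff ℝ (⊤ : ℕ∞) g)
    (i : Fin 3) : pd i (fun x => f x + g x) = fun x => pd i f x + pd i g x := by
  funext x
  have h := fderiv_fun_add (hf.differentiable (by simp)).differentiableAt
    (hg.differentiable (by simp)).differentiableAt (x := x)
  rw [pd, h, add_apply, pd, pd]

lemma pd_pd_mul {f g : E3 → ℝ} (hf : ContDiff ℝ (⊤ : ℕ∞) f) (hg : ContDiff ℝ (⊤ : ℕ∞) g)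
    (i j : Fin 3) (x : E3) :
    pd i (pd j (fun x => f x * g x)) x = f x * pd i (pd j g) x
      + (pd i f x * pd j g x + pd j f x * pd i g x + pd i (pd j f) x * g x) := by
  have hf' := contDiff_pd hf j
  have hg' := contDiff_pd hg j
  rw [pd_mul hf hg j, pd_add (hf.mul hg') (hf'.mul hg), pd_mul hf hg', pd_mul hf' hg]
  ring

lemma pd_eq_zero_of_eqOn_const {f : E3 → ℝ} {U : Set E3} (hU : IsOpen U) {c : ℝ}
    (hf : ∀ x ∈ U, f x = c) (i : Fin 3) : ∀ x ∈ U, pd i f x = 0 := fun x hx => by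
  have h : f =ᶠ[nhds x] fun _ => c := Filter.eventuallyEq_of_mem (hU.mem_nhds hx) hf
  rw [pd_congr h, pd]
  simp

lemma exists_abs_le_of_compactSupport {f : E3 → ℝ} (hf : ContDiff ℝ (⊤ : ℕ∞) f)
    (hc : HasCompactSupport f) : ∃ C, 0 ≤ C ∧ ∀ x, |f x| ≤ C := by
  obtain ⟨C, hC⟩ := hf.continuous.bounded_above_of_compact_support hc
  exact ⟨C, (abs_nonneg _).trans (hC 0), hC⟩

/-- Cutoff functions at scale `R`, with derivative bounds uniform in `R`. -/
lemma exists_cutoff {γ₁ γ₂ : ℝ} (h1 : 0 < γ₁) (h12 : γ₁ < γ₂) :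
    ∃ C, 0 ≤ C ∧ ∀ R, 0 < R → ∃ η : E3 → ℝ, ContDiff ℝ (⊤ : ℕ∞) η ∧
      (∀ x, 0 ≤ η x) ∧ (∀ x, η x ≤ 1) ∧ tsupport η ⊆ Metric.closedBall 0 (γ₂ * R) ∧
      (∀ x, ‖x‖ < γ₁ * R → η x = 1) ∧
      (∀ i x, |pd i η x| ≤ C * R⁻¹) ∧ (∀ i j x, |pd i (pd j η) x| ≤ C * R⁻¹ ^ 2) ∧
      (∀ i x, ‖x‖ < γ₁ * R → pd i η x = 0) ∧
      (∀ i j x, ‖x‖ < γ₁ * R → pd i (pd j η) x = 0) := by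
  let b : ContDiffBump (0 : E3) := ⟨γ₁, γ₂, h1, h12⟩
  have hb : ContDiff ℝ (⊤ : ℕ∞) b := b.contDiff
  have hbc : HasCompactSupport b := b.hasCompactSupport
  choose C₁ hC₁ hb₁ using fun i =>
    exists_abs_le_of_compactSupport (contDiff_pd hb i) (hasCompactSupport_pd hbc i)
  choose C₂ hC₂ hb₂ using fun i j =>
    exists_abs_le_of_compactSupport (contDiff_pd (contDiff_pd hb j) i)
      (hasCompactSupport_pd (hasCompactSupport_pd hbc j) i)
  have hs1 : 0 ≤ ∑ i, C₁ i := Finset.sum_nonneg fun i _ => hC₁ i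
  have hs2 : 0 ≤ ∑ i, ∑ j, C₂ i j :=
    Finset.sum_nonneg fun i _ => Finset.sum_nonneg fun j _ => hC₂ i j
  have hl1 : ∀ i, C₁ i ≤ ∑ i, C₁ i := fun i =>
    Finset.single_le_sum (fun i _ => hC₁ i) (Finset.mem_univ i)
  have hl2 : ∀ i j, C₂ i j ≤ ∑ i, ∑ j, C₂ i j := fun i j =>
    (Finset.single_le_sum (fun j _ => hC₂ i j) (Finset.mem_univ j)).trans
      (Finset.single_le_sum (f := fun i => ∑ j, C₂ i j)
        (fun i _ => Finset.sum_nonneg fun j _ => hC₂ i j) (Finset.mem_univ i))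
  refine ⟨∑ i, C₁ i + ∑ i, ∑ j, C₂ i j, by positivity, fun R hR => ?_⟩
  have hη : ContDiff ℝ (⊤ : ℕ∞) fun x : E3 => b (R⁻¹ • x) := hb.comp (contDiff_const_smul _)
  have e1 : ∀ i, pd i (fun x : E3 => b (R⁻¹ • x)) = fun x => R⁻¹ * pd i b (R⁻¹ • x) :=
    fun i => pd_comp_smul _ _ _
  have e2 : ∀ i j, pd i (pd j (fun x : E3 => b (R⁻¹ • x)))
      = fun x => R⁻¹ * (R⁻¹ * pd i (pd j b) (R⁻¹ • x)) := fun i j => by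
    rw [e1, pd_const_mul, pd_comp_smul]
  have hball : ∀ x : E3, ‖x‖ < γ₁ * R → b (R⁻¹ • x) = 1 := fun x hx => by
    refine b.one_of_mem_closedBall ?_
    rw [mem_closedBall_zero_iff, norm_smul, norm_inv, Real.norm_of_nonneg hR.le,
      inv_mul_le_iff₀ hR, mul_comm R]
    exact hx.le
  have hopen : IsOpen {x : E3 | ‖x‖ < γ₁ * R} := isOpen_lt continuous_norm continuous_const
  refine ⟨fun x => b (R⁻¹ • x), hη, fun x => b.nonneg, fun x => b.le_one, ?_, hball, ?_, ?_,
    fun i => pd_eq_zero_of_eqOn_const hopen hball i,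
    fun i j => pd_eq_zero_of_eqOn_const hopen (pd_eq_zero_of_eqOn_const hopen hball j) i⟩
  · refine closure_minimal (fun x hx => ?_) Metric.isClosed_closedBall
    have h : R⁻¹ • x ∈ Function.support b := hx
    rw [b.support_eq, mem_ball_zero_iff, norm_smul, norm_inv, Real.norm_of_nonneg hR.le,
      inv_mul_lt_iff₀ hR, mul_comm R] at h
    exact mem_closedBall_zero_iff.2 h.le
  · intro i x
    rw [e1, abs_mul, abs_of_pos (inv_pos.2 hR), mul_comm]
    gcongr
    linarith [hb₁ i (R⁻¹ • x), hl1 i]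
  · intro i j x
    rw [e2]
    beta_reduce
    rw [← mul_assoc, abs_mul, ← sq, abs_of_pos (by positivity), mul_comm]
    gcongr
    linarith [hb₂ i j (R⁻¹ • x), hl2 i j]

lemma cv_congr {k k' h : E3 → ℝ} {x : E3} (H : ∀ y, h (x - y) ≠ 0 → k y = k' y) :
    cv k h x = cv k' h x := by
  refine integral_congr_ae (Filter.Eventually.of_forall fun y => ?_)
  beta_reduce
  by_cases hy : h (x - y) = 0
  · rw [hy, mul_zero, mul_zero]
  · rw [H y hy]

lemma abs_cv_le_of_support {k h : E3 → ℝ} {x : E3} {M : ℝ} (hM : 0 ≤ M) (hh : Integrable h)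
    (H : ∀ y, h (x - y) ≠ 0 → |k y| ≤ M) : |cv k h x| ≤ M * ∫ y, |h y| := by
  classical
  have h1 : cv k h x = cv ({y | |k y| ≤ M}.indicator k) h x :=
    cv_congr fun y hy => (indicator_of_mem (show y ∈ {y | |k y| ≤ M} from H y hy) k).symm
  rw [h1]
  refine abs_cv_le (fun y => ?_) hh x
  by_cases hy : |k y| ≤ M
  · rwa [indicator_of_mem (show y ∈ {y | |k y| ≤ M} from hy)]
  · rw [indicator_of_notMem (show y ∉ {y | |k y| ≤ M} from hy), abs_zero]
    exact hM

lemma cv_newtonMass {a : ℝ} (ha : 0 < a) {h : E3 → ℝ} (hh : Integrable h) (x : E3) :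
    cv (newtonMass a) h x = -∑ i, cv (newton₂ i i a) h x := by
  obtain ⟨M, hM⟩ := exists_abs_newton₂_le ha
  have e : newtonMass a = fun y => -∑ i, newton₂ i i a y := funext fun y => by
    rw [sum_newton₂ ha, neg_neg]
  rw [e]
  simp_rw [cv]
  rw [← integral_finsetSum _ fun i _ =>
    integrable_mul_comp_sub (measurable_newton₂ i i a) (hM i i) hh x, ← integral_neg]
  simp_rw [neg_mul, Finset.sum_mul]

/-- Test functions whose second derivatives are the truncated second derivatives of a Newton
potential, up to errors of order `R⁻³` supported away from the source. -/
lemma exists_test_function {γ γ₁ γ₂ : ℝ} (h0 : 0 < γ) (h1 : γ < γ₁) (h12 : γ₁ < γ₂)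
    (h2 : γ₂ < 1) : ∃ C, 0 ≤ C ∧ ∀ R, 4 / γ < R → ∃ η : E3 → ℝ, ContDiff ℝ (⊤ : ℕ∞) η ∧
      (∀ x, 0 ≤ η x) ∧ (∀ x, η x ≤ 1) ∧ (∀ x, ‖x‖ < γ₁ * R → η x = 1) ∧
      ∀ a, 0 < a → ∀ h : E3 → ℝ, Integrable h → (∀ x, h x ≠ 0 → ‖x‖ < 4) →
      ∃ φ : E3 → ℝ, ContDiff ℝ (⊤ : ℕ∞) φ ∧ HasCompactSupport φ ∧
        tsupport φ ⊆ Metric.closedBall 0 (γ₂ * R) ∧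
        ∀ i j x, ‖x‖ < R → |pd i (pd j φ) x - η x * cv (newton₂ i j a) h x| ≤
          {x : E3 | γ * R < ‖x‖}.indicator (fun _ => C * R⁻¹ ^ 3 * ∫ y, |h y|) x := by
  obtain ⟨C, hC, H⟩ := exists_cutoff (h0.trans h1) h12
  have hδ : 0 < γ₁ - γ := by linarith
  refine ⟨2 * (C * ((γ₁ - γ)⁻¹ ^ 2)) + C * (γ₁ - γ)⁻¹, by positivity, fun R hR => ?_⟩
  have hγR : 4 < γ * R := by rwa [div_lt_iff₀ h0, mul_comm] at hR
  have hR0 : 0 < R := lt_trans (by positivity) hR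
  have hR4 : 4 < R := by nlinarith
  obtain ⟨η, hη, hη0, hη1, hηs, hηe, b1, b2, z1, z2⟩ := H R hR0
  refine ⟨η, hη, hη0, hη1, hηe, fun a ha h hh hs => ?_⟩
  obtain ⟨k, hk, hkc, k0, k1, k2⟩ := exists_truncated_newton ha (show 0 < 2 * R by linarith)
  have hψ := contDiff_cv hk hkc hh
  have hφs : tsupport (fun x => η x * cv k h x) ⊆ tsupport η :=
    closure_mono (Function.support_mul_subset_left _ _)
  refine ⟨fun x => η x * cv k h x, hη.mul hψ, ?_, hφs.trans hηs, fun i j x hx => ?_⟩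
  · exact (isCompact_closedBall (0 : E3) (γ₂ * R)).of_isClosed_subset (isClosed_tsupport _)
      (hφs.trans hηs)
  have hy : ∀ y, h (x - y) ≠ 0 → y ∈ Metric.ball (0 : E3) (2 * R) := fun y hy => by
    have t1 := hs _ hy
    have t2 := norm_sub_norm_le y x
    rw [norm_sub_rev] at t2
    rw [mem_ball_zero_iff]
    linarith
  have c0 : cv k h x = cv (newton a) h x := cv_congr fun y hz => k0 y (hy y hz)
  have c1 : ∀ i, pd i (cv k h) x = cv (newton₁ i a) h x := fun i => by
    rw [pd_cv hk hkc hh]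
    exact cv_congr fun y hz => k1 i y (hy y hz)
  have c2 : pd i (pd j (cv k h)) x = cv (newton₂ i j a) h x := by
    rw [pd_cv hk hkc hh, pd_cv (contDiff_pd hk j) (hasCompactSupport_pd hkc j) hh]
    exact cv_congr fun y hz => k2 i j y (hy y hz)
  rw [pd_pd_mul hη hψ, c0, c1, c1, c2, add_sub_cancel_left]
  by_cases hxγ : ‖x‖ < γ₁ * R
  · rw [z1 i x hxγ, z1 j x hxγ, z2 i j x hxγ]
    simp only [zero_mul, add_zero, abs_zero]
    exact indicator_nonneg (fun _ _ => mul_nonneg (by positivity)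
      (integral_nonneg fun _ => abs_nonneg _)) x
  push Not at hxγ
  have hxγ' : γ * R < ‖x‖ := lt_of_lt_of_le (by gcongr) hxγ
  rw [indicator_of_mem (show x ∈ {x : E3 | γ * R < ‖x‖} from hxγ')]
  have hfar : ∀ y, h (x - y) ≠ 0 → (γ₁ - γ) * R ≤ ‖y‖ := fun y hz => by
    have t1 := hs _ hz
    have t2 := norm_sub_norm_le x y
    nlinarith
  have hr : 0 < (γ₁ - γ) * R := by positivity
  have n0 := abs_cv_le_of_support (k := newton a) (by positivity) hh
    fun y hz => abs_newton_le hr (hfar y hz)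
  have n1 := fun i => abs_cv_le_of_support (k := newton₁ i a) (by positivity) hh
    fun y hz => abs_newton₁_le ha hr i (hfar y hz)
  set I := ∫ y, |h y|
  have hI : 0 ≤ I := integral_nonneg fun _ => abs_nonneg _
  calc _ ≤ |pd i η x * cv (newton₁ j a) h x| + |pd j η x * cv (newton₁ i a) h x|
        + |pd i (pd j η) x * cv (newton a) h x| := abs_add_three _ _ _
    _ ≤ C * R⁻¹ * ((((γ₁ - γ) * R)⁻¹) ^ 2 * I) + C * R⁻¹ * ((((γ₁ - γ) * R)⁻¹) ^ 2 * I)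
        + C * R⁻¹ ^ 2 * (((γ₁ - γ) * R)⁻¹ * I) := by
        simp_rw [abs_mul]
        gcongr
        · exact b1 i x
        · exact n1 j
        · exact b1 j x
        · exact n1 i
        · exact b2 i j x
    _ = _ := by
        rw [mul_inv]
        ring

lemma integrable_mul_cv_newton₂ {a : ℝ} (ha : 0 < a) (i j : Fin 3) {f h : E3 → ℝ}
    (hf : Integrable f) (hh : Integrable h) (hhm : Measurable h) :
    Integrable fun x => f x * cv (newton₂ i j a) h x := by
  obtain ⟨M, hM⟩ := exists_abs_newton₂_le ha
  exact hf.mul_bdd (measurable_cv (measurable_newton₂ i j a) hhm).aestronglyMeasurable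
    (Filter.Eventually.of_forall fun x => abs_cv_le (hM i j) hh x)

lemma integrable_mul_pd_pd {f φ : E3 → ℝ} (hf : Integrable f) (hφ : ContDiff ℝ (⊤ : ℕ∞) φ)
    (hφc : HasCompactSupport φ) (i j : Fin 3) : Integrable fun x => f x * pd i (pd j φ) x := by
  have h1 := contDiff_pd (contDiff_pd hφ j) i
  obtain ⟨C, -, hC⟩ := exists_abs_le_of_compactSupport h1
    (hasCompactSupport_pd (hasCompactSupport_pd hφc j) i)
  exact hf.mul_bdd h1.continuous.aestronglyMeasurable (Filter.Eventually.of_forall hC)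

lemma abs_integral_mul_le_of_abs_le_indicator {f e : E3 → ℝ} {T : Set E3} {M : ℝ}
    (hT : MeasurableSet T) (hf : Integrable f)
    (he : ∀ x, f x ≠ 0 → |e x| ≤ T.indicator (fun _ => M) x) :
    |∫ x, f x * e x| ≤ M * ∫ x in T, |f x| := by
  rw [← integral_indicator hT, ← integral_const_mul, ← Real.norm_eq_abs]
  refine norm_integral_le_of_norm_le ((hf.abs.indicator hT).const_mul M)
    (Filter.Eventually.of_forall fun x => ?_)
  rw [norm_mul, Real.norm_eq_abs, Real.norm_eq_abs]
  by_cases hx : f x = 0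
  · by_cases hxT : x ∈ T <;> simp [hx, hxT]
  · have h := he x hx
    by_cases hxT : x ∈ T
    · rw [indicator_of_mem hxT] at h ⊢
      rw [mul_comm]
      gcongr
    · rw [indicator_of_notMem hxT] at h ⊢
      rw [abs_nonpos_iff.1 h]
      simp

/-- The distributional pressure equation tested with truncated Newton potentials. -/
lemma exists_pairing_newtonMass_le {γ γ₁ γ₂ P Q : ℝ} (h0 : 0 < γ) (h1 : γ < γ₁) (h12 : γ₁ < γ₂)
    (h2 : γ₂ < 1) (hQP : Q.HolderConjugate P) :
    ∃ C, 0 < C ∧ ∀ R, 4 / γ < R → ∃ η : E3 → ℝ, ContDiff ℝ (⊤ : ℕ∞) η ∧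
      (∀ x, 0 ≤ η x) ∧ (∀ x, η x ≤ 1) ∧ (∀ x, ‖x‖ < γ₁ * R → η x = 1) ∧
      ∀ (p : E3 → ℝ) (w : Fin 3 → Fin 3 → E3 → ℝ), Integrable p →
      (∀ i j, Measurable (w i j)) → (∀ i j, Integrable (w i j)) →
      (∀ x, R ≤ ‖x‖ → p x = 0) → (∀ i j x, R ≤ ‖x‖ → w i j x = 0) →
      (∀ φ : E3 → ℝ, ContDiff ℝ (⊤ : ℕ∞) φ → HasCompactSupport φ →
        tsupport φ ⊆ Metric.closedBall 0 (γ₂ * R) →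
        ∫ x, p x * ∑ i, pd i (pd i φ) x = -∫ x, ∑ i, ∑ j, w i j x * pd i (pd j φ) x) →
      ∀ a, 0 < a → ∀ h : E3 → ℝ, Integrable h → Measurable h →
      (∀ x, h x ≠ 0 → 3 < ‖x‖ ∧ ‖x‖ < 4) →
      ENNReal.ofReal |∫ x, p x * η x * cv (newtonMass a) h x| ≤
        (∑ i, ∑ j, ENNReal.ofReal C *
          ∫⁻ x, ENNReal.ofReal (|{x : E3 | 1 < ‖x‖}.indicator (w i j) x| ^ Q + |h x| ^ P))
        + ENNReal.ofReal ((∫ x, |h x|) * (C * ((∑ i, ∑ j, ∫ x in {x : E3 | ‖x‖ ≤ 1}, |w i j x|)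
          + R⁻¹ ^ 3 * ((∫ x in {x : E3 | γ * R < ‖x‖}, |p x|)
            + ∑ i, ∑ j, ∫ x in {x : E3 | γ * R < ‖x‖}, |w i j x|)))) := by
  obtain ⟨C₁, hC₁, H₁⟩ := exists_test_function h0 h1 h12 h2
  obtain ⟨C₂, hC₂, H₂⟩ := exists_newton₂_le hQP
  refine ⟨max C₂ (3 * C₁ + 1), lt_max_of_lt_left hC₂, fun R hR => ?_⟩
  have hR0 : 0 < R := lt_trans (by positivity) hR
  obtain ⟨η, hη, hη0, hη1, hηe, H₃⟩ := H₁ R hR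
  refine ⟨η, hη, hη0, hη1, hηe, fun p w hp hwm hw hp0 hw0 hpde a ha h hh hhm hs => ?_⟩
  obtain ⟨φ, hφ, hφc, hφs, H₄⟩ := H₃ a ha h hh fun x hx => (hs x hx).2
  set N := fun i j => cv (newton₂ i j a) h with hN
  set T := {x : E3 | γ * R < ‖x‖} with hT
  have hTm : MeasurableSet T := measurableSet_lt measurable_const measurable_norm
  have hBm : MeasurableSet {x : E3 | ‖x‖ ≤ 1} := measurableSet_le measurable_norm measurable_const
  have hOm : MeasurableSet {x : E3 | 1 < ‖x‖} := measurableSet_lt measurable_const measurable_norm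
  set I := ∫ x, |h x| with hI
  have hI0 : 0 ≤ I := integral_nonneg fun _ => abs_nonneg _
  have hηb : ∀ x, ‖η x‖ ≤ 1 := fun x => by
    rw [Real.norm_of_nonneg (hη0 x)]; exact hη1 x
  have hηm : AEStronglyMeasurable η volume := hη.continuous.aestronglyMeasurable
  have hpη : Integrable fun x => p x * η x :=
    hp.mul_bdd hηm (Filter.Eventually.of_forall hηb)
  have hwη : ∀ i j, Integrable fun x => w i j x * η x := fun i j =>
    (hw i j).mul_bdd hηm (Filter.Eventually.of_forall hηb)
  have iA : ∀ i, Integrable fun x => p x * pd i (pd i φ) x := fun i =>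
    integrable_mul_pd_pd hp hφ hφc i i
  have iB : ∀ i, Integrable fun x => p x * η x * N i i x := fun i =>
    integrable_mul_cv_newton₂ ha i i hpη hh hhm
  have iC : ∀ i j, Integrable fun x => w i j x * pd i (pd j φ) x := fun i j =>
    integrable_mul_pd_pd (hw i j) hφ hφc i j
  have iD : ∀ i j, Integrable fun x => w i j x * η x * N i j x := fun i j =>
    integrable_mul_cv_newton₂ ha i j (hwη i j) hh hhm
  have key : ∫ x, p x * η x * cv (newtonMass a) h x
      = (∑ i, ∫ x, p x * (pd i (pd i φ) x - η x * N i i x))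
        + ∑ i, ∑ j, ((∫ x, w i j x * η x * N i j x)
          + ∫ x, w i j x * (pd i (pd j φ) x - η x * N i j x)) := by
    have e1 : ∫ x, p x * η x * cv (newtonMass a) h x = -∑ i, ∫ x, p x * η x * N i i x := by
      rw [← integral_finsetSum _ fun i _ => iB i, ← integral_neg]
      simp_rw [cv_newtonMass ha hh, mul_neg, Finset.mul_sum]
      rfl
    have e2 : ∀ i, ∫ x, p x * (pd i (pd i φ) x - η x * N i i x)
        = (∫ x, p x * pd i (pd i φ) x) - ∫ x, p x * η x * N i i x := fun i => by
      rw [← integral_sub (iA i) (iB i)]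
      simp_rw [mul_sub, mul_assoc]
    have e3 : ∀ i j, ∫ x, w i j x * (pd i (pd j φ) x - η x * N i j x)
        = (∫ x, w i j x * pd i (pd j φ) x) - ∫ x, w i j x * η x * N i j x := fun i j => by
      rw [← integral_sub (iC i j) (iD i j)]
      simp_rw [mul_sub, mul_assoc]
    have e4 := hpde φ hφ hφc hφs
    simp_rw [Finset.mul_sum] at e4
    rw [integral_finsetSum _ fun i _ => iA i,
      integral_finsetSum _ fun i _ => integrable_finsetSum _ fun j _ => iC i j] at e4
    simp_rw [integral_finsetSum _ fun j _ => iC _ j] at e4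
    simp_rw [e1, e2, e3, add_sub_cancel, Finset.sum_sub_distrib, e4]
    ring
  have bp : ∀ i, |∫ x, p x * (pd i (pd i φ) x - η x * N i i x)|
      ≤ C₁ * R⁻¹ ^ 3 * I * ∫ x in T, |p x| := fun i =>
    abs_integral_mul_le_of_abs_le_indicator hTm hp fun x hx =>
      H₄ i i x (not_le.1 fun hc => hx (hp0 x hc))
  have bw : ∀ i j, |∫ x, w i j x * (pd i (pd j φ) x - η x * N i j x)|
      ≤ C₁ * R⁻¹ ^ 3 * I * ∫ x in T, |w i j x| := fun i j =>
    abs_integral_mul_le_of_abs_le_indicator hTm (hw i j) fun x hx =>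
      H₄ i j x (not_le.1 fun hc => hx (hw0 i j x hc))
  have iO : ∀ i j, Integrable ({x : E3 | 1 < ‖x‖}.indicator fun x => w i j x * η x) :=
    fun i j => (hwη i j).indicator hOm
  have split : ∀ i j, ∫ x, w i j x * η x * N i j x
      = (∫ x, {x : E3 | 1 < ‖x‖}.indicator (fun x => w i j x * η x) x * N i j x)
        + ∫ x, w i j x * {x : E3 | ‖x‖ ≤ 1}.indicator (fun x => η x * N i j x) x := fun i j => by
    have i2 : Integrable fun x =>
        w i j x * {x : E3 | ‖x‖ ≤ 1}.indicator (fun x => η x * N i j x) x := by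
      refine ((iD i j).indicator hBm).congr (Filter.Eventually.of_forall fun x => ?_)
      by_cases hx : x ∈ {x : E3 | ‖x‖ ≤ 1}
      · simp only [indicator_of_mem hx]; ring
      · simp only [indicator_of_notMem hx, mul_zero]
    refine Eq.trans ?_ (integral_add (integrable_mul_cv_newton₂ ha i j (iO i j) hh hhm) i2)
    refine integral_congr_ae (Filter.Eventually.of_forall fun x => ?_)
    beta_reduce
    by_cases hx : ‖x‖ ≤ 1
    · rw [indicator_of_mem (show x ∈ {x : E3 | ‖x‖ ≤ 1} from hx),
        indicator_of_notMem (show x ∉ {x : E3 | 1 < ‖x‖} from not_lt.2 hx)]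
      ring
    · rw [indicator_of_notMem (show x ∉ {x : E3 | ‖x‖ ≤ 1} from hx),
        indicator_of_mem (show x ∈ {x : E3 | 1 < ‖x‖} from not_le.1 hx)]
      ring
  have bin : ∀ i j, |∫ x, w i j x * {x : E3 | ‖x‖ ≤ 1}.indicator (fun x => η x * N i j x) x|
      ≤ I * ∫ x in {x : E3 | ‖x‖ ≤ 1}, |w i j x| := fun i j => by
    refine abs_integral_mul_le_of_abs_le_indicator hBm (hw i j) fun x _ => ?_
    by_cases hx : x ∈ {x : E3 | ‖x‖ ≤ 1}
    · rw [indicator_of_mem hx, indicator_of_mem hx, abs_mul]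
      have n2 := abs_cv_le_of_support (k := newton₂ i j a) (x := x) (by positivity) hh
        fun y hz => abs_newton₂_le ha two_pos i j (by
          have t1 := (hs _ hz).1
          have t2 := norm_sub_le x y
          have t3 : ‖x‖ ≤ 1 := hx
          linarith)
      have n3 := hηb x
      calc |η x| * |N i j x| ≤ 1 * (4 * (2 : ℝ)⁻¹ ^ 3 * I) := by
            gcongr
            exact n3
        _ ≤ I := by linarith
    · rw [indicator_of_notMem hx, indicator_of_notMem hx, abs_zero]
  have bcz : ∀ i j, ENNReal.ofReal
      |∫ x, {x : E3 | 1 < ‖x‖}.indicator (fun x => w i j x * η x) x * N i j x|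
      ≤ ENNReal.ofReal (max C₂ (3 * C₁ + 1)) *
        ∫⁻ x, ENNReal.ofReal (|{x : E3 | 1 < ‖x‖}.indicator (w i j) x| ^ Q + |h x| ^ P) :=
    fun i j => by
    refine (H₂ i j a _ h ha (iO i j) hh
      (((hwm i j).mul hη.continuous.measurable).indicator hOm) hhm).trans ?_
    have hle : ∀ x, |{x : E3 | 1 < ‖x‖}.indicator (fun x => w i j x * η x) x|
        ≤ |{x : E3 | 1 < ‖x‖}.indicator (w i j) x| := fun x => by
      by_cases hx : x ∈ {x : E3 | 1 < ‖x‖}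
      · rw [indicator_of_mem hx, indicator_of_mem hx, abs_mul]
        exact mul_le_of_le_one_right (abs_nonneg _) (hηb x)
      · rw [indicator_of_notMem hx, indicator_of_notMem hx]
    exact mul_le_mul' (ENNReal.ofReal_le_ofReal (le_max_left _ _)) (lintegral_mono fun x =>
      ENNReal.ofReal_le_ofReal
        (add_le_add (Real.rpow_le_rpow (abs_nonneg _) (hle x) hQP.nonneg) le_rfl))
  have main : |∫ x, p x * η x * cv (newtonMass a) h x| ≤
      (∑ i, ∑ j, |∫ x, {x : E3 | 1 < ‖x‖}.indicator (fun x => w i j x * η x) x * N i j x|)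
      + I * (max C₂ (3 * C₁ + 1) * ((∑ i, ∑ j, ∫ x in {x : E3 | ‖x‖ ≤ 1}, |w i j x|)
          + R⁻¹ ^ 3 * ((∫ x in T, |p x|) + ∑ i, ∑ j, ∫ x in T, |w i j x|))) := by
    have nn : ∀ (S : Set E3) (f : E3 → ℝ), 0 ≤ ∫ x in S, |f x| := fun S f =>
      integral_nonneg fun _ => abs_nonneg _
    have nB : 0 ≤ ∑ i, ∑ j, ∫ x in {x : E3 | ‖x‖ ≤ 1}, |w i j x| :=
      Finset.sum_nonneg fun i _ => Finset.sum_nonneg fun j _ => nn _ _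
    have nT : 0 ≤ ∑ i, ∑ j, ∫ x in T, |w i j x| :=
      Finset.sum_nonneg fun i _ => Finset.sum_nonneg fun j _ => nn _ _
    have nP := nn T p
    have s1 : |∑ i, ∫ x, p x * (pd i (pd i φ) x - η x * N i i x)|
        ≤ 3 * (C₁ * R⁻¹ ^ 3 * I * ∫ x in T, |p x|) := by
      refine (Finset.abs_sum_le_sum_abs _ _).trans
        ((Finset.sum_le_sum fun i _ => bp i).trans_eq ?_)
      simp
    have s2 : |∑ i, ∑ j, ((∫ x, w i j x * η x * N i j x)
          + ∫ x, w i j x * (pd i (pd j φ) x - η x * N i j x))|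
        ≤ ∑ i, ∑ j,
          (|∫ x, {x : E3 | 1 < ‖x‖}.indicator (fun x => w i j x * η x) x * N i j x|
            + I * (∫ x in {x : E3 | ‖x‖ ≤ 1}, |w i j x|)
            + C₁ * R⁻¹ ^ 3 * I * ∫ x in T, |w i j x|) := by
      refine (Finset.abs_sum_le_sum_abs _ _).trans (Finset.sum_le_sum fun i _ =>
        (Finset.abs_sum_le_sum_abs _ _).trans (Finset.sum_le_sum fun j _ => ?_))
      rw [split i j]
      refine (abs_add_three _ _ _).trans ?_
      gcongr
      · exact bin i j
      · exact bw i j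
    rw [key]
    refine (abs_add_le _ _).trans ((add_le_add s1 s2).trans ?_)
    simp_rw [Finset.sum_add_distrib, ← Finset.mul_sum]
    have m1 : 3 * C₁ + 1 ≤ max C₂ (3 * C₁ + 1) := le_max_right _ _
    set K := max C₂ (3 * C₁ + 1)
    set B := ∑ i, ∑ j, ∫ x in {x : E3 | ‖x‖ ≤ 1}, |w i j x|
    set W := ∑ i, ∑ j, ∫ x in T, |w i j x|
    set Y := ∫ x in T, |p x|
    have q1 : I * B ≤ I * B * K := le_mul_of_one_le_right (by positivity) (by linarith)
    have q2 : R⁻¹ ^ 3 * I * Y * (3 * C₁) ≤ R⁻¹ ^ 3 * I * Y * K := by gcongr; linarith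
    have q3 : R⁻¹ ^ 3 * I * W * C₁ ≤ R⁻¹ ^ 3 * I * W * K := by gcongr; linarith
    linarith
  refine (ENNReal.ofReal_le_ofReal main).trans (ENNReal.ofReal_add_le.trans ?_)
  gcongr
  rw [ENNReal.ofReal_sum_of_nonneg fun i _ => Finset.sum_nonneg fun j _ => abs_nonneg _]
  refine Finset.sum_le_sum fun i _ => ?_
  rw [ENNReal.ofReal_sum_of_nonneg fun j _ => abs_nonneg _]
  exact Finset.sum_le_sum fun j _ => bcz i j

lemma continuous_integral_mul_comp_sub {F h : E3 → ℝ} {M : ℝ} (hF : Integrable F)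
    (hh : Integrable h) (hhm : Measurable h) (hM : ∀ x, |h x| ≤ M) :
    Continuous fun z => ∫ x, F x * h (x - z) := by
  have hM0 : 0 ≤ M := (abs_nonneg _).trans (hM 0)
  have h_int : ∀ {f : E3 → ℝ}, Integrable f → ∀ z, Integrable fun x => f x * h (x - z) :=
    fun hf z => hf.mul_bdd (hhm.comp (measurable_sub_const z)).aestronglyMeasurable
      (Filter.Eventually.of_forall fun x => hM (x - z))
  refine continuous_of_uniform_approx_of_continuous fun u hu => ?_
  obtain ⟨ε, hε, hεu⟩ := Metric.mem_uniformity_dist.1 hu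
  obtain ⟨g, hgc, hg, hgcont, hgi⟩ := hF.exists_hasCompactSupport_integral_sub_le
    (ε := ε / (M + 1) / 2) (by positivity)
  refine ⟨fun z => ∫ x, g x * h (x - z), ?_, fun z => hεu ?_⟩
  · have e : (fun z => ∫ x, g x * h (x - z)) = fun z => ∫ x, g (x + z) * h x := funext fun z => by
      rw [← integral_add_right_eq_self _ z]
      simp
    rw [e]
    obtain ⟨C, hC⟩ := hgcont.bounded_above_of_compact_support hgc
    refine continuous_of_dominated (F := fun z x => g (x + z) * h x)
      (bound := fun x => C * |h x|) (fun z => ?_) (fun z => ?_) (hh.abs.const_mul C) ?_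
    · have : Continuous fun x => g (x + z) := by fun_prop
      exact this.aestronglyMeasurable.mul hhm.aestronglyMeasurable
    · refine Filter.Eventually.of_forall fun x => ?_
      rw [norm_mul]
      exact mul_le_mul_of_nonneg_right (hC _) (norm_nonneg _)
    · exact Filter.Eventually.of_forall fun x => by fun_prop
  · rw [Real.dist_eq, ← integral_sub (h_int hF z) (h_int hgi z)]
    have h1 : |∫ x, (F x * h (x - z) - g x * h (x - z))| ≤ ∫ x, ‖F x - g x‖ * M := by
      rw [← Real.norm_eq_abs]
      refine norm_integral_le_of_norm_le ((hF.sub hgi).norm.mul_const M)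
        (Filter.Eventually.of_forall fun x => ?_)
      rw [← sub_mul, norm_mul]
      exact mul_le_mul_of_nonneg_left (hM _) (norm_nonneg _)
    refine h1.trans_lt ?_
    rw [integral_mul_const]
    calc _ ≤ ε / (M + 1) / 2 * M := by gcongr
      _ ≤ ε / (M + 1) / 2 * (M + 1) := by gcongr; linarith
      _ = ε / 2 := by field_simp
      _ < ε := by linarith

lemma integrable_newtonMass_one : Integrable (newtonMass 1) := by
  have h := (integrable_rpow_neg_one_add_norm_sq (E := E3) (μ := volume) (r := 5)
    (by simp; norm_num)).const_mul 3
  refine h.congr (Filter.Eventually.of_forall fun x => ?_)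
  simp only [newtonMass]
  rw [add_comm, neg_div]
  norm_num

lemma integral_newtonMass_one_pos : 0 < ∫ x, newtonMass 1 x := by
  have hpos : ∀ x, 0 < newtonMass 1 x := fun x => by unfold newtonMass; positivity
  rw [integral_pos_iff_support_of_nonneg (fun x => (hpos x).le) integrable_newtonMass_one]
  rw [show Function.support (newtonMass 1) = univ from
    eq_univ_of_forall fun x => (hpos x).ne']
  simp

lemma newtonMass_smul {a : ℝ} (ha : 0 < a) (x : E3) :
    newtonMass a (a • x) = (a ^ 3)⁻¹ * newtonMass 1 x := by
  simp only [newtonMass]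
  have e : ‖a • x‖ ^ 2 + a ^ 2 = a ^ 2 * (‖x‖ ^ 2 + 1 ^ 2) := by
    rw [norm_smul, Real.norm_of_nonneg ha.le]; ring
  have e2 : (a ^ 2) ^ (-(5 / 2) : ℝ) = (a ^ 5)⁻¹ := by
    rw [← Real.rpow_natCast, ← Real.rpow_mul ha.le, ← Real.rpow_natCast a 5,
      ← Real.rpow_neg ha.le]
    norm_num
  rw [e, Real.mul_rpow (by positivity) (by positivity), e2]
  field_simp

lemma cv_newtonMass_eq {a : ℝ} (ha : 0 < a) (h : E3 → ℝ) (x : E3) :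
    cv (newtonMass a) h x = ∫ y, newtonMass 1 y * h (x - a • y) := by
  have h1 := Measure.integral_comp_smul (volume : Measure E3)
    (fun y => newtonMass a y * h (x - y)) a
  simp_rw [newtonMass_smul ha, mul_assoc, integral_const_mul] at h1
  have h2 : |(a ^ Module.finrank ℝ E3)⁻¹| = (a ^ 3)⁻¹ := by
    rw [abs_of_pos (by positivity)]; simp
  rw [h2, smul_eq_mul] at h1
  exact (mul_left_cancel₀ (by positivity) h1).symm

/-- The regularised kernels form an approximate identity, up to normalisation. -/
lemma tendsto_integral_mul_cv_newtonMass {F h : E3 → ℝ} {M : ℝ} (hF : Integrable F)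
    (hh : Integrable h) (hhm : Measurable h) (hM : ∀ x, |h x| ≤ M) :
    Filter.Tendsto (fun a => ∫ x, F x * cv (newtonMass a) h x) (nhdsWithin 0 (Ioi 0))
      (nhds ((∫ y, newtonMass 1 y) * ∫ x, F x * h x)) := by
  have hΘ := continuous_integral_mul_comp_sub hF hh hhm hM
  set Θ := fun z => ∫ x, F x * h (x - z) with hΘdef
  have hb : ∀ z, ‖Θ z‖ ≤ ∫ x, ‖F x‖ * M := fun z =>
    norm_integral_le_of_norm_le (hF.norm.mul_const M) (Filter.Eventually.of_forall fun x => by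
      rw [norm_mul]
      exact mul_le_mul_of_nonneg_left (hM _) (norm_nonneg _))
  have e : ∀ a, 0 < a → ∫ y, newtonMass 1 y * Θ (a • y) = ∫ x, F x * cv (newtonMass a) h x :=
    fun a ha => by
    have h_int : Integrable (Function.uncurry fun (y x : E3) =>
        newtonMass 1 y * (F x * h (x - a • y))) := by
      have h1 : Measurable fun z : E3 × E3 => h (z.2 - a • z.1) := by fun_prop
      have h2 := (integrable_newtonMass_one.mul_prod hF).mul_bdd h1.aestronglyMeasurable
        (Filter.Eventually.of_forall fun z => hM _)
      refine h2.congr (Filter.Eventually.of_forall fun z => ?_)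
      simp only [Function.uncurry]
      ring
    simp_rw [cv_newtonMass_eq ha, ← integral_const_mul, hΘdef, ← integral_const_mul]
    rw [integral_integral_swap h_int]
    simp_rw [mul_left_comm]
  have lim : Filter.Tendsto (fun a : ℝ => ∫ y, newtonMass 1 y * Θ (a • y)) (nhds 0)
      (nhds (∫ y, newtonMass 1 y * Θ 0)) := by
    refine tendsto_integral_filter_of_dominated_convergence
      (fun y => newtonMass 1 y * ∫ x, ‖F x‖ * M) ?_ ?_
      (integrable_newtonMass_one.mul_const _) ?_
    · exact Filter.Eventually.of_forall fun a =>
        integrable_newtonMass_one.aestronglyMeasurable.mul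
          (by fun_prop : Continuous fun y : E3 => Θ (a • y)).aestronglyMeasurable
    · refine Filter.Eventually.of_forall fun a => Filter.Eventually.of_forall fun y => ?_
      rw [norm_mul, Real.norm_of_nonneg (show 0 ≤ newtonMass 1 y by unfold newtonMass; positivity)]
      exact mul_le_mul_of_nonneg_left (hb _) (by unfold newtonMass; positivity)
    · refine Filter.Eventually.of_forall fun y => Filter.Tendsto.const_mul _ ?_
      have : Continuous fun a : ℝ => Θ (a • y) := by fun_prop
      simpa using this.tendsto 0
  have lim2 := lim.mono_left (nhdsWithin_le_nhds (s := Ioi 0))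
  rw [integral_mul_const] at lim2
  have e0 : Θ 0 = ∫ x, F x * h x := by simp [hΘdef]
  rw [e0] at lim2
  refine lim2.congr' ?_
  filter_upwards [self_mem_nhdsWithin] with a ha using e a ha

/-- A duality principle: a bound on the pairings of `p` with bounded functions, allowing a
homogeneous error term, bounds the `L^Q` norm of `p`. -/
lemma lintegral_rpow_le_of_pairing {A : Set E3} (hA : MeasurableSet A) (hAf : volume A ≠ ⊤)
    {P Q κ K X Y ε : ℝ} (hQP : Q.HolderConjugate P) (hK : 0 ≤ K) (hY : 0 ≤ Y) (hε : 0 < ε)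
    (hκ : 0 < κ) (hεκ : (K + 1) * ε ^ P ≤ κ * ε / 2) {p : E3 → ℝ} (hp : Integrable p)
    (hpm : Measurable p)
    (H : ∀ h : E3 → ℝ, Measurable h → (∃ M, ∀ x, |h x| ≤ M) → (∀ x, h x ≠ 0 → x ∈ A) →
      κ * |∫ x, p x * h x| ≤ K * (X + ∫ x, |h x| ^ P) + Y * ∫ x, |h x|) :
    ∫⁻ x in A, ENNReal.ofReal (|p x| ^ Q)
      ≤ ENNReal.ofReal ((κ * ε / 2)⁻¹ * (K * X + volume.real A * Y ^ Q)) := by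
  have hQ0 := hQP.pos
  have hP0 := hQP.symm.pos
  have hQ1 : 0 < Q - 1 := sub_pos.2 hQP.lt
  let m : ℕ → E3 → ℝ := fun n x => min |p x| n
  have hm0 : ∀ n x, 0 ≤ m n x := fun n x => le_min (abs_nonneg _) n.cast_nonneg
  have hmm : ∀ n, Measurable (m n) := fun n => hpm.abs.min measurable_const
  have hmono : ∀ x, Monotone fun n => ENNReal.ofReal (m n x ^ Q) := fun x n n' hn => by
    have h1 : m n x ≤ m n' x := min_le_min_left _ (by exact_mod_cast hn)
    exact ENNReal.ofReal_le_ofReal (Real.rpow_le_rpow (hm0 n x) h1 hQ0.le)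
  have hsup : ∀ x, ENNReal.ofReal (|p x| ^ Q) = ⨆ n, ENNReal.ofReal (m n x ^ Q) := fun x => by
    refine le_antisymm ?_ (iSup_le fun n => ENNReal.ofReal_le_ofReal
      (Real.rpow_le_rpow (hm0 n x) (min_le_left _ _) hQ0.le))
    obtain ⟨n, hn⟩ := exists_nat_ge |p x|
    refine le_iSup_of_le n ?_
    rw [show m n x = |p x| from min_eq_left hn]
  simp_rw [hsup]
  rw [lintegral_iSup (fun n => ((hmm n).pow_const Q).ennreal_ofReal) fun n n' hn x => hmono x hn]
  refine iSup_le fun n => ?_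
  have hfin : IsFiniteMeasure (volume.restrict A) := ⟨by simpa using hAf.lt_top⟩
  have bdd : ∀ {f : E3 → ℝ} {c : ℝ}, Measurable f → (∀ x, |f x| ≤ c) → IntegrableOn f A :=
    fun hf hc => Integrable.of_bound (hf.aestronglyMeasurable) _ (Filter.Eventually.of_forall hc)
  have hmpow : ∀ {b : ℝ}, 0 ≤ b → ∀ x, |m n x ^ b| ≤ (n : ℝ) ^ b := fun hb x => by
    rw [abs_of_nonneg (Real.rpow_nonneg (hm0 n x) _)]
    exact Real.rpow_le_rpow (hm0 n x) (min_le_right _ _) hb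
  have hZi : IntegrableOn (fun x => m n x ^ Q) A := bdd ((hmm n).pow_const Q) (hmpow hQ0.le)
  set Z := ∫ x in A, m n x ^ Q with hZ
  let g : E3 → ℝ := fun x => ε * (SignType.sign (p x) * m n x ^ (Q - 1))
  have hsgn : Measurable fun x => ((SignType.sign (p x) : SignType) : ℝ) := by
    have e : (fun x => ((SignType.sign (p x) : SignType) : ℝ))
        = fun x => if 0 < p x then 1 else if p x < 0 then -1 else 0 := by
      funext x
      rw [sign_apply]
      split_ifs <;> simp
    rw [e]
    exact Measurable.ite (measurableSet_lt measurable_const hpm) measurable_const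
      (Measurable.ite (measurableSet_lt hpm measurable_const) measurable_const measurable_const)
  have hgm : Measurable g := (hsgn.mul ((hmm n).pow_const _)).const_mul ε
  have hgabs : ∀ x, |g x| ≤ ε * m n x ^ (Q - 1) := fun x => by
    rw [abs_mul, abs_mul, abs_of_pos hε, abs_of_nonneg (Real.rpow_nonneg (hm0 n x) _)]
    gcongr
    refine mul_le_of_le_one_left (Real.rpow_nonneg (hm0 n x) _) ?_
    rcases lt_trichotomy (p x) 0 with h | h | h <;> simp [h]
  have hgb : ∀ x, |g x| ≤ ε * (n : ℝ) ^ (Q - 1) := fun x =>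
    (hgabs x).trans (by gcongr; exact min_le_right _ _)
  have hgP : ∀ x, |g x| ^ P ≤ ε ^ P * m n x ^ Q := fun x => by
    refine (Real.rpow_le_rpow (abs_nonneg _) (hgabs x) hP0.le).trans_eq ?_
    rw [Real.mul_rpow hε.le (Real.rpow_nonneg (hm0 n x) _), ← Real.rpow_mul (hm0 n x),
      hQP.sub_one_mul_conj]
  have hgPi : IntegrableOn (fun x => |g x| ^ P) A := bdd (hgm.abs.pow_const P)
    (c := (ε * (n : ℝ) ^ (Q - 1)) ^ P) fun x => by
      rw [abs_of_nonneg (Real.rpow_nonneg (abs_nonneg _) _)]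
      exact Real.rpow_le_rpow (abs_nonneg _) (hgb x) hP0.le
  have b1 : ∫ x in A, |g x| ^ P ≤ ε ^ P * Z := by
    rw [hZ, ← integral_const_mul]
    exact setIntegral_mono hgPi (hZi.const_mul _) hgP
  have b2 : Y * ∫ x in A, |g x| ≤ volume.real A * Y ^ Q + ∫ x in A, |g x| ^ P := by
    have e : volume.real A * Y ^ Q = ∫ x in A, Y ^ Q := by simp
    rw [e, ← integral_const_mul, ← integral_add (integrable_const _) hgPi]
    refine setIntegral_mono ((bdd hgm hgb).abs.const_mul Y)
      ((integrable_const _).add hgPi) fun x => ?_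
    refine (Real.young_inequality_of_nonneg hY (abs_nonneg (g x)) hQP).trans ?_
    have y1 : 0 ≤ Y ^ Q := Real.rpow_nonneg hY _
    have y2 : 0 ≤ |g x| ^ P := Real.rpow_nonneg (abs_nonneg _) _
    exact add_le_add (div_le_self y1 hQP.lt.le) (div_le_self y2 hQP.symm.lt.le)
  have b3 : ε * Z ≤ ∫ x in A, p x * g x := by
    rw [hZ, ← integral_const_mul]
    refine setIntegral_mono (hZi.const_mul _) (hp.integrableOn.mul_bdd hgm.aestronglyMeasurable
      (Filter.Eventually.of_forall hgb)) fun x => ?_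
    have e1 : p x * g x = ε * (|p x| * m n x ^ (Q - 1)) := by
      rw [← self_mul_sign]; ring
    rw [e1]
    have e2 : m n x ^ Q = m n x * m n x ^ (Q - 1) := by
      rcases (hm0 n x).eq_or_lt with h | h
      · rw [← h, Real.zero_rpow hQ0.ne', zero_mul]
      · rw [← Real.rpow_one_add' h.le (by linarith)]; ring_nf
    rw [e2]
    gcongr
    exact min_le_left _ _
  have key := H (A.indicator g) (hgm.indicator hA)
    ⟨ε * (n : ℝ) ^ (Q - 1), fun x => by
      by_cases hx : x ∈ A
      · rw [indicator_of_mem hx]; exact hgb x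
      · rw [indicator_of_notMem hx, abs_zero]
        exact mul_nonneg hε.le (Real.rpow_nonneg n.cast_nonneg _)⟩
    fun x hx => by_contra fun hxA => hx (indicator_of_notMem hxA g)
  have i1 : ∫ x, p x * A.indicator g x = ∫ x in A, p x * g x := by
    rw [← integral_indicator hA]
    congr 1 with x
    by_cases hx : x ∈ A <;> simp [hx]
  have i2 : ∫ x, |A.indicator g x| ^ P = ∫ x in A, |g x| ^ P := by
    rw [← integral_indicator hA]
    congr 1 with x
    by_cases hx : x ∈ A <;> simp [hx, Real.zero_rpow hP0.ne']
  have i3 : ∫ x, |A.indicator g x| = ∫ x in A, |g x| := by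
    rw [← integral_indicator hA]
    congr 1 with x
    by_cases hx : x ∈ A <;> simp [hx]
  rw [i1, i2, i3] at key
  have hZ0 : 0 ≤ Z := integral_nonneg fun x => Real.rpow_nonneg (hm0 n x) _
  rw [← ofReal_integral_eq_lintegral_ofReal hZi
    (Filter.Eventually.of_forall fun x => Real.rpow_nonneg (hm0 n x) _)]
  refine ENNReal.ofReal_le_ofReal ?_
  rw [← hZ, inv_mul_eq_div, le_div_iff₀ (by positivity)]
  have r1 := mul_le_mul_of_nonneg_left (b3.trans (le_abs_self _)) hκ.le
  have r2 := mul_le_mul_of_nonneg_left b1 hK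
  have r3 := mul_le_mul_of_nonneg_right hεκ hZ0
  linarith

lemma integrable_of_abs_le_of_support {A : Set E3} (hAf : volume A ≠ ⊤)
    {f : E3 → ℝ} {M : ℝ} (hf : Measurable f) (hM : ∀ x, |f x| ≤ M) (hs : ∀ x, f x ≠ 0 → x ∈ A) :
    Integrable f := by
  have hfin : IsFiniteMeasure (volume.restrict A) := ⟨by simpa using hAf.lt_top⟩
  have h : IntegrableOn f A :=
    Integrable.of_bound hf.aestronglyMeasurable _ (Filter.Eventually.of_forall hM)
  exact (integrableOn_iff_integrable_of_support_subset fun x hx => hs x hx).1 h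

lemma exists_pos_mul_rpow_le {κ K P : ℝ} (hκ : 0 < κ) (hK : 0 ≤ K) (hP : 1 < P) :
    ∃ ε, 0 < ε ∧ (K + 1) * ε ^ P ≤ κ * ε / 2 := by
  have hP1 : 0 < P - 1 := sub_pos.2 hP
  set b := κ / (2 * (K + 1)) with hb
  have hb0 : 0 < b := by positivity
  refine ⟨b ^ (P - 1)⁻¹, by positivity, le_of_eq ?_⟩
  have e : (b ^ (P - 1)⁻¹) ^ P = b ^ (P - 1)⁻¹ * b := by
    rw [← Real.rpow_mul hb0.le, ← Real.rpow_add_one hb0.ne']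
    congr 1
    field_simp
    ring
  rw [e, hb]
  field_simp

lemma measurableSet_annulus (a b : ℝ) : MeasurableSet {x : E3 | a < ‖x‖ ∧ ‖x‖ < b} :=
  (measurableSet_lt measurable_const measurable_norm).inter
    (measurableSet_lt measurable_norm measurable_const)

lemma volume_annulus_ne_top (a b : ℝ) : volume {x : E3 | a < ‖x‖ ∧ ‖x‖ < b} ≠ ⊤ :=
  measure_ne_top_of_subset (fun _ hx => mem_ball_zero_iff.2 hx.2) measure_ball_lt_top.ne

/-- The pressure estimate for globally integrable data vanishing outside a ball. -/
lemma exists_pressure_le {γ γ₁ γ₂ Q : ℝ} (h0 : 0 < γ) (h1 : γ < γ₁) (h12 : γ₁ < γ₂)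
    (h2 : γ₂ < 1) (hQ : 1 < Q) :
    ∃ C, 0 < C ∧ ∀ R, 4 / γ < R → ∀ (p : E3 → ℝ) (w : Fin 3 → Fin 3 → E3 → ℝ),
      Measurable p → Integrable p → (∀ i j, Measurable (w i j)) → (∀ i j, Integrable (w i j)) →
      (∀ x, R ≤ ‖x‖ → p x = 0) → (∀ i j x, R ≤ ‖x‖ → w i j x = 0) →
      (∀ φ : E3 → ℝ, ContDiff ℝ (⊤ : ℕ∞) φ → HasCompactSupport φ →
        tsupport φ ⊆ Metric.closedBall 0 (γ₂ * R) →
        ∫ x, p x * ∑ i, pd i (pd i φ) x = -∫ x, ∑ i, ∑ j, w i j x * pd i (pd j φ) x) →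
      ∫⁻ x in {x : E3 | 3 < ‖x‖ ∧ ‖x‖ < 4}, ENNReal.ofReal (|p x| ^ Q) ≤
        ENNReal.ofReal C * (∑ i, ∑ j,
          ∫⁻ x, ENNReal.ofReal (|{x : E3 | 1 < ‖x‖}.indicator (w i j) x| ^ Q))
        + ENNReal.ofReal (C * ((∑ i, ∑ j, ∫ x in {x : E3 | ‖x‖ ≤ 1}, |w i j x|)
          + R⁻¹ ^ 3 * ((∫ x in {x : E3 | γ * R < ‖x‖}, |p x|)
            + ∑ i, ∑ j, ∫ x in {x : E3 | γ * R < ‖x‖}, |w i j x|)) ^ Q) := by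
  have hQP : Q.HolderConjugate Q.conjExponent := Real.HolderConjugate.conjExponent hQ
  set P := Q.conjExponent
  obtain ⟨C, hC, H⟩ := exists_pairing_newtonMass_le h0 h1 h12 h2 hQP
  set κ := ∫ y, newtonMass 1 y with hκdef
  have hκ : 0 < κ := integral_newtonMass_one_pos
  obtain ⟨ε, hε, hεκ⟩ := exists_pos_mul_rpow_le hκ (show 0 ≤ 9 * C by positivity) hQP.symm.lt
  set A := {x : E3 | 3 < ‖x‖ ∧ ‖x‖ < 4}
  have hA : MeasurableSet A := measurableSet_annulus 3 4
  have hAf : volume A ≠ ⊤ := volume_annulus_ne_top 3 4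
  set c₁ := (κ * ε / 2)⁻¹ * (9 * C) with hc₁
  set c₂ := (κ * ε / 2)⁻¹ * (volume.real A * C ^ Q) with hc₂
  have hc₁0 : 0 < c₁ := by positivity
  have hc₂0 : 0 ≤ c₂ := by positivity
  refine ⟨c₁ + c₂, by positivity, fun R hR p w hpm hp hwm hw hp0 hw0 hpde => ?_⟩
  obtain ⟨η, hη, hη0, hη1, hηe, H'⟩ := H R hR
  set X := ∑ i, ∑ j, ∫⁻ x, ENNReal.ofReal (|{x : E3 | 1 < ‖x‖}.indicator (w i j) x| ^ Q)
    with hX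
  set W := (∑ i, ∑ j, ∫ x in {x : E3 | ‖x‖ ≤ 1}, |w i j x|)
          + R⁻¹ ^ 3 * ((∫ x in {x : E3 | γ * R < ‖x‖}, |p x|)
            + ∑ i, ∑ j, ∫ x in {x : E3 | γ * R < ‖x‖}, |w i j x|) with hW
  have hR0 : 0 < R := lt_trans (by positivity) hR
  have nn : ∀ (S : Set E3) (f : E3 → ℝ), 0 ≤ ∫ x in S, |f x| := fun S f =>
    integral_nonneg fun _ => abs_nonneg _
  have hW0 : 0 ≤ W := by
    have n1 : ∀ S, 0 ≤ ∑ i, ∑ j, ∫ x in S, |w i j x| := fun S =>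
      Finset.sum_nonneg fun i _ => Finset.sum_nonneg fun j _ => nn _ _
    exact add_nonneg (n1 _) (mul_nonneg (by positivity) (add_nonneg (nn _ _) (n1 _)))
  by_cases hXtop : X = ⊤
  · rw [hXtop, ENNReal.mul_top (by simpa using by positivity), top_add]
    exact le_top
  have hXr : X = ENNReal.ofReal X.toReal := (ENNReal.ofReal_toReal hXtop).symm
  have hηb : ∀ x, ‖η x‖ ≤ 1 := fun x => by
    rw [Real.norm_of_nonneg (hη0 x)]; exact hη1 x
  have hpη : Integrable fun x => p x * η x :=
    hp.mul_bdd hη.continuous.aestronglyMeasurable (Filter.Eventually.of_forall hηb)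
  have hiwm : ∀ i j, Measurable ({x : E3 | 1 < ‖x‖}.indicator (w i j)) := fun i j =>
    (hwm i j).indicator (measurableSet_lt measurable_const measurable_norm)
  have main := lintegral_rpow_le_of_pairing hA hAf (X := X.toReal) hQP
    (show 0 ≤ 9 * C by positivity) (show 0 ≤ C * W by positivity) hε hκ hεκ hp hpm
    fun h hhm ⟨M, hM⟩ hs => by
    have hh := integrable_of_abs_le_of_support hAf hhm hM hs
    have hhP : Integrable fun x => |h x| ^ P :=
      integrable_of_abs_le_of_support (M := M ^ P) hAf (hhm.abs.pow_const P)
        (fun x => by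
          rw [abs_of_nonneg (Real.rpow_nonneg (abs_nonneg _) _)]
          exact Real.rpow_le_rpow (abs_nonneg _) (hM x) hQP.symm.nonneg)
        fun x hx => hs x fun h0 => hx (by rw [h0, abs_zero, Real.zero_rpow hQP.symm.ne_zero])
    set G := ∫ x, |h x| ^ P with hG
    have hG0 : 0 ≤ G := integral_nonneg fun x => Real.rpow_nonneg (abs_nonneg _) _
    have eG : ∫⁻ x, ENNReal.ofReal (|h x| ^ P) = ENNReal.ofReal G :=
      (ofReal_integral_eq_lintegral_ofReal hhP
        (Filter.Eventually.of_forall fun x => Real.rpow_nonneg (abs_nonneg _) _)).symm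
    have lim := (tendsto_integral_mul_cv_newtonMass hpη hh hhm hM).abs
    have e1 : ∫ x, p x * η x * h x = ∫ x, p x * h x := by
      congr 1 with x
      by_cases hx : h x = 0
      · simp [hx]
      · have hx4 := (hs x hx).2
        rw [div_lt_iff₀ h0] at hR
        rw [hηe x (by nlinarith), mul_one]
    rw [e1, abs_mul, abs_of_pos hκ] at lim
    refine le_of_tendsto lim ?_
    filter_upwards [self_mem_nhdsWithin] with a ha
    have key := H' p w hp hwm hw hp0 hw0 hpde a ha h hh hhm hs
    have e2 : ∀ i j, ∫⁻ x, ENNReal.ofReal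
          (|{x : E3 | 1 < ‖x‖}.indicator (w i j) x| ^ Q + |h x| ^ P)
        = (∫⁻ x, ENNReal.ofReal (|{x : E3 | 1 < ‖x‖}.indicator (w i j) x| ^ Q))
          + ENNReal.ofReal G := fun i j => by
      rw [← eG, ← lintegral_add_left ((hiwm i j).abs.pow_const Q).ennreal_ofReal]
      congr 1 with x
      exact ENNReal.ofReal_add (Real.rpow_nonneg (abs_nonneg _) _)
        (Real.rpow_nonneg (abs_nonneg _) _)
    have e3 : ∑ i : Fin 3, ∑ j : Fin 3, ENNReal.ofReal C * ∫⁻ x, ENNReal.ofReal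
          (|{x : E3 | 1 < ‖x‖}.indicator (w i j) x| ^ Q + |h x| ^ P)
        = ENNReal.ofReal (C * (X.toReal + 9 * G)) := by
      simp_rw [e2, ← Finset.mul_sum, Finset.sum_add_distrib]
      rw [← hX, ENNReal.ofReal_mul hC.le, ENNReal.ofReal_add ENNReal.toReal_nonneg
        (by positivity), ← hXr, ENNReal.ofReal_mul (by norm_num)]
      simp
      ring_nf
    have hI0 : 0 ≤ ∫ x, |h x| := integral_nonneg fun _ => abs_nonneg _
    rw [e3, ← ENNReal.ofReal_add (by positivity) (by positivity),
      ENNReal.ofReal_le_ofReal_iff (by positivity)] at key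
    refine key.trans ?_
    have : 0 ≤ C * X.toReal := by positivity
    linarith
  refine main.trans ?_
  have e5 : (κ * ε / 2)⁻¹ * (9 * C * X.toReal + volume.real A * (C * W) ^ Q)
      = c₁ * X.toReal + c₂ * W ^ Q := by
    rw [Real.mul_rpow hC.le hW0]; ring
  have hWQ : 0 ≤ W ^ Q := Real.rpow_nonneg hW0 _
  rw [e5]
  refine ENNReal.ofReal_add_le.trans ?_
  rw [ENNReal.ofReal_mul hc₁0.le, ← hXr]
  gcongr
  · linarith
  · linarith

lemma pd_pd_eq_zero_of_notMem_tsupport {φ : E3 → ℝ} {x : E3} (hx : x ∉ tsupport φ) (i j : Fin 3) :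
    pd i (pd j φ) x = 0 := by
  have hopen : IsOpen (tsupport φ)ᶜ := (isClosed_tsupport φ).isOpen_compl
  exact pd_eq_zero_of_eqOn_const hopen (pd_eq_zero_of_eqOn_const hopen
    (fun y hy => image_eq_zero_of_notMem_tsupport hy) j) i x hx

/-- The pressure estimate for a stress tensor dominated by `‖v‖ ^ 2`. -/
lemma exists_pressure_le_of_dominated {γ γ₂ s : ℝ} (hγ : 0 < γ) (hγ₂ : γ < γ₂) (hγ₂' : γ₂ < 1)
    (hs : 2 < s) :
    ∃ c₁ c₂ : ℝ, ∀ R : ℝ, 4 / γ < R → ∀ v : E3 → E3, ∀ p : E3 → ℝ,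
      ∀ w : Fin 3 → Fin 3 → E3 → ℝ,
      IntegrableOn (fun x => ‖v x‖ ^ 2) (Metric.ball 0 R) →
      LocallyIntegrableOn p (Metric.ball 0 R) →
      (∀ i j, AEStronglyMeasurable (w i j) (volume.restrict (Metric.closedBall 0 (γ₂ * R)))) →
      (∀ i j x, |w i j x| ≤ ‖v x‖ ^ 2) →
      (∀ φ : E3 → ℝ, ContDiff ℝ (⊤ : ℕ∞) φ → HasCompactSupport φ →
        tsupport φ ⊆ Metric.closedBall 0 (γ₂ * R) →
        (∫ x in Metric.ball (0 : E3) R, p x * ∑ i, pd i (pd i φ) x)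
          = -∫ x in Metric.ball (0 : E3) R, ∑ i, ∑ j, w i j x * pd i (pd j φ) x) →
      (∫⁻ x in {x : E3 | 3 < ‖x‖ ∧ ‖x‖ < 4}, ENNReal.ofReal (|p x| ^ (s / 2)))
        ≤ ENNReal.ofReal c₁ *
            (∫⁻ x in Metric.ball (0 : E3) 1, ENNReal.ofReal (‖v x‖ ^ 2)) ^ (s / 2)
          + ENNReal.ofReal c₂ *
            (∫⁻ x in {x : E3 | 1 < ‖x‖ ∧ ‖x‖ < R}, ENNReal.ofReal (‖v x‖ ^ s))
          + ENNReal.ofReal c₁ *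
            (ENNReal.ofReal (R ^ (-3 : ℝ)) *
              ∫⁻ x in {x : E3 | γ * R < ‖x‖ ∧ ‖x‖ < R},
                ENNReal.ofReal (‖v x‖ ^ 2 + |p x|)) ^ (s / 2) := by
  set Q := s / 2 with hQdef
  have hQ : 1 < Q := by rw [hQdef]; linarith
  obtain ⟨C, hC, H⟩ := exists_pressure_le (γ₁ := (γ + γ₂) / 2) (Q := Q) hγ (by linarith)
    (by linarith) hγ₂' hQ
  refine ⟨C * (10 ^ Q * 2 ^ (Q - 1)), C * 9, fun R hR v p w hv hp hwm hwv hpde => ?_⟩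
  have hR0 : 0 < R := lt_trans (by positivity) hR
  have hγR : 4 < γ * R := by rwa [div_lt_iff₀ hγ, mul_comm] at hR
  set B := Metric.closedBall (0 : E3) (γ₂ * R) with hB
  have hBm : MeasurableSet B := measurableSet_closedBall
  have hBR : B ⊆ Metric.ball 0 R := Metric.closedBall_subset_ball (by nlinarith)
  have hpB : IntegrableOn p B :=
    hp.integrableOn_compact_subset hBR (isCompact_closedBall (0 : E3) (γ₂ * R))
  have hwB : ∀ i j, IntegrableOn (w i j) B := fun i j =>
    (hv.mono_set hBR).mono' (hwm i j) (Filter.Eventually.of_forall (hwv i j))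
  -- measurable representatives, extended by zero
  have rep : ∀ f : E3 → ℝ, IntegrableOn f B → ∃ g : E3 → ℝ, Measurable g ∧ Integrable g ∧
      (∀ x, x ∉ B → g x = 0) ∧ ∀ᵐ x, x ∈ B → g x = f x := fun f hf => by
    refine ⟨B.indicator (hf.1.mk f), hf.1.stronglyMeasurable_mk.measurable.indicator hBm,
      (integrable_indicator_iff hBm).2 (Integrable.congr hf hf.1.ae_eq_mk),
      fun x hx => indicator_of_notMem hx _, ?_⟩
    filter_upwards [(ae_restrict_iff' hBm).1 hf.1.ae_eq_mk] with x hx hxB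
    rw [indicator_of_mem hxB, hx hxB]
  obtain ⟨p', hpm', hpi', hp0', hpe'⟩ := rep p hpB
  choose w' hwm' hwi' hw0' hwe' using fun i j => rep (w i j) (hwB i j)
  have hout : ∀ x : E3, R ≤ ‖x‖ → x ∉ B := fun x hx hxB =>
    absurd (mem_ball_zero_iff.1 (hBR hxB)) (not_lt.2 hx)
  have hwall : ∀ᵐ x, ∀ i j, x ∈ B → w' i j x = w i j x :=
    ae_all_iff.2 fun i => ae_all_iff.2 fun j => hwe' i j
  have hpde' : ∀ φ : E3 → ℝ, ContDiff ℝ (⊤ : ℕ∞) φ → HasCompactSupport φ → tsupport φ ⊆ B →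
      ∫ x, p' x * ∑ i, pd i (pd i φ) x = -∫ x, ∑ i, ∑ j, w' i j x * pd i (pd j φ) x := by
    intro φ hφ hφc hφs
    have hz : ∀ x, x ∉ B → ∀ i j, pd i (pd j φ) x = 0 := fun x hx i j =>
      pd_pd_eq_zero_of_notMem_tsupport (fun h => hx (hφs h)) i j
    have t1 : ∀ f : E3 → ℝ, (∀ x, x ∉ B → f x = 0) →
        ∫ x in Metric.ball (0 : E3) R, f x = ∫ x, f x := fun f hf =>
      setIntegral_eq_integral_of_forall_compl_eq_zero fun x hx => hf x fun h => hx (hBR h)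
    have h := hpde φ hφ hφc hφs
    rw [t1 _ fun x hx => by simp [hz x hx], t1 _ fun x hx => by simp [hz x hx]] at h
    refine Eq.trans (integral_congr_ae ?_) (h.trans (congrArg _ (integral_congr_ae ?_)))
    · filter_upwards [hpe'] with x hx
      by_cases hxB : x ∈ B
      · rw [hx hxB]
      · simp [hz x hxB]
    · filter_upwards [hwall] with x hx
      by_cases hxB : x ∈ B
      · simp_rw [hx _ _ hxB]
      · simp [hz x hxB]
  have main := H R hR p' w' hpm' hpi' hwm' hwi' (fun x hx => hp0' x (hout x hx))
    (fun i j x hx => hw0' i j x (hout x hx)) hpde'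
  have hwle : ∀ᵐ x, ∀ i j, |w' i j x| ≤ ‖v x‖ ^ 2 := by
    filter_upwards [hwall] with x hx i j
    by_cases hxB : x ∈ B
    · rw [hx i j hxB]; exact hwv i j x
    · rw [hw0' i j x hxB, abs_zero]; positivity
  have hple : ∀ᵐ x, |p' x| ≤ |p x| := by
    filter_upwards [hpe'] with x hx
    by_cases hxB : x ∈ B
    · rw [hx hxB]
    · rw [hp0' x hxB, abs_zero]; exact abs_nonneg _
  set A := {x : E3 | 3 < ‖x‖ ∧ ‖x‖ < 4}
  set V₁ := ∫⁻ x in Metric.ball (0 : E3) 1, ENNReal.ofReal (‖v x‖ ^ 2)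
  set V₂ := ∫⁻ x in {x : E3 | 1 < ‖x‖ ∧ ‖x‖ < R}, ENNReal.ofReal (‖v x‖ ^ s)
  set V₃ := ∫⁻ x in {x : E3 | γ * R < ‖x‖ ∧ ‖x‖ < R}, ENNReal.ofReal (‖v x‖ ^ 2 + |p x|)
  have eA : ∫⁻ x in A, ENNReal.ofReal (|p x| ^ Q) = ∫⁻ x in A, ENNReal.ofReal (|p' x| ^ Q) := by
    refine setLIntegral_congr_fun_ae (measurableSet_annulus 3 4) ?_
    filter_upwards [hpe'] with x hx hxA
    rw [hx (mem_closedBall_zero_iff.2 (by nlinarith [hxA.2]))]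
  have b2 : ∀ i j, ∫⁻ x, ENNReal.ofReal (|{x : E3 | 1 < ‖x‖}.indicator (w' i j) x| ^ Q) ≤ V₂ :=
    fun i j => by
    refine le_of_le_of_eq ?_ (lintegral_indicator (measurableSet_annulus 1 R) _)
    refine lintegral_mono_ae ?_
    filter_upwards [hwle] with x hx
    by_cases h1 : 1 < ‖x‖
    · by_cases h2 : ‖x‖ < R
      · rw [indicator_of_mem (show x ∈ {x : E3 | 1 < ‖x‖ ∧ ‖x‖ < R} from ⟨h1, h2⟩),
          indicator_of_mem (show x ∈ {x : E3 | 1 < ‖x‖} from h1)]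
        refine ENNReal.ofReal_le_ofReal
          ((Real.rpow_le_rpow (abs_nonneg _) (hx i j) (by linarith)).trans_eq ?_)
        rw [← Real.rpow_natCast, ← Real.rpow_mul (norm_nonneg _), hQdef]
        congr 1
        push_cast
        ring
      · rw [indicator_of_mem (show x ∈ {x : E3 | 1 < ‖x‖} from h1),
          hw0' i j x (hout x (not_lt.1 h2)), abs_zero, Real.zero_rpow (by linarith)]
        simp
    · rw [indicator_of_notMem (show x ∉ {x : E3 | 1 < ‖x‖} from h1), abs_zero,
        Real.zero_rpow (by linarith)]
      simp
  have toL : ∀ (S : Set E3) (f : E3 → ℝ), Integrable f →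
      ENNReal.ofReal (∫ x in S, |f x|) = ∫⁻ x in S, ENNReal.ofReal |f x| := fun S f hf =>
    ofReal_integral_eq_lintegral_ofReal hf.abs.integrableOn
      (Filter.Eventually.of_forall fun _ => abs_nonneg _)
  have b1 : ∀ i j, ENNReal.ofReal (∫ x in {x : E3 | ‖x‖ ≤ 1}, |w' i j x|) ≤ V₁ := fun i j => by
    rw [toL _ _ (hwi' i j)]
    have e1 : {x : E3 | ‖x‖ ≤ 1} =ᵐ[volume] Metric.ball (0 : E3) 1 := by
      have e2 : {x : E3 | ‖x‖ ≤ 1} = Metric.closedBall 0 1 := by ext; simp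
      rw [e2]
      exact (ae_eq_of_subset_of_measure_ge Metric.ball_subset_closedBall
        (Measure.addHaar_closedBall_eq_addHaar_ball volume 0 1).le
        measurableSet_ball.nullMeasurableSet measure_closedBall_lt_top.ne).symm
    rw [setLIntegral_congr e1]
    refine lintegral_mono_ae (ae_restrict_of_ae ?_)
    filter_upwards [hwle] with x hx using ENNReal.ofReal_le_ofReal (hx i j)
  have b3 : ∀ f : E3 → ℝ, Integrable f → (∀ x, R ≤ ‖x‖ → f x = 0) →
      (∀ᵐ x, |f x| ≤ ‖v x‖ ^ 2 + |p x|) →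
      ENNReal.ofReal (∫ x in {x : E3 | γ * R < ‖x‖}, |f x|) ≤ V₃ := fun f hf hf0 hfle => by
    rw [toL _ _ hf, ← lintegral_indicator (measurableSet_lt measurable_const measurable_norm)]
    refine le_of_le_of_eq ?_ (lintegral_indicator (measurableSet_annulus (γ * R) R) _)
    refine lintegral_mono_ae ?_
    filter_upwards [hfle] with x hx
    by_cases h1 : γ * R < ‖x‖
    · rw [indicator_of_mem (show x ∈ {x : E3 | γ * R < ‖x‖} from h1)]
      by_cases h2 : ‖x‖ < R
      · rw [indicator_of_mem (show x ∈ {x : E3 | γ * R < ‖x‖ ∧ ‖x‖ < R} from ⟨h1, h2⟩)]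
        exact ENNReal.ofReal_le_ofReal hx
      · rw [hf0 x (not_lt.1 h2)]
        simp
    · rw [indicator_of_notMem (show x ∉ {x : E3 | γ * R < ‖x‖} from h1)]
      exact zero_le
  have b3p := b3 p' hpi' (fun x hx => hp0' x (hout x hx)) (by
    filter_upwards [hple] with x hx
    have : 0 ≤ ‖v x‖ ^ 2 := by positivity
    linarith)
  have b3w : ∀ i j, ENNReal.ofReal (∫ x in {x : E3 | γ * R < ‖x‖}, |w' i j x|) ≤ V₃ :=
    fun i j => b3 (w' i j) (hwi' i j) (fun x hx => hw0' i j x (hout x hx)) (by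
      filter_upwards [hwle] with x hx
      linarith [hx i j, abs_nonneg (p x)])
  have nn : ∀ (S : Set E3) (f : E3 → ℝ), 0 ≤ ∫ x in S, |f x| := fun S f =>
    integral_nonneg fun _ => abs_nonneg _
  have sumle : ∀ (g : Fin 3 → Fin 3 → ℝ≥0∞) (V : ℝ≥0∞), (∀ i j, g i j ≤ V) →
      ∑ i, ∑ j, g i j ≤ 9 * V := fun g V hg => by
    refine (Finset.sum_le_sum fun i _ => Finset.sum_le_sum fun j _ => hg i j).trans_eq ?_
    simp
    ring
  have sumR : ∀ S : Set E3, ENNReal.ofReal (∑ i, ∑ j, ∫ x in S, |w' i j x|)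
      = ∑ i, ∑ j, ENNReal.ofReal (∫ x in S, |w' i j x|) := fun S => by
    rw [ENNReal.ofReal_sum_of_nonneg fun i _ => Finset.sum_nonneg fun j _ => nn _ _]
    simp_rw [ENNReal.ofReal_sum_of_nonneg fun j _ => nn _ _]
  have hRr : ENNReal.ofReal (R⁻¹ ^ 3) = ENNReal.ofReal (R ^ (-3 : ℝ)) := by
    rw [Real.rpow_neg hR0.le, inv_pow]
    norm_cast
  rw [eA]
  refine main.trans ?_
  set W := (∑ i, ∑ j, ∫ x in {x : E3 | ‖x‖ ≤ 1}, |w' i j x|)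
          + R⁻¹ ^ 3 * ((∫ x in {x : E3 | γ * R < ‖x‖}, |p' x|)
            + ∑ i, ∑ j, ∫ x in {x : E3 | γ * R < ‖x‖}, |w' i j x|) with hW
  have n1 : ∀ S, 0 ≤ ∑ i, ∑ j, ∫ x in S, |w' i j x| := fun S =>
    Finset.sum_nonneg fun i _ => Finset.sum_nonneg fun j _ => nn _ _
  have hW0 : 0 ≤ W :=
    add_nonneg (n1 _) (mul_nonneg (by positivity) (add_nonneg (nn _ _) (n1 _)))
  have hWle : ENNReal.ofReal W ≤ 10 * (V₁ + ENNReal.ofReal (R ^ (-3 : ℝ)) * V₃) := by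
    rw [hW, ← hRr]
    refine ENNReal.ofReal_add_le.trans ?_
    rw [ENNReal.ofReal_mul (by positivity), sumR]
    have q1 := sumle _ _ b1
    have q3 := sumle _ _ b3w
    have q4 := add_le_add b3p q3
    rw [← sumR] at q4
    have q5 := ENNReal.ofReal_add_le.trans q4
    calc _ ≤ 9 * V₁ + ENNReal.ofReal (R⁻¹ ^ 3) * (V₃ + 9 * V₃) := by gcongr
      _ ≤ 10 * V₁ + ENNReal.ofReal (R⁻¹ ^ 3) * (V₃ + 9 * V₃) := by gcongr; norm_num
      _ = _ := by ring
  have hWQ : ENNReal.ofReal (W ^ Q)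
      ≤ ENNReal.ofReal (10 ^ Q * 2 ^ (Q - 1))
        * (V₁ ^ Q + (ENNReal.ofReal (R ^ (-3 : ℝ)) * V₃) ^ Q) := by
    rw [← ENNReal.ofReal_rpow_of_nonneg hW0 (by linarith)]
    refine (ENNReal.rpow_le_rpow hWle (by linarith)).trans ?_
    have e10 : ENNReal.ofReal (10 ^ Q) = 10 ^ Q := by
      rw [← ENNReal.ofReal_rpow_of_pos (by norm_num), ENNReal.ofReal_ofNat]
    have e2 : ENNReal.ofReal (2 ^ (Q - 1)) = 2 ^ (Q - 1) := by
      rw [← ENNReal.ofReal_rpow_of_pos (by norm_num), ENNReal.ofReal_ofNat]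
    rw [ENNReal.mul_rpow_of_nonneg _ _ (by linarith), ENNReal.ofReal_mul (by positivity), e10, e2,
      mul_assoc]
    gcongr
    exact ENNReal.rpow_add_le_mul_rpow_add_rpow _ _ hQ.le
  have q2 := sumle _ _ b2
  calc _ ≤ ENNReal.ofReal C * (9 * V₂) + ENNReal.ofReal C * (ENNReal.ofReal (10 ^ Q * 2 ^ (Q - 1))
        * (V₁ ^ Q + (ENNReal.ofReal (R ^ (-3 : ℝ)) * V₃) ^ Q)) := by
        rw [ENNReal.ofReal_mul hC.le]
        gcongr
    _ = _ := by
        rw [ENNReal.ofReal_mul hC.le (q := 9), ENNReal.ofReal_mul hC.le, ENNReal.ofReal_ofNat]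
        ring

lemma pd_coord (i j : Fin 3) : pd i (fun x : E3 => x j) = fun _ => kron i j := by
  funext x
  rw [pd, (hasFDerivAt_coord j x).fderiv, ← e3_apply]
  rfl

lemma pd_pd_coord_mul_coord (i j k l : Fin 3) (x : E3) :
    pd k (pd l (fun x : E3 => x i * x j)) x = kron k i * kron l j + kron l i * kron k j := by
  have hc : ∀ i : Fin 3, ContDiff ℝ (⊤ : ℕ∞) fun x : E3 => x i := fun i => by fun_prop
  have h0 : ∀ c : ℝ, pd k (fun _ : E3 => c) x = 0 := fun c =>
    pd_eq_zero_of_eqOn_const isOpen_univ (fun _ _ => rfl) k x (mem_univ x)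
  rw [pd_pd_mul (hc i) (hc j)]
  simp only [pd_coord, h0]
  ring

/-- The stress tensor is measurable if all its contractions with Hessians are. -/
lemma aestronglyMeasurable_stress {v : E3 → E3} {ρ R : ℝ} (hρ : 0 < ρ) (hρR : ρ < R)
    (H : ∀ φ : E3 → ℝ, ContDiff ℝ (⊤ : ℕ∞) φ → HasCompactSupport φ →
      tsupport φ ⊆ Metric.ball 0 R →
      AEStronglyMeasurable (fun x => ∑ i, ∑ j, v x i * v x j * pd i (pd j φ) x)
        (volume.restrict (Metric.ball 0 R))) (i j : Fin 3) :
    AEStronglyMeasurable (fun x => v x i * v x j)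
      (volume.restrict (Metric.closedBall 0 ρ)) := by
  let b : ContDiffBump (0 : E3) := ⟨(2 * ρ + R) / 3, (ρ + 2 * R) / 3, by linarith, by linarith⟩
  have hs : tsupport (fun x : E3 => b x * (x i * x j)) ⊆ Metric.ball 0 R := by
    refine (tsupport_mul_subset_left (f := b)).trans ?_
    rw [b.tsupport_eq]
    exact Metric.closedBall_subset_ball (show (ρ + 2 * R) / 3 < R by linarith)
  have h := (H (fun x => b x * (x i * x j)) (b.contDiff.mul (by fun_prop))
    b.hasCompactSupport.mul_right hs).mono_measure
    (Measure.restrict_mono (Metric.closedBall_subset_ball hρR) le_rfl)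
  refine (h.const_mul 2⁻¹).congr ((ae_restrict_iff' measurableSet_closedBall).2
    (Filter.Eventually.of_forall fun x hx => ?_))
  have hloc : ∀ᶠ y in nhds x, (fun x : E3 => b x * (x i * x j)) y = y i * y j := by
    refine Filter.eventually_of_mem (Metric.isOpen_ball.mem_nhds
      (Metric.closedBall_subset_ball (show ρ < (2 * ρ + R) / 3 by linarith) hx)) fun y hy => ?_
    simp [b.one_of_mem_closedBall (Metric.ball_subset_closedBall hy)]
  have hpd : ∀ k l, pd k (pd l fun x : E3 => b x * (x i * x j)) x
      = kron k i * kron l j + kron l i * kron k j := fun k l => by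
    rw [← pd_pd_coord_mul_coord]
    refine pd_congr ?_ k
    filter_upwards [hloc.eventually_nhds] with y hy using pd_congr hy l
  simp only [hpd]
  fin_cases i <;> fin_cases j <;> simp [kron, Fin.sum_univ_three] <;> ring

lemma integrable_mul_laplacian {p φ : E3 → ℝ} {R : ℝ}
    (hp : LocallyIntegrableOn p (Metric.ball 0 R)) (hφ : ContDiff ℝ (⊤ : ℕ∞) φ)
    (hφc : HasCompactSupport φ) (hφs : tsupport φ ⊆ Metric.ball 0 R) :
    Integrable fun x => p x * ∑ i, pd i (pd i φ) x := by
  have hm : MeasurableSet (tsupport φ) := (isClosed_tsupport φ).measurableSet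
  have h1 := (integrable_indicator_iff hm).2 (hp.integrableOn_compact_subset hφs hφc)
  refine (integrable_finsetSum Finset.univ fun i _ =>
    integrable_mul_pd_pd h1 hφ hφc i i).congr (Filter.Eventually.of_forall fun x => ?_)
  beta_reduce
  rw [← Finset.mul_sum]
  by_cases hx : x ∈ tsupport φ
  · rw [indicator_of_mem hx]
  · simp [pd_pd_eq_zero_of_notMem_tsupport hx]

/-- If some contraction of the stress tensor with a Hessian is not measurable, then the
distributional identity forces the pressure to be harmonic. -/
lemma integral_mul_laplacian_eq_zero {v : E3 → E3} {p φ₀ : E3 → ℝ} {R : ℝ}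
    (hp : LocallyIntegrableOn p (Metric.ball 0 R))
    (hpde : ∀ φ : E3 → ℝ, ContDiff ℝ (⊤ : ℕ∞) φ → HasCompactSupport φ →
      tsupport φ ⊆ Metric.ball 0 R →
      (∫ x in Metric.ball (0 : E3) R, p x * ∑ i, pd i (pd i φ) x)
        = -∫ x in Metric.ball (0 : E3) R, ∑ i, ∑ j, v x i * v x j * pd i (pd j φ) x)
    (hφ₀ : ContDiff ℝ (⊤ : ℕ∞) φ₀) (hφ₀c : HasCompactSupport φ₀)
    (hφ₀s : tsupport φ₀ ⊆ Metric.ball 0 R)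
    (hφ₀m : ¬ AEStronglyMeasurable (fun x => ∑ i, ∑ j, v x i * v x j * pd i (pd j φ₀) x)
      (volume.restrict (Metric.ball 0 R)))
    {φ : E3 → ℝ} (hφ : ContDiff ℝ (⊤ : ℕ∞) φ) (hφc : HasCompactSupport φ)
    (hφs : tsupport φ ⊆ Metric.ball 0 R) :
    ∫ x in Metric.ball (0 : E3) R, p x * ∑ i, pd i (pd i φ) x = 0 := by
  have key : ∀ ψ : E3 → ℝ, ContDiff ℝ (⊤ : ℕ∞) ψ → HasCompactSupport ψ →
      tsupport ψ ⊆ Metric.ball 0 R →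
      ¬ AEStronglyMeasurable (fun x => ∑ i, ∑ j, v x i * v x j * pd i (pd j ψ) x)
        (volume.restrict (Metric.ball 0 R)) →
      ∫ x in Metric.ball (0 : E3) R, p x * ∑ i, pd i (pd i ψ) x = 0 := fun ψ h1 h2 h3 h4 => by
    rw [hpde ψ h1 h2 h3, integral_non_aestronglyMeasurable h4, neg_zero]
  by_cases hm : AEStronglyMeasurable (fun x => ∑ i, ∑ j, v x i * v x j * pd i (pd j φ) x)
      (volume.restrict (Metric.ball 0 R))
  · have e : ∀ i j x, pd i (pd j fun x => φ x + φ₀ x) x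
        = pd i (pd j φ) x + pd i (pd j φ₀) x := fun i j x => by
      rw [pd_add hφ hφ₀, pd_add (contDiff_pd hφ j) (contDiff_pd hφ₀ j)]
    have h := key (fun x => φ x + φ₀ x) (hφ.add hφ₀) (hφc.add hφ₀c)
      ((tsupport_add φ φ₀).trans (union_subset hφs hφ₀s)) fun hadd => hφ₀m <| by
        refine (hadd.sub hm).congr (Filter.Eventually.of_forall fun x => ?_)
        simp only [Pi.sub_apply, e, mul_add, Finset.sum_add_distrib, add_sub_cancel_left]
    simp only [e, mul_add, Finset.sum_add_distrib] at h
    rw [integral_add (integrable_mul_laplacian hp hφ hφc hφs).integrableOn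
      (integrable_mul_laplacian hp hφ₀ hφ₀c hφ₀s).integrableOn,
      key φ₀ hφ₀ hφ₀c hφ₀s hφ₀m, add_zero] at h
    exact h
  · exact key φ hφ hφc hφs hm

/-- **Pressure estimate (Lemma 2).** Let `0 < γ < 1`, `s > 3`. There are constants
`c₁, c₂, c₃` (depending only on `s, γ`) such that whenever `R > 4/γ`,
`v ∈ L²(B_R) ∩ L^s_loc(B_R)`, `p ∈ L¹_loc(B_R)` and `Δp = −∂ᵢ∂ⱼ(vᵢvⱼ)` in the sense
of distributions in `B_R`, then (in `[0,∞]`)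
`∫_{3<|x|<4} |p|^{s/2} ≤ c₁ (∫_{|x|<1} |v|²)^{s/2} + c₂ ∫_{1<|x|<R} |v|^s
  + c₃ (R^{−3} ∫_{γR<|x|<R} (|v|² + |p|))^{s/2}`. -/
theorem stmt_14 (γ s : ℝ) (hγ0 : 0 < γ) (hγ1 : γ < 1) (hs : 3 < s) :
    ∃ c₁ c₂ c₃ : ℝ,
      ∀ R : ℝ, 4 / γ < R →
      ∀ v : E3 → E3, ∀ p : E3 → ℝ,
      IntegrableOn (fun x => ‖v x‖ ^ 2) (Metric.ball 0 R) →
      LocallyIntegrableOn (fun x => ‖v x‖ ^ s) (Metric.ball 0 R) →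
      LocallyIntegrableOn p (Metric.ball 0 R) →
      (∀ φ : E3 → ℝ, ContDiff ℝ (⊤ : ℕ∞) φ → HasCompactSupport φ →
        tsupport φ ⊆ Metric.ball 0 R →
        (∫ x in Metric.ball (0 : E3) R, p x * ∑ i, pd i (pd i φ) x)
          = -∫ x in Metric.ball (0 : E3) R, ∑ i, ∑ j, v x i * v x j * pd i (pd j φ) x) →
      (∫⁻ x in {x : E3 | 3 < ‖x‖ ∧ ‖x‖ < 4}, ENNReal.ofReal (|p x| ^ (s / 2)))
        ≤ ENNReal.ofReal c₁ *
            (∫⁻ x in Metric.ball (0 : E3) 1, ENNReal.ofReal (‖v x‖ ^ 2)) ^ (s / 2)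
          + ENNReal.ofReal c₂ *
            (∫⁻ x in {x : E3 | 1 < ‖x‖ ∧ ‖x‖ < R}, ENNReal.ofReal (‖v x‖ ^ s))
          + ENNReal.ofReal c₃ *
            (ENNReal.ofReal (R ^ (-3 : ℝ)) *
              ∫⁻ x in {x : E3 | γ * R < ‖x‖ ∧ ‖x‖ < R},
                ENNReal.ofReal (‖v x‖ ^ 2 + |p x|)) ^ (s / 2) := by
  obtain ⟨c₁, c₂, H⟩ := exists_pressure_le_of_dominated (γ₂ := (γ + 1) / 2) (s := s) hγ0
    (by linarith) (by linarith) (by linarith)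
  refine ⟨c₁, c₂, c₁, fun R hR v p hv _ hp hpde => ?_⟩
  have hR0 : 0 < R := lt_trans (by positivity) hR
  have hρR : (γ + 1) / 2 * R < R := by nlinarith
  have hsub := Metric.closedBall_subset_ball (x := (0 : E3)) hρR
  by_cases hm : ∀ φ : E3 → ℝ, ContDiff ℝ (⊤ : ℕ∞) φ → HasCompactSupport φ →
      tsupport φ ⊆ Metric.ball 0 R →
      AEStronglyMeasurable (fun x => ∑ i, ∑ j, v x i * v x j * pd i (pd j φ) x)
        (volume.restrict (Metric.ball 0 R))
  · exact H R hR v p (fun i j x => v x i * v x j) hv hp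
      (aestronglyMeasurable_stress (by positivity) hρR hm)
      (fun i j x => abs_coord_mul_le (v x) i j)
      fun φ hφ hφc hφs => hpde φ hφ hφc (hφs.trans hsub)
  · push Not at hm
    obtain ⟨φ₀, hφ₀, hφ₀c, hφ₀s, hφ₀m⟩ := hm
    refine H R hR v p (fun _ _ _ => 0) hv hp (fun _ _ => aestronglyMeasurable_const)
      (fun _ _ x => by rw [abs_zero]; positivity) fun φ hφ hφc hφs => ?_
    rw [integral_mul_laplacian_eq_zero hp hpde hφ₀ hφ₀c hφ₀s hφ₀m hφ hφc (hφs.trans hsub)]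
    simp
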